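/- Let Q be a quipu quiver with almost separate relations, and let the first relation along the main string of Q (the one whose source is closest to the start of the main string) have source s, target t and length l. Let Q' be identical to Q except for the following changes: the relation from s to t is removed, the main-string path of length l from s to t is replaced by a path s → t' → t of length 2, and a cord of length l−2 is attached at the new vertex t'. Then the algebra of Q and the algebra of Q' are derived equivalent. -/

import Mathlib

open CategoryTheory

/-- A finite quiver: a finite vertex type, an arrow type, and source/target maps. -/
structure PreQuiver where
  V : Type
  A : Type
  [fintV : Fintype V]
  s : A → V
  t : A → V

attribute [instance] PreQuiver.fintV

/-- The defining relations presenting the path algebra of the quiver `Q` over `k`, together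
with the zero relations given by the paths (lists of composable arrows) in `R`.  The
generators are the trivial paths `Sum.inl v` (one for each vertex) and the arrows
`Sum.inr a`; multiplication of generators corresponds to concatenation of paths, so that the
resulting algebra has as a basis the paths of `Q` (not passing through a relation of `R`). -/
inductive PathAlgRel (k : Type) [Field k] (Q : PreQuiver) (R : Set (List Q.A)) :
    FreeAlgebra k (Q.V ⊕ Q.A) → FreeAlgebra k (Q.V ⊕ Q.A) → Prop
  | idem (v : Q.V) :
      PathAlgRel k Q R (FreeAlgebra.ι k (Sum.inl v) * FreeAlgebra.ι k (Sum.inl v))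
        (FreeAlgebra.ι k (Sum.inl v))
  | orth (v w : Q.V) (h : v ≠ w) :
      PathAlgRel k Q R (FreeAlgebra.ι k (Sum.inl v) * FreeAlgebra.ι k (Sum.inl w)) 0
  | unit :
      PathAlgRel k Q R (∑ v : Q.V, FreeAlgebra.ι k (Sum.inl v)) 1
  | source (a : Q.A) :
      PathAlgRel k Q R (FreeAlgebra.ι k (Sum.inl (Q.s a)) * FreeAlgebra.ι k (Sum.inr a))
        (FreeAlgebra.ι k (Sum.inr a))
  | target (a : Q.A) :
      PathAlgRel k Q R (FreeAlgebra.ι k (Sum.inr a) * FreeAlgebra.ι k (Sum.inl (Q.t a)))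
        (FreeAlgebra.ι k (Sum.inr a))
  | zeroRel (p : List Q.A) (hp : p ∈ R) :
      PathAlgRel k Q R ((p.map fun a => FreeAlgebra.ι k (Sum.inr a)).prod) 0

/-- The path algebra of the quiver `Q` over the field `k`, modulo the two-sided ideal
generated by the zero relations in `R`. -/
abbrev PathAlgebraRel (k : Type) [Field k] (Q : PreQuiver) (R : Set (List Q.A)) : Type :=
  RingQuot (PathAlgRel k Q R)

/-- The path algebra of the quiver `Q` over the field `k`. -/
abbrev PathAlgebra (k : Type) [Field k] (Q : PreQuiver) : Type :=
  PathAlgebraRel k Q ∅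

noncomputable instance (C : Type*) [Category C] [Abelian C] : HasDerivedCategory C :=
  HasDerivedCategory.standard C

/-- Two `k`-algebras are *derived equivalent* if there is a triangulated equivalence between
the derived categories of their categories of right modules (i.e. of left modules over the
opposite rings). -/
def DerivedEquivalent (k : Type) [Field k] (A : Type) [Ring A] [Algebra k A]
    (B : Type) [Ring B] [Algebra k B] : Prop :=
  ∃ (F : DerivedCategory (ModuleCat.{0} Aᵐᵒᵖ) ⥤ DerivedCategory (ModuleCat.{0} Bᵐᵒᵖ))
    (c : F.CommShift ℤ), haveI := c; (F.IsTriangulated ∧ F.IsEquivalence)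

/-- The quipu quiver with main string `0 → 1 → ⋯ → (L-1)` (linearly oriented from left to
right) and, at each main-string vertex `v`, a cord with `c v` vertices, linearly oriented
away from the main string. -/
def quipuQuiver (L : ℕ) (c : Fin L → ℕ) : PreQuiver where
  V := Fin L ⊕ Σ v : Fin L, Fin (c v)
  A := Fin (L - 1) ⊕ Σ v : Fin L, Fin (c v)
  s := fun a =>
    match a with
    | Sum.inl i => Sum.inl ⟨i.1, by have := i.2; omega⟩
    | Sum.inr ⟨v, j⟩ =>
        if h : j.1 = 0 then Sum.inl v else Sum.inr ⟨v, ⟨j.1 - 1, by have := j.2; omega⟩⟩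
  t := fun a =>
    match a with
    | Sum.inl i => Sum.inl ⟨i.1 + 1, by have := i.2; omega⟩
    | Sum.inr x => Sum.inr x

/-- The path of length `l` along the main string of a quipu quiver, starting at the
main-string vertex `s`: it consists of the main-string arrows `s, s + 1, …, s + l - 1`. -/
def mainPath (L : ℕ) (c : Fin L → ℕ) (s l : ℕ) : List (quipuQuiver L c).A :=
  (List.range l).filterMap fun j =>
    if h : s + j < L - 1 then some (Sum.inl ⟨s + j, h⟩) else none

/-- Data for a quipu quiver with relations: a main string with `L` vertices, a cord with
`c v` vertices at each main-string vertex `v`, and a set of zero relations along the main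
string, each recorded as a pair `(s, l)` (start vertex and length). -/
structure QRData where
  L : ℕ
  c : Fin L → ℕ
  rels : Set (ℕ × ℕ)

/-- The conditions for a quipu quiver with relations to have *almost separate relations*:
every relation has length at least `2` and lies along the main string, no cord begins at an
internal vertex of a relation, and two distinct relations overlap in at most one arrow. -/
structure QRData.Valid (Q : QRData) : Prop where
  two_le : ∀ p ∈ Q.rels, 2 ≤ p.2
  end_lt : ∀ p ∈ Q.rels, p.1 + p.2 < Q.L
  no_cord_internal : ∀ p ∈ Q.rels, ∀ v : Fin Q.L, Q.c v ≠ 0 →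
    ¬(p.1 < v.1 ∧ v.1 < p.1 + p.2)
  almost_separate : ∀ p ∈ Q.rels, ∀ q ∈ Q.rels, p ≠ q →
    p.1 + p.2 ≤ q.1 + 1 ∨ q.1 + q.2 ≤ p.1 + 1

/-- The algebra of a quipu quiver with relations: the path algebra of the quipu quiver
modulo the two-sided ideal generated by the relation paths along the main string. -/
abbrev QRData.algebra (k : Type) [Field k] (Q : QRData) : Type :=
  PathAlgebraRel k (quipuQuiver Q.L Q.c)
    {p | ∃ q ∈ Q.rels, p = mainPath Q.L Q.c q.1 q.2}

/-- The transformation of the first relation of a quipu quiver with relations: the first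
relation `(s, l)` (source `s`, target `t = s + l`, length `l`) is removed, the main-string
path of length `l` from `s` to `t` is replaced by a path `s → t' → t` of length `2`, a cord
with `l - 2` vertices is attached at the new vertex `t' = s + 1`, and everything else is
kept (the remaining relations and cords being shifted accordingly). -/
def FirstSwap (Q : QRData) (s l : ℕ) (hlt : s + l < Q.L) (hl : 2 ≤ l) : QRData where
  L := Q.L + 2 - l
  c := fun v =>
    if h1 : v.1 ≤ s then Q.c ⟨v.1, by omega⟩
    else if h2 : v.1 = s + 1 then l - 2
    else Q.c ⟨v.1 + l - 2, by have := v.2; omega⟩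
  rels := (fun p : ℕ × ℕ => (p.1 + 2 - l, p.2)) '' (Q.rels \ {(s, l)})


open CategoryTheory

namespace QuipuDE
open CategoryTheory Category Limits HomologicalComplex CochainComplex CochainComplex.HomComplex Pretriangulated

universe v u v' u'

section Shift
variable {C : Type u} [Category.{v} C] [Preadditive C]

/-- tautological cochain `X → X⟦a⟧` of degree `-a` -/
noncomputable def sh (X : CochainComplex C ℤ) (a b : ℤ) (h : b + a = 0) : Cochain X (X⟦a⟧) b :=
  (Cochain.ofHom (𝟙 X)).rightShift a b h

/-- tautological cochain `X⟦a⟧ → X` of degree `a` -/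
noncomputable def un (X : CochainComplex C ℤ) (a : ℤ) : Cochain (X⟦a⟧) X a :=
  (Cochain.ofHom (𝟙 (X⟦a⟧))).rightUnshift a (by simp)

lemma sh_v (X : CochainComplex C ℤ) (a b : ℤ) (h : b + a = 0) (p q : ℤ) (hpq : p + b = q) :
    (sh X a b h).v p q hpq = (X.shiftFunctorObjXIso a q p (by omega)).inv := by
  simp [sh, Cochain.rightShift_v (Cochain.ofHom (𝟙 X)) a b h p q hpq p (by omega)]

lemma un_v (X : CochainComplex C ℤ) (a : ℤ) (p q : ℤ) (hpq : p + a = q) :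
    (un X a).v p q hpq = (X.shiftFunctorObjXIso a p q (by omega)).hom := by
  simp [un, Cochain.rightUnshift_v (Cochain.ofHom (𝟙 (X⟦a⟧))) a (by simp) p q hpq p (by omega)]

@[simp]
lemma δ_sh (X : CochainComplex C ℤ) (a b c : ℤ) (h : b + a = 0) : δ b c (sh X a b h) = 0 := by
  by_cases hc : b + 1 = c
  · rw [sh, Cochain.δ_rightShift _ a b c h 1 (by omega)]
    simp
  · exact δ_shape _ _ hc _

@[simp]
lemma δ_un (X : CochainComplex C ℤ) (a c : ℤ) : δ a c (un X a) = 0 := by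
  by_cases hc : a + 1 = c
  · rw [un, Cochain.δ_rightUnshift _ a _ c 1 (by omega)]
    simp
  · exact δ_shape _ _ hc _

@[simp]
lemma sh_comp_un (X : CochainComplex C ℤ) (a b : ℤ) (h : b + a = 0) :
    (sh X a b h).comp (un X a) h = Cochain.ofHom (𝟙 X) := by
  ext p
  rw [Cochain.comp_v _ _ h p (p + b) p rfl (by omega), sh_v, un_v]
  simp

@[simp]
lemma un_comp_sh (X : CochainComplex C ℤ) (a b : ℤ) (h : b + a = 0) :
    (un X a).comp (sh X a b h) (by omega : a + b = 0) = Cochain.ofHom (𝟙 (X⟦a⟧)) := by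
  ext p
  rw [Cochain.comp_v _ _ (by omega) p (p + a) p rfl (by omega), sh_v, un_v]
  simp

lemma un_naturality {X Y : CochainComplex C ℤ} (f : X ⟶ Y) (a : ℤ) :
    (Cochain.ofHom (f⟦a⟧')).comp (un Y a) (zero_add a) =
      (un X a).comp (Cochain.ofHom f) (add_zero a) := by
  ext p q hpq
  obtain rfl : q = p + a := hpq.symm
  rw [Cochain.zero_cochain_comp_v, Cochain.comp_zero_cochain_v, un_v, un_v]
  simp

lemma ofHom_ext_un {K L : CochainComplex C ℤ} {a : ℤ} {f g : K ⟶ L⟦a⟧}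
    (h : (Cochain.ofHom f).comp (un L a) (zero_add a) =
      (Cochain.ofHom g).comp (un L a) (zero_add a)) : f = g := by
  have h2 := congrArg (fun z => Cochain.comp z (sh L a (-a) (by omega)) (by omega : a + -a = 0)) h
  simp only [Cochain.comp_assoc_of_first_is_zero_cochain, un_comp_sh, Cochain.comp_id] at h2
  ext p
  have := congrArg (fun z => Cochain.v z p p (add_zero p)) h2
  simpa using this

end Shift

/-- A dg functor between categories of complexes. -/
structure DGFun (C : Type u) [Category.{v} C] [Preadditive C]
    (D : Type u') [Category.{v'} D] [Preadditive D] where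
  functor : CochainComplex C ℤ ⥤ CochainComplex D ℤ
  map : ∀ {X Y : CochainComplex C ℤ} {n : ℤ}, Cochain X Y n →+
    Cochain (functor.obj X) (functor.obj Y) n
  map_ofHom : ∀ {X Y : CochainComplex C ℤ} (f : X ⟶ Y),
    map (Cochain.ofHom f) = Cochain.ofHom (functor.map f)
  map_comp : ∀ {X Y Z : CochainComplex C ℤ} {n m nm : ℤ} (z : Cochain X Y n) (w : Cochain Y Z m)
    (h : n + m = nm), map (z.comp w h) = (map z).comp (map w) h
  map_δ : ∀ {X Y : CochainComplex C ℤ} {n m : ℤ} (z : Cochain X Y n),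
    map (δ n m z) = δ n m (map z)

namespace DGFun
variable {C : Type u} [Category.{v} C] [Preadditive C]
    {D : Type u'} [Category.{v'} D] [Preadditive D] (F : DGFun C D)

lemma map_id (X : CochainComplex C ℤ) :
    F.map (Cochain.ofHom (𝟙 X)) = Cochain.ofHom (𝟙 (F.functor.obj X)) := by
  rw [map_ofHom, CategoryTheory.Functor.map_id]

/-- morphism attached to a degree zero cochain with zero differential -/
noncomputable def homOf' {K L : CochainComplex D ℤ} (z : Cochain K L 0) (h : δ 0 1 z = 0) : K ⟶ L :=
  Cocycle.homOf (Cocycle.mk z 1 (by omega) h)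

@[simp]
lemma ofHom_homOf' {K L : CochainComplex D ℤ} (z : Cochain K L 0) (h : δ 0 1 z = 0) :
    Cochain.ofHom (homOf' z h) = z := by
  simp [homOf']

lemma hom_ext' {K L : CochainComplex D ℤ} {f g : K ⟶ L} (h : Cochain.ofHom f = Cochain.ofHom g) :
    f = g := by
  ext p
  have := congrArg (fun z => Cochain.v z p p (add_zero p)) h
  simpa using this

/-- the commutation with shifts -/
noncomputable def shiftIso (a : ℤ) (X : CochainComplex C ℤ) : F.functor.obj (X⟦a⟧) ≅ (F.functor.obj X)⟦a⟧ where
  hom := homOf' ((F.map (un X a)).comp (sh (F.functor.obj X) a (-a) (by omega)) (by omega : a + -a = 0))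
    (by rw [δ_comp _ _ _ (a+1) (-a+1) 1 (by omega) rfl rfl, ← F.map_δ]; simp)
  inv := homOf' ((un (F.functor.obj X) a).comp (F.map (sh X a (-a) (by omega))) (by omega : a + -a = 0))
    (by rw [δ_comp _ _ _ (a+1) (-a+1) 1 (by omega) rfl rfl, ← F.map_δ]; simp)
  hom_inv_id := hom_ext' (by
    rw [Cochain.ofHom_comp, ofHom_homOf', ofHom_homOf',
      Cochain.comp_assoc _ _ _ (by omega : a + -a = 0) (by omega : -a + 0 = -a) (by omega),
      ← Cochain.comp_assoc _ _ _ (by omega : -a + a = 0) (by omega : a + -a = 0) (by omega)]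
    simp only [sh_comp_un, Cochain.id_comp, ← F.map_comp, un_comp_sh, F.map_id])
  inv_hom_id := hom_ext' (by
    rw [Cochain.ofHom_comp, ofHom_homOf', ofHom_homOf',
      Cochain.comp_assoc _ _ _ (by omega : a + -a = 0) (by omega : -a + 0 = -a) (by omega),
      ← Cochain.comp_assoc _ _ _ (by omega : -a + a = 0) (by omega : a + -a = 0) (by omega)]
    simp only [← F.map_comp, sh_comp_un, F.map_id, Cochain.id_comp, un_comp_sh])

lemma shiftIso_hom_un (a : ℤ) (X : CochainComplex C ℤ) :
    (Cochain.ofHom (F.shiftIso a X).hom).comp (un (F.functor.obj X) a) (zero_add a) = F.map (un X a) := by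
  simp only [shiftIso, ofHom_homOf']
  rw [Cochain.comp_assoc _ _ _ (by omega : a + -a = 0) (by omega : -a + a = 0) (by omega)]
  simp

/-- shift compatibility natural iso -/
noncomputable def commShiftIso' (a : ℤ) :
    CategoryTheory.shiftFunctor (CochainComplex C ℤ) a ⋙ F.functor ≅ F.functor ⋙ CategoryTheory.shiftFunctor (CochainComplex D ℤ) a :=
  NatIso.ofComponents (fun X => F.shiftIso a X) (fun {X Y} f => ofHom_ext_un (by
    dsimp
    simp only [Cochain.ofHom_comp, Cochain.comp_assoc_of_first_is_zero_cochain, un_naturality]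
    rw [shiftIso_hom_un, ← Cochain.comp_assoc_of_first_is_zero_cochain, shiftIso_hom_un]
    simp only [← map_ofHom, ← F.map_comp, un_naturality]))

lemma un_zero (X : CochainComplex C ℤ) :
    un X 0 = Cochain.ofHom ((shiftFunctorZero (CochainComplex C ℤ) ℤ).hom.app X) := by
  ext p
  rw [un_v]
  simp [CochainComplex.shiftFunctorZero_hom_app_f]

lemma eqToHom_aux {A B B' B'' : C} (h1 : A = B) (h2 : B = B') (h3 : B' = B'') (h4 : A = B'') :
    eqToHom h4 = eqToHom h1 ≫ (eqToIso h2).hom ≫ eqToHom h3 := by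
  subst h1 h2 h3; simp

lemma un_add (X : CochainComplex C ℤ) (a b : ℤ) :
    un X (a + b) = (Cochain.ofHom ((shiftFunctorAdd (CochainComplex C ℤ) a b).hom.app X)).comp
      ((un (X⟦a⟧) b).comp (un X a) (add_comm b a)) (zero_add _) := by
  ext p q hpq
  rw [Cochain.zero_cochain_comp_v, Cochain.comp_v _ _ _ p (p + b) q rfl (by omega), un_v, un_v, un_v]
  simp [CochainComplex.shiftFunctorAdd_hom_app_f, HomologicalComplex.XIsoOfEq, eqToHom_trans]
  exact eqToHom_aux _ _ _ _

noncomputable instance : F.functor.CommShift ℤ where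
  commShiftIso := F.commShiftIso'
  commShiftIso_zero := by
    ext X : 3
    refine ofHom_ext_un ?_
    dsimp [commShiftIso']
    rw [shiftIso_hom_un, Functor.CommShift.isoZero_hom_app, Cochain.ofHom_comp,
      Cochain.comp_assoc_of_first_is_zero_cochain, un_zero, un_zero]
    simp only [← map_ofHom, ← Cochain.ofHom_comp]
    erw [Iso.inv_hom_id_app]
    simp
  commShiftIso_add a b := by
    ext X : 3
    refine ofHom_ext_un ?_
    dsimp [commShiftIso']
    rw [shiftIso_hom_un, Functor.CommShift.isoAdd_hom_app, un_add, un_add]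
    simp only [Cochain.ofHom_comp, F.map_comp, ← map_ofHom,
      Cochain.comp_assoc_of_first_is_zero_cochain, NatIso.ofComponents_hom_app]
    congr 1
    rw [← Cochain.comp_assoc_of_first_is_zero_cochain
      (Cochain.ofHom ((shiftFunctorAdd (CochainComplex D ℤ) a b).inv.app _)), ← Cochain.ofHom_comp]
    erw [Iso.inv_hom_id_app]
    rw [Cochain.id_comp]
    rw [← Cochain.comp_assoc_of_first_is_zero_cochain (Cochain.ofHom ((CategoryTheory.shiftFunctor (CochainComplex D ℤ) b).map _)),
      un_naturality, Cochain.comp_assoc_of_second_is_zero_cochain, shiftIso_hom_un,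
      ← Cochain.comp_assoc_of_first_is_zero_cochain, shiftIso_hom_un]

@[simp]
lemma commShiftIso_hom_un (a : ℤ) (X : CochainComplex C ℤ) :
    (Cochain.ofHom ((F.functor.commShiftIso a).hom.app X)).comp (un (F.functor.obj X) a) (zero_add a) = F.map (un X a) :=
  F.shiftIso_hom_un a X

end DGFun
end QuipuDE

open CategoryTheory

namespace QuipuDE
open CategoryTheory Category Limits HomologicalComplex CochainComplex CochainComplex.HomComplex Pretriangulated

universe v u v' u' w w'

namespace DGFun

section
variable {C : Type u} [Category.{v} C] [Preadditive C] [HasBinaryBiproducts C]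
    {D : Type u'} [Category.{v'} D] [Preadditive D] [HasBinaryBiproducts D] (F : DGFun C D)

/-- connecting morphism of a cone -/
noncomputable def cδ {X Y : CochainComplex C ℤ} (f : X ⟶ Y) : mappingCone f ⟶ X⟦(1 : ℤ)⟧ :=
  (mappingCone.triangle f).mor₃

lemma rightShift_comp_un {K L : CochainComplex C ℤ} {n : ℤ} (γ : Cochain K L n) (a n' : ℤ)
    (h : n' + a = n) : (γ.rightShift a n' h).comp (un L a) h = γ := by
  ext p q hpq
  rw [Cochain.comp_v _ _ h p (p + n') q rfl (by omega), un_v,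
    Cochain.rightShift_v γ a n' h p (p + n') rfl q hpq, assoc, Iso.inv_hom_id, comp_id]

lemma cδ_un {X Y : CochainComplex C ℤ} (f : X ⟶ Y) :
    (Cochain.ofHom (cδ f)).comp (un X 1) (zero_add 1) =
      - (mappingCone.fst f).1 := by
  have : Cochain.ofHom (cδ f) = (-(mappingCone.fst f).1).rightShift 1 0 (zero_add 1) := by
    simp [cδ, mappingCone.triangle]
  rw [this, rightShift_comp_un]

/-- a dg functor preserves mapping cones -/
noncomputable def coneIso {X Y : CochainComplex C ℤ} (f : X ⟶ Y) :
    mappingCone (F.functor.map f) ≅ F.functor.obj (mappingCone f) where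
  hom := mappingCone.desc _ (F.map (mappingCone.inl f)) (F.functor.map (mappingCone.inr f)) (by
    rw [← F.map_δ, ← Functor.map_comp, ← map_ofHom, mappingCone.δ_inl])
  inv := mappingCone.lift _ (Cocycle.mk (F.map (mappingCone.fst f).1) 2 (by omega)
      (by rw [← F.map_δ, Cocycle.δ_eq_zero, map_zero])) (F.map (mappingCone.snd f)) (by
    rw [← F.map_δ, mappingCone.δ_snd]
    simp [F.map_comp, map_ofHom])
  hom_inv_id := by
    apply hom_ext'
    simp only [Cochain.ofHom_comp, mappingCone.ofHom_desc, mappingCone.ofHom_lift]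
    rw [mappingCone.ext_cochain_to_iff _ 0 1 (by omega)]
    constructor
    · rw [Cochain.comp_assoc_of_first_is_zero_cochain, mappingCone.liftCochain_fst,
        mappingCone.ext_cochain_from_iff _ 0 1 (by omega),
        ← Cochain.comp_assoc_of_second_is_zero_cochain, mappingCone.inl_descCochain,
        ← Cochain.comp_assoc_of_first_is_zero_cochain, mappingCone.inr_descCochain]
      simp [← F.map_comp, ← F.map_ofHom]
      simp [map_ofHom]
    · rw [Cochain.comp_assoc_of_first_is_zero_cochain, mappingCone.liftCochain_snd,
        mappingCone.ext_cochain_from_iff _ (-1) 0 (by omega),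
        ← Cochain.comp_assoc_of_second_is_zero_cochain, mappingCone.inl_descCochain,
        ← Cochain.comp_assoc_of_first_is_zero_cochain, mappingCone.inr_descCochain]
      simp [← F.map_comp, ← F.map_ofHom]
      simp [map_ofHom]
  inv_hom_id := by
    apply hom_ext'
    simp only [Cochain.ofHom_comp, mappingCone.ofHom_desc, mappingCone.ofHom_lift]
    rw [mappingCone.liftCochain_descCochain, ← map_ofHom]
    simp only [Cocycle.mk_coe]
    rw [← F.map_comp, ← F.map_comp, ← map_add, mappingCone.id, map_id]

lemma inr_coneIso_hom {X Y : CochainComplex C ℤ} (f : X ⟶ Y) :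
    mappingCone.inr (F.functor.map f) ≫ (F.coneIso f).hom = F.functor.map (mappingCone.inr f) := by
  simp [coneIso]

lemma coneIso_hom_cδ {X Y : CochainComplex C ℤ} (f : X ⟶ Y) :
    (F.coneIso f).hom ≫ F.functor.map (cδ f) ≫ (F.functor.commShiftIso (1 : ℤ)).hom.app X =
      cδ (F.functor.map f) := by
  rw [← cancel_epi (F.coneIso f).inv, Iso.inv_hom_id_assoc]
  apply ofHom_ext_un
  simp only [Cochain.ofHom_comp, Cochain.comp_assoc_of_first_is_zero_cochain, cδ_un,
    commShiftIso_hom_un, ← map_ofHom, ← F.map_comp, map_neg, Cochain.comp_neg]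
  simp [coneIso]

/-- dg functors preserve standard triangles -/
noncomputable def mapTriangleIso {X Y : CochainComplex C ℤ} (f : X ⟶ Y) :
    F.functor.mapTriangle.obj (mappingCone.triangle f) ≅ mappingCone.triangle (F.functor.map f) :=
  Triangle.isoMk _ _ (Iso.refl _) (Iso.refl _) (F.coneIso f).symm (by
      change F.functor.map f ≫ 𝟙 _ = 𝟙 _ ≫ F.functor.map f
      simp) (by
      change F.functor.map (mappingCone.inr f) ≫ (F.coneIso f).inv =
        𝟙 _ ≫ mappingCone.inr (F.functor.map f)
      rw [Iso.comp_inv_eq, id_comp, inr_coneIso_hom]) (by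
      change (F.functor.map (cδ f) ≫ (F.functor.commShiftIso (1 : ℤ)).hom.app X) ≫ (𝟙 _)⟦(1 : ℤ)⟧' =
        (F.coneIso f).inv ≫ cδ (F.functor.map f)
      rw [Iso.eq_inv_comp, CategoryTheory.Functor.map_id]
      erw [comp_id]
      exact F.coneIso_hom_cδ f)

end

section
variable {C : Type u} [Category.{v} C] [Abelian C] [HasDerivedCategory.{w} C]
    {D : Type u'} [Category.{v'} D] [Abelian D] [HasDerivedCategory.{w'} D] (F : DGFun C D)
open DerivedCategory

/-- preservation of quasi-isos -/
class Exact' : Prop where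
  qi : ∀ {X Y : CochainComplex C ℤ} (f : X ⟶ Y), QuasiIso f → QuasiIso (F.functor.map f)

variable [F.Exact']

lemma inverts : (HomologicalComplex.quasiIso C (ComplexShape.up ℤ)).IsInvertedBy
    (F.functor ⋙ Q) := fun X Y f hf => by
  rw [HomologicalComplex.mem_quasiIso_iff] at hf
  have := Exact'.qi (F := F) f hf
  exact (isIso_Q_map_iff_quasiIso _ _).2 this

/-- the derived functor of an exact dg functor -/
noncomputable def der : DerivedCategory C ⥤ DerivedCategory D :=
  Localization.lift (F.functor ⋙ Q) F.inverts Q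

noncomputable instance : Localization.Lifting Q
    (HomologicalComplex.quasiIso C (ComplexShape.up ℤ)) (F.functor ⋙ Q) F.der :=
  inferInstanceAs (Localization.Lifting Q
    (HomologicalComplex.quasiIso C (ComplexShape.up ℤ)) (F.functor ⋙ Q) (Localization.lift _ _ _))

/-- compatibility with the localization functor -/
noncomputable def derFac : Q ⋙ F.der ≅ F.functor ⋙ Q :=
  Localization.Lifting.iso Q (HomologicalComplex.quasiIso C (ComplexShape.up ℤ)) _ _

noncomputable instance : F.der.CommShift ℤ :=
  Functor.commShiftOfLocalization Q (HomologicalComplex.quasiIso C (ComplexShape.up ℤ)) ℤ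
    (F.functor ⋙ Q) F.der

instance : NatTrans.CommShift F.derFac.hom ℤ :=
  NatTrans.commShift_iso_hom_of_localization Q
    (HomologicalComplex.quasiIso C (ComplexShape.up ℤ)) ℤ (F.functor ⋙ Q) F.der

instance : F.der.IsTriangulated where
  map_distinguished T hT := by
    rw [DerivedCategory.mem_distTriang_iff] at hT
    obtain ⟨X, Y, f, ⟨e⟩⟩ := hT
    rw [DerivedCategory.mem_distTriang_iff]
    refine ⟨_, _, F.functor.map f, ⟨?_⟩⟩
    exact F.der.mapTriangle.mapIso e ≪≫
      (Functor.mapTriangleCompIso Q F.der).symm.app _ ≪≫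
      (Functor.mapTriangleIso F.derFac).app _ ≪≫
      (Functor.mapTriangleCompIso F.functor Q).app _ ≪≫
      Q.mapTriangle.mapIso (F.mapTriangleIso f)

end
end DGFun
end QuipuDE

open CategoryTheory

namespace QuipuDE
open CategoryTheory Category Limits HomologicalComplex CochainComplex CochainComplex.HomComplex Pretriangulated

universe v u v' u' w w' v'' u''

section Ac
variable {C : Type u} [Category.{v} C] [Abelian C]

/-- acyclic complexes -/
def Ac (K : CochainComplex C ℤ) : Prop := QuasiIso (0 : K ⟶ K)

lemma ac_iff [HasDerivedCategory.{w} C] (K : CochainComplex C ℤ) :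
    Ac K ↔ IsZero (DerivedCategory.Q.obj K) := by
  rw [Ac, ← DerivedCategory.isIso_Q_map_iff_quasiIso, Functor.map_zero]
  constructor
  · intro h
    rw [IsZero.iff_id_eq_zero]
    have := IsIso.hom_inv_id (0 : DerivedCategory.Q.obj K ⟶ DerivedCategory.Q.obj K)
    rw [← this, zero_comp]
  · intro h
    exact ⟨0, h.eq_of_src _ _, h.eq_of_src _ _⟩

lemma ac_of_isZero {K : CochainComplex C ℤ} (h : ∀ i, IsZero (K.X i)) : Ac K := by
  have : (0 : K ⟶ K) = 𝟙 K := by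
    ext i; exact (h i).eq_of_src _ _
  rw [Ac, this]; infer_instance

lemma ac_of_iso {K L : CochainComplex C ℤ} (e : K ≅ L) (h : Ac K) : Ac L := by
  letI := HasDerivedCategory.standard C
  rw [ac_iff] at *
  exact h.of_iso (DerivedCategory.Q.mapIso e.symm)

lemma ac_shift {K : CochainComplex C ℤ} (a : ℤ) (h : Ac K) : Ac (K⟦a⟧) := by
  letI := HasDerivedCategory.standard C
  rw [ac_iff] at *
  refine IsZero.of_iso ?_ ((DerivedCategory.Q.commShiftIso a).app K)
  exact (CategoryTheory.shiftFunctor (DerivedCategory C) a).map_isZero h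

lemma qi_cδ {X Y : CochainComplex C ℤ} (f : X ⟶ Y) (h : Ac Y) : QuasiIso (DGFun.cδ f) := by
  letI := HasDerivedCategory.standard C
  rw [ac_iff] at h
  rw [← DerivedCategory.isIso_Q_map_iff_quasiIso]
  have h2 := (Triangle.isZero₂_iff_isIso₃ _ (DerivedCategory.mappingCone_triangle_distinguished f)).1 h
  have h3 : IsIso (DerivedCategory.Q.map (DGFun.cδ f) ≫ (DerivedCategory.Q.commShiftIso (1:ℤ)).hom.app X) := h2
  exact IsIso.of_isIso_comp_right _ ((DerivedCategory.Q.commShiftIso (1:ℤ)).hom.app X)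

lemma qi_inr {X Y : CochainComplex C ℤ} (f : X ⟶ Y) (h : Ac X) : QuasiIso (mappingCone.inr f) := by
  letI := HasDerivedCategory.standard C
  rw [ac_iff] at h
  rw [← DerivedCategory.isIso_Q_map_iff_quasiIso]
  exact (Triangle.isZero₁_iff_isIso₂ _ (DerivedCategory.mappingCone_triangle_distinguished f)).1 h

lemma ac_cone {X Y : CochainComplex C ℤ} (f : X ⟶ Y) (h : QuasiIso f) : Ac (mappingCone f) := by
  letI := HasDerivedCategory.standard C
  rw [ac_iff]
  rw [← DerivedCategory.isIso_Q_map_iff_quasiIso] at h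
  exact (Triangle.isZero₃_iff_isIso₁ _ (DerivedCategory.mappingCone_triangle_distinguished f)).2 h

lemma qi_shift {X Y : CochainComplex C ℤ} (f : X ⟶ Y) (a : ℤ) (h : QuasiIso f) : QuasiIso (f⟦a⟧') := by
  letI := HasDerivedCategory.standard C
  rw [← DerivedCategory.isIso_Q_map_iff_quasiIso] at *
  have e := DerivedCategory.Q.commShiftIso (C := CochainComplex C ℤ) a
  have h2 := (DerivedCategory.Q.commShiftIso (C := CochainComplex C ℤ) a).hom.naturality f
  dsimp at h2
  rw [← Iso.app_hom, ← Iso.app_hom, ← Iso.eq_comp_inv] at h2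
  rw [h2]
  infer_instance

lemma qi_of_cone {X Y X' Y' : CochainComplex C ℤ} {φ : X ⟶ Y} {φ' : X' ⟶ Y'}
    (f : mappingCone φ ⟶ mappingCone φ') (g₁ : X ⟶ X') (g₀ : Y ⟶ Y')
    (h : φ ≫ g₀ = g₁ ≫ φ') (h₀ : mappingCone.inr φ ≫ f = g₀ ≫ mappingCone.inr φ')
    (h₁ : f ≫ DGFun.cδ φ' = DGFun.cδ φ ≫ g₁⟦1⟧') (q₁ : QuasiIso g₁) (q₀ : QuasiIso g₀) :
    QuasiIso f := by
  letI := HasDerivedCategory.standard C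
  rw [← DerivedCategory.isIso_Q_map_iff_quasiIso] at *
  let τ : mappingCone.triangle φ ⟶ mappingCone.triangle φ' :=
    { hom₁ := g₁, hom₂ := g₀, hom₃ := f, comm₁ := h, comm₂ := h₀, comm₃ := h₁.symm }
  exact isIso₃_of_isIso₁₂ (DerivedCategory.Q.mapTriangle.map τ)
    (DerivedCategory.mappingCone_triangle_distinguished φ)
    (DerivedCategory.mappingCone_triangle_distinguished φ') q₁ q₀

end Ac

namespace DGFun

section
variable {C : Type u} [Category.{v} C] [Preadditive C]
    {D : Type u'} [Category.{v'} D] [Preadditive D]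
    {E : Type u''} [Category.{v''} E] [Preadditive E]

/-- the dg functor induced by an additive functor -/
@[simps]
noncomputable def ofFunctor (N : C ⥤ D) [N.Additive] : DGFun C D where
  functor := N.mapHomologicalComplex _
  map := { toFun := fun z => z.map N, map_zero' := Cochain.map_zero _ _ _ _, map_add' := fun _ _ => Cochain.map_add _ _ _ }
  map_ofHom f := Cochain.map_ofHom _ _ f N
  map_comp z w h := Cochain.map_comp _ z w h N
  map_δ z := (δ_map _ _ _ _).symm

/-- composition of dg functors -/
@[simps]
noncomputable def comp (F : DGFun C D) (G : DGFun D E) : DGFun C E where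
  functor := F.functor ⋙ G.functor
  map := G.map.comp F.map
  map_ofHom f := by simp [map_ofHom]
  map_comp z w h := by simp [map_comp]
  map_δ z := by simp [map_δ]

end

section
variable {C : Type u} [Category.{v} C] [Abelian C]
    {D : Type u'} [Category.{v'} D] [Abelian D] (F : DGFun C D)

instance (N : C ⥤ D) [N.Additive] [N.PreservesHomology] : (ofFunctor N).Exact' where
  qi f hf := inferInstanceAs (QuasiIso ((N.mapHomologicalComplex _).map f))

variable {F}

lemma qi_map_cδ {X Y : CochainComplex C ℤ} (f : X ⟶ Y) (h : Ac (F.functor.obj Y)) :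
    QuasiIso (F.functor.map (cδ f)) := by
  have h1 := qi_cδ (F.functor.map f) h
  rw [← coneIso_hom_cδ, quasiIso_iff_comp_left, quasiIso_iff_comp_right] at h1
  exact h1

lemma qi_map_inr {X Y : CochainComplex C ℤ} (f : X ⟶ Y) (h : Ac (F.functor.obj X)) :
    QuasiIso (F.functor.map (mappingCone.inr f)) := by
  rw [← inr_coneIso_hom]
  have h1 := qi_inr (F.functor.map f) h
  infer_instance

lemma ac_map_cone {X Y : CochainComplex C ℤ} (f : X ⟶ Y) (h : QuasiIso (F.functor.map f)) :
    Ac (F.functor.obj (mappingCone f)) :=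
  ac_of_iso (F.coneIso f) (ac_cone _ h)

end

end DGFun
end QuipuDE

open CategoryTheory

namespace QuipuDE
open CategoryTheory Category Limits HomologicalComplex CochainComplex CochainComplex.HomComplex Pretriangulated

universe v u v' u' w w' v'' u''

section cone
variable {C : Type u} [Category.{v} C] [Preadditive C]
    {D : Type u'} [Category.{v'} D] [Preadditive D]

/-- the morphism of complexes given by a natural transformation -/
noncomputable abbrev nat {N₁ N₀ : C ⥤ D} [N₁.Additive] [N₀.Additive] (η : N₁ ⟶ N₀)
    (X : CochainComplex C ℤ) : (N₁.mapHomologicalComplex _).obj X ⟶ (N₀.mapHomologicalComplex _).obj X :=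
  (NatTrans.mapHomologicalComplex η _).app X

lemma nat_cochain {N₁ N₀ : C ⥤ D} [N₁.Additive] [N₀.Additive] (η : N₁ ⟶ N₀)
    {X Y : CochainComplex C ℤ} {n : ℤ} (z : Cochain X Y n) :
    (Cochain.ofHom (nat η X)).comp (z.map N₀) (zero_add n) =
      (z.map N₁).comp (Cochain.ofHom (nat η Y)) (add_zero n) := by
  ext p q hpq
  simp only [Cochain.zero_cochain_comp_v, Cochain.comp_zero_cochain_v, Cochain.ofHom_v, Cochain.map_v]
  exact (η.naturality _).symm

variable [HasBinaryBiproducts D]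

/-- action of the cone dg functor on cochains -/
noncomputable def cmap {N₁ N₀ : C ⥤ D} [N₁.Additive] [N₀.Additive] (η : N₁ ⟶ N₀)
    {X Y : CochainComplex C ℤ} {n : ℤ} (z : Cochain X Y n) :
    Cochain (mappingCone (nat η X)) (mappingCone (nat η Y)) n :=
  n.negOnePow • (((mappingCone.fst (nat η X)).1.comp (z.map N₁) (add_comm 1 n)).comp
    (mappingCone.inl (nat η Y)) (by omega : n + 1 + (-1) = n)) +
  ((mappingCone.snd (nat η X)).comp (z.map N₀) (zero_add n)).comp
    (Cochain.ofHom (mappingCone.inr (nat η Y))) (add_zero n)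

section
variable {N₁ N₀ : C ⥤ D} [N₁.Additive] [N₀.Additive] (η : N₁ ⟶ N₀)
    {X Y : CochainComplex C ℤ} {n : ℤ} (z : Cochain X Y n)

lemma cmap_fst {m : ℤ} (h : n + 1 = m) : (cmap η z).comp (mappingCone.fst (nat η Y)).1 h =
    n.negOnePow • (mappingCone.fst (nat η X)).1.comp (z.map N₁) (by omega) := by
  subst h
  rw [cmap, Cochain.add_comp, Cochain.comp_assoc_of_second_is_zero_cochain, mappingCone.inr_fst,
    Cochain.comp_zero, add_zero, Cochain.units_smul_comp,
    Cochain.comp_assoc _ _ _ _ (by omega : -1 + 1 = 0) (by omega),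
    mappingCone.inl_fst, Cochain.comp_id]

lemma cmap_snd : (cmap η z).comp (mappingCone.snd (nat η Y)) (add_zero n) =
    (mappingCone.snd (nat η X)).comp (z.map N₀) (zero_add n) := by
  rw [cmap, Cochain.add_comp, Cochain.comp_assoc_of_second_is_zero_cochain, mappingCone.inr_snd,
    Cochain.comp_id, Cochain.units_smul_comp, Cochain.comp_assoc_of_third_is_zero_cochain,
    mappingCone.inl_snd, Cochain.comp_zero, smul_zero, zero_add]

lemma inr_cmap : (Cochain.ofHom (mappingCone.inr (nat η X))).comp (cmap η z) (zero_add n) =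
    (z.map N₀).comp (Cochain.ofHom (mappingCone.inr (nat η Y))) (add_zero n) := by
  rw [mappingCone.ext_cochain_to_iff _ n (n+1) rfl,
    Cochain.comp_assoc_of_first_is_zero_cochain, Cochain.comp_assoc_of_first_is_zero_cochain,
    cmap_fst, cmap_snd, Cochain.comp_assoc_of_second_is_zero_cochain, mappingCone.inr_fst,
    Cochain.comp_assoc_of_second_is_zero_cochain, mappingCone.inr_snd, Cochain.comp_units_smul]
  constructor
  · simp
  · simp

lemma inl_cmap {m : ℤ} (h : -1 + n = m) :
    (mappingCone.inl (nat η X)).comp (cmap η z) h =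
    n.negOnePow • (z.map N₁).comp (mappingCone.inl (nat η Y)) (by omega) := by
  rw [mappingCone.ext_cochain_to_iff _ m n (by omega),
    Cochain.comp_assoc _ _ _ h (rfl : n + 1 = n + 1) (by omega), cmap_fst,
    Cochain.comp_assoc_of_third_is_zero_cochain, cmap_snd]
  constructor
  · rw [Cochain.comp_units_smul, mappingCone.inl_fst_assoc, Cochain.units_smul_comp,
      Cochain.comp_assoc _ _ _ _ (by omega : -1 + 1 = 0) (by omega), mappingCone.inl_fst, Cochain.comp_id]
  · rw [mappingCone.inl_snd_assoc, Cochain.units_smul_comp, Cochain.comp_assoc_of_third_is_zero_cochain,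
      mappingCone.inl_snd, Cochain.comp_zero, smul_zero]

lemma cmap_comp {Z : CochainComplex C ℤ} {m nm : ℤ} (w : Cochain Y Z m) (h : n + m = nm) :
    cmap η (z.comp w h) = (cmap η z).comp (cmap η w) h := by
  subst h
  rw [mappingCone.ext_cochain_to_iff _ (n+m) (n+m+1) rfl]
  constructor
  · rw [cmap_fst, Cochain.comp_assoc _ _ _ rfl (rfl : m + 1 = m + 1) (by omega), cmap_fst,
      Cochain.comp_units_smul, ← Cochain.comp_assoc _ _ _ (rfl : n + 1 = n + 1) (by omega) (by omega),
      cmap_fst, Cochain.map_comp, Int.negOnePow_add, mul_comm, mul_smul, Cochain.units_smul_comp,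
      Cochain.comp_assoc _ _ _ _ _ (by omega)]
  · rw [cmap_snd, Cochain.comp_assoc_of_third_is_zero_cochain, cmap_snd,
      ← Cochain.comp_assoc_of_second_is_zero_cochain, cmap_snd, Cochain.map_comp,
      Cochain.comp_assoc_of_first_is_zero_cochain]

lemma cmap_id : cmap η (Cochain.ofHom (𝟙 X)) = Cochain.ofHom (𝟙 _) := by
  rw [mappingCone.ext_cochain_to_iff _ 0 1 rfl, cmap_fst, cmap_snd]
  simp

lemma cmap_δ (m : ℤ) : cmap η (δ n m z) = δ n m (cmap η z) := by
  by_cases h : n + 1 = m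
  swap
  · rw [δ_shape _ _ h, δ_shape _ _ h]; simp [cmap]
  subst h
  rw [cmap, cmap, δ_add, δ_units_smul, δ_comp_ofHom, δ_zero_cochain_comp _ _ _ rfl,
    mappingCone.δ_snd, δ_comp _ _ _ (n+1+1) 0 (n+1) rfl rfl rfl,
    δ_comp _ _ _ 2 (n+1) (n+1+1) rfl rfl rfl, Cocycle.δ_eq_zero, mappingCone.δ_inl, δ_map, δ_map]
  simp only [Cochain.zero_comp, smul_zero, add_zero, Cochain.neg_comp, Cochain.units_smul_comp, Cochain.add_comp,
    Cochain.ofHom_comp, smul_add, smul_neg, Int.negOnePow_succ, Int.negOnePow_neg, Int.negOnePow_one,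
    Units.neg_smul, one_smul, ]
  rw [Cochain.comp_assoc_of_second_is_zero_cochain, nat_cochain]
  simp only [Cochain.comp_assoc_of_second_is_zero_cochain, Cochain.comp_assoc_of_third_is_zero_cochain]
  abel
end
/-- action of the cone dg functor on morphisms -/
noncomputable def cmor {N₁ N₀ : C ⥤ D} [N₁.Additive] [N₀.Additive] (η : N₁ ⟶ N₀)
    {X Y : CochainComplex C ℤ} (f : X ⟶ Y) : mappingCone (nat η X) ⟶ mappingCone (nat η Y) :=
  DGFun.homOf' (cmap η (Cochain.ofHom f)) (by rw [← cmap_δ]; simp [cmap])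

section
variable {N₁ N₀ : C ⥤ D} [N₁.Additive] [N₀.Additive] (η : N₁ ⟶ N₀)
    {X Y : CochainComplex C ℤ} (f : X ⟶ Y)

lemma ofHom_cmor : Cochain.ofHom (cmor η f) = cmap η (Cochain.ofHom f) := by simp [cmor]

lemma inr_cmor : mappingCone.inr (nat η X) ≫ cmor η f =
    (N₀.mapHomologicalComplex _).map f ≫ mappingCone.inr (nat η Y) := by
  apply DGFun.hom_ext'
  rw [Cochain.ofHom_comp, ofHom_cmor, inr_cmap, Cochain.map_ofHom, ← Cochain.ofHom_comp]

lemma cmor_cδ : cmor η f ≫ DGFun.cδ (nat η Y) =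
    DGFun.cδ (nat η X) ≫ ((N₁.mapHomologicalComplex _).map f)⟦1⟧' := by
  apply ofHom_ext_un
  rw [Cochain.ofHom_comp, Cochain.comp_assoc_of_first_is_zero_cochain, DGFun.cδ_un,
    Cochain.ofHom_comp, Cochain.comp_assoc_of_first_is_zero_cochain, un_naturality,
    ← Cochain.comp_assoc_of_first_is_zero_cochain, DGFun.cδ_un, ofHom_cmor, Cochain.comp_neg, cmap_fst]
  simp
end

/-- the cone dg functor of a natural transformation -/
noncomputable def coneDG {N₁ N₀ : C ⥤ D} [N₁.Additive] [N₀.Additive] (η : N₁ ⟶ N₀) : DGFun C D where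
  functor :=
    { obj := fun X => mappingCone (nat η X)
      map := fun f => cmor η f
      map_id := fun X => DGFun.hom_ext' (by simp [ofHom_cmor, cmap_id])
      map_comp := fun f g => DGFun.hom_ext' (by simp [ofHom_cmor, Cochain.ofHom_comp, cmap_comp]) }
  map := { toFun := cmap η, map_zero' := by simp [cmap], map_add' := fun x y => by
            simp only [cmap, Cochain.map_add, Cochain.comp_add, Cochain.add_comp, smul_add]
            abel }
  map_ofHom f := by simp [ofHom_cmor]
  map_comp z w h := cmap_comp η z w h
  map_δ z := cmap_δ η z _

end cone
section
variable {C : Type u} [Category.{v} C] [Abelian C]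
    {D : Type u'} [Category.{v'} D] [Abelian D]

instance {N₁ N₀ : C ⥤ D} [N₁.Additive] [N₀.Additive] (η : N₁ ⟶ N₀) [N₁.PreservesHomology]
   [N₀.PreservesHomology] : (coneDG η).Exact' where
  qi {X Y} f hf :=
    qi_of_cone (cmor η f) ((N₁.mapHomologicalComplex _).map f) ((N₀.mapHomologicalComplex _).map f)
      (by simp) (inr_cmor η f) (cmor_cδ η f) inferInstance inferInstance
end
end QuipuDE

open CategoryTheory

namespace QuipuDE
open CategoryTheory Category Limits HomologicalComplex CochainComplex CochainComplex.HomComplex Pretriangulated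

universe v' u' w w' v'' u'' v u

/-- mutation data between two abelian categories -/
structure Mut (A : Type u) [Category.{v} A] [Abelian A] (B : Type u') [Category.{v'} B] [Abelian B] where
  N₁ : A ⥤ B
  N₀ : A ⥤ B
  M₁ : B ⥤ A
  M₀ : B ⥤ A
  [aN₁ : N₁.Additive]
  [aN₀ : N₀.Additive]
  [aM₁ : M₁.Additive]
  [aM₀ : M₀.Additive]
  [hN₁ : N₁.PreservesHomology]
  [hN₀ : N₀.PreservesHomology]
  [hM₁ : M₁.PreservesHomology]
  [hM₀ : M₀.PreservesHomology]
  η : N₁ ⟶ N₀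
  θ : M₁ ⟶ M₀
  zN : ∀ Y, IsZero (N₁.obj (M₁.obj Y))
  zM : ∀ X, IsZero (M₀.obj (N₀.obj X))
  α : ∀ Y, Y ⟶ N₁.obj (M₀.obj Y)
  α_nat : ∀ {Y Y' : B} (f : Y ⟶ Y'), f ≫ α Y' = α Y ≫ N₁.map (M₀.map f)
  β : ∀ Y, Y ⟶ N₀.obj (M₁.obj Y)
  β_nat : ∀ {Y Y' : B} (f : Y ⟶ Y'), f ≫ β Y' = β Y ≫ N₀.map (M₁.map f)
  αβ : ∀ Y, α Y ≫ η.app (M₀.obj Y) = β Y ≫ N₀.map (θ.app Y)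
  a : ∀ X, M₀.obj (N₁.obj X) ⟶ X
  a_nat : ∀ {X X' : A} (f : X ⟶ X'), a X ≫ f = M₀.map (N₁.map f) ≫ a X'
  b : ∀ X, M₁.obj (N₀.obj X) ⟶ X
  b_nat : ∀ {X X' : A} (f : X ⟶ X'), b X ≫ f = M₁.map (N₀.map f) ≫ b X'
  ab : ∀ X, M₁.map (η.app X) ≫ b X = θ.app (N₁.obj X) ≫ a X

namespace Mut
attribute [instance] aN₁ aN₀ aM₁ aM₀ hN₁ hN₀ hM₁ hM₀
variable {A : Type u} [Category.{v} A] [Abelian A] {B : Type u'} [Category.{v'} B] [Abelian B] (m : Mut A B)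

/-- action of an additive functor on complexes -/
noncomputable abbrev cx {A : Type u} [Category.{v} A] [Preadditive A] {B : Type u'} [Category.{v'} B] [Preadditive B] (N : A ⥤ B) [N.Additive] :
    CochainComplex A ℤ ⥤ CochainComplex B ℤ := N.mapHomologicalComplex _

/-- complex version of `α` -/
@[simps]
noncomputable def cα (Y : CochainComplex B ℤ) : Y ⟶ (cx m.N₁).obj ((cx m.M₀).obj Y) where
  f i := m.α _
  comm' i j _ := (m.α_nat _).symm

/-- complex version of `β` -/
@[simps]
noncomputable def cβ (Y : CochainComplex B ℤ) : Y ⟶ (cx m.N₀).obj ((cx m.M₁).obj Y) where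
  f i := m.β _
  comm' i j _ := (m.β_nat _).symm

/-- complex version of `a` -/
@[simps]
noncomputable def ca (X : CochainComplex A ℤ) : (cx m.M₀).obj ((cx m.N₁).obj X) ⟶ X where
  f i := m.a _
  comm' i j _ := m.a_nat _

/-- complex version of `b` -/
@[simps]
noncomputable def cb (X : CochainComplex A ℤ) : (cx m.M₁).obj ((cx m.N₀).obj X) ⟶ X where
  f i := m.b _
  comm' i j _ := m.b_nat _

lemma cα_nat {Y Y' : CochainComplex B ℤ} (f : Y ⟶ Y') :
    f ≫ m.cα Y' = m.cα Y ≫ (cx m.N₁).map ((cx m.M₀).map f) := by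
  ext i; exact m.α_nat _

lemma cβ_nat {Y Y' : CochainComplex B ℤ} (f : Y ⟶ Y') :
    f ≫ m.cβ Y' = m.cβ Y ≫ (cx m.N₀).map ((cx m.M₁).map f) := by
  ext i; exact m.β_nat _

lemma ca_nat {Y Y' : CochainComplex A ℤ} (f : Y ⟶ Y') :
    m.ca Y ≫ f = (cx m.M₀).map ((cx m.N₁).map f) ≫ m.ca Y' := by
  ext i; exact m.a_nat _

lemma cb_nat {Y Y' : CochainComplex A ℤ} (f : Y ⟶ Y') :
    m.cb Y ≫ f = (cx m.M₁).map ((cx m.N₀).map f) ≫ m.cb Y' := by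
  ext i; exact m.b_nat _

lemma cαβ (Y : CochainComplex B ℤ) :
    m.cα Y ≫ nat m.η ((cx m.M₀).obj Y) = m.cβ Y ≫ (cx m.N₀).map (nat m.θ Y) := by
  ext i; exact m.αβ _

lemma cab (X : CochainComplex A ℤ) :
    (cx m.M₁).map (nat m.η X) ≫ m.cb X = nat m.θ ((cx m.N₁).obj X) ≫ m.ca X := by
  ext i; exact m.ab _

/-- first component of the unit -/
noncomputable def ψ₁ (Y : CochainComplex B ℤ) :
    Cocycle (Y⟦(1 : ℤ)⟧) ((cx m.N₁).obj (mappingCone (nat m.θ Y))) 1 :=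
  Cocycle.mk ((un Y 1).comp (Cochain.ofHom (m.cα Y ≫ (cx m.N₁).map (mappingCone.inr (nat m.θ Y)))) (add_zero 1)) 2
      rfl (by rw [δ_comp_ofHom]; simp)

lemma ψ₁_coe (Y : CochainComplex B ℤ) : (m.ψ₁ Y).1 =
    (un Y 1).comp (Cochain.ofHom (m.cα Y ≫ (cx m.N₁).map (mappingCone.inr (nat m.θ Y)))) (add_zero 1) := rfl

/-- the unit -/
noncomputable def ψ (Y : CochainComplex B ℤ) :
    Y⟦(1 : ℤ)⟧ ⟶ mappingCone (nat m.η (mappingCone (nat m.θ Y))) :=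
  mappingCone.lift _
    (m.ψ₁ Y)
    (- (un Y 1).comp ((Cochain.ofHom (m.cβ Y)).comp ((mappingCone.inl (nat m.θ Y)).map m.N₀) (zero_add (-1)))
      (by omega : 1 + (-1) = 0))
    (by
      rw [δ_neg, δ_comp _ _ _ 2 0 1 rfl rfl rfl, δ_un, δ_ofHom_comp, δ_map, mappingCone.δ_inl]
      simp only [Cochain.zero_comp, smul_zero, add_zero, ψ₁_coe, Cochain.map_ofHom,
        Cochain.comp_assoc_of_third_is_zero_cochain]
      rw [← Cochain.comp_neg, ← Cochain.comp_add, ← Cochain.ofHom_comp, ← Cochain.ofHom_comp]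
      have : (m.cα Y ≫ (cx m.N₁).map (mappingCone.inr (nat m.θ Y))) ≫ nat m.η (mappingCone (nat m.θ Y)) =
         m.cβ Y ≫ (cx m.N₀).map (nat m.θ Y ≫ mappingCone.inr (nat m.θ Y)) := by
        rw [Functor.map_comp, ← assoc, ← cαβ]; simp
      rw [this]; simp)

/-- the counit -/
noncomputable def κ (X : CochainComplex A ℤ) :
    mappingCone (nat m.θ (mappingCone (nat m.η X))) ⟶ X⟦(1 : ℤ)⟧ :=
  mappingCone.desc _
    (((mappingCone.snd (nat m.η X)).map m.M₁).comp
      ((Cochain.ofHom (m.cb X)).comp (sh X 1 (-1) (by omega)) (zero_add _)) (zero_add _))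
    (DGFun.homOf' (((mappingCone.fst (nat m.η X)).1.map m.M₀).comp
      ((Cochain.ofHom (m.ca X)).comp (sh X 1 (-1) (by omega)) (zero_add _)) (by omega : 1 + (-1) = 0))
      (by
        rw [δ_comp _ _ _ 2 0 1 rfl rfl rfl, δ_ofHom_comp, δ_map]; simp [-Cochain.map_ofHom]))
    (by
      rw [δ_zero_cochain_comp _ _ 0 rfl, δ_ofHom_comp, δ_map, mappingCone.δ_snd, Cochain.ofHom_comp, DGFun.ofHom_homOf',
        ← Cochain.comp_assoc_of_first_is_zero_cochain (Cochain.ofHom (nat m.θ _)), nat_cochain]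
      simp only [δ_sh, Cochain.comp_zero, zero_add, Cochain.map_neg, Cochain.neg_comp, Int.negOnePow_neg, Int.negOnePow_one, Units.neg_smul, one_smul, neg_neg,
        Cochain.map_comp, Cochain.map_ofHom]
      rw [Cochain.comp_assoc_of_second_is_zero_cochain, Cochain.comp_assoc_of_second_is_zero_cochain,
        ← Cochain.comp_assoc_of_first_is_zero_cochain, ← Cochain.comp_assoc_of_first_is_zero_cochain,
        ← Cochain.ofHom_comp, ← Cochain.ofHom_comp, cab])

lemma ψ_nat {Y Y' : CochainComplex B ℤ} (f : Y ⟶ Y') :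
    f⟦(1 : ℤ)⟧' ≫ m.ψ Y' = m.ψ Y ≫ cmor m.η (cmor m.θ f) := by
  apply DGFun.hom_ext'
  rw [mappingCone.ext_cochain_to_iff _ 0 1 rfl, Cochain.ofHom_comp, Cochain.ofHom_comp]
  constructor
  · rw [Cochain.comp_assoc_of_first_is_zero_cochain, Cochain.comp_assoc_of_first_is_zero_cochain, ofHom_cmor,
      cmap_fst, ψ, mappingCone.ofHom_lift, mappingCone.liftCochain_fst]
    rw [Cochain.comp_units_smul, ← Cochain.comp_assoc_of_third_is_zero_cochain, ψ, mappingCone.ofHom_lift, mappingCone.liftCochain_fst,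
      ψ₁_coe, ψ₁_coe, ← Cochain.comp_assoc_of_third_is_zero_cochain, un_naturality,
      Cochain.comp_assoc_of_third_is_zero_cochain, Cochain.map_ofHom, Cochain.comp_assoc_of_third_is_zero_cochain,
      ← Cochain.ofHom_comp, ← Cochain.ofHom_comp]
    rw [← assoc, cα_nat, assoc, assoc, ← Functor.map_comp, ← Functor.map_comp, inr_cmor]
    simp
  · rw [Cochain.comp_assoc_of_first_is_zero_cochain, Cochain.comp_assoc_of_first_is_zero_cochain, ofHom_cmor,
      cmap_snd, ψ, mappingCone.ofHom_lift, mappingCone.liftCochain_snd,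
      ← Cochain.comp_assoc_of_third_is_zero_cochain, ψ, mappingCone.ofHom_lift, mappingCone.liftCochain_snd]
    rw [Cochain.comp_neg, Cochain.neg_comp, ← Cochain.comp_assoc_of_first_is_zero_cochain, un_naturality,
      Cochain.comp_assoc_of_second_is_zero_cochain, ← Cochain.comp_assoc_of_first_is_zero_cochain,
      ← Cochain.ofHom_comp, cβ_nat, Cochain.comp_assoc_of_third_is_zero_cochain,
      Cochain.comp_assoc_of_third_is_zero_cochain, ← Cochain.map_comp, ofHom_cmor, inl_cmap]
    simp [Cochain.ofHom_comp]

lemma sh_naturality {X Y : CochainComplex A ℤ} (f : X ⟶ Y) (a b : ℤ) (h : b + a = 0) :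
    (sh X a b h).comp (Cochain.ofHom (f⟦a⟧')) (add_zero b) =
      (Cochain.ofHom f).comp (sh Y a b h) (zero_add b) := by
  have h1 := un_naturality f a
  have h2 := congrArg (fun z => (sh X a b h).comp (Cochain.comp z (sh Y a b h) (by omega : a + b = 0)) (add_zero b)) h1
  simp only [Cochain.comp_assoc_of_first_is_zero_cochain, un_comp_sh, Cochain.comp_id] at h2
  rw [h2, Cochain.comp_assoc_of_second_is_zero_cochain, ← Cochain.comp_assoc _ _ _ h (by omega) (by omega), sh_comp_un, Cochain.id_comp]

/-- second component of the counit -/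
noncomputable def κ₀ (X : CochainComplex A ℤ) : (cx m.M₀).obj (mappingCone (nat m.η X)) ⟶ X⟦(1 : ℤ)⟧ :=
  DGFun.homOf' (((mappingCone.fst (nat m.η X)).1.map m.M₀).comp
      ((Cochain.ofHom (m.ca X)).comp (sh X 1 (-1) (by omega)) (zero_add _)) (by omega : 1 + (-1) = 0))
      (by
        rw [δ_comp _ _ _ 2 0 1 rfl rfl rfl, δ_ofHom_comp, δ_map]; simp [-Cochain.map_ofHom])

lemma ofHom_κ₀ (X : CochainComplex A ℤ) : Cochain.ofHom (m.κ₀ X) =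
    (((mappingCone.fst (nat m.η X)).1.map m.M₀).comp
      ((Cochain.ofHom (m.ca X)).comp (sh X 1 (-1) (by omega)) (zero_add _)) (by omega : 1 + (-1) = 0)) := by
  simp [κ₀]

lemma inr_κ (X : CochainComplex A ℤ) : mappingCone.inr _ ≫ m.κ X = m.κ₀ X := by
  simp [κ, κ₀]

lemma inl_κ (X : CochainComplex A ℤ) : (mappingCone.inl _).comp (Cochain.ofHom (m.κ X)) (add_zero _) =
    (((mappingCone.snd (nat m.η X)).map m.M₁).comp
      ((Cochain.ofHom (m.cb X)).comp (sh X 1 (-1) (by omega)) (zero_add _)) (zero_add _)) := by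
  simp [κ]

lemma κ_nat {X X' : CochainComplex A ℤ} (f : X ⟶ X') :
    cmor m.θ (cmor m.η f) ≫ m.κ X' = m.κ X ≫ f⟦(1 : ℤ)⟧' := by
  apply DGFun.hom_ext'
  rw [mappingCone.ext_cochain_from_iff _ (-1) 0 rfl]
  constructor
  · rw [Cochain.ofHom_comp, Cochain.ofHom_comp, ← Cochain.comp_assoc_of_second_is_zero_cochain, ofHom_cmor, inl_cmap,
      ← Cochain.comp_assoc_of_second_is_zero_cochain, inl_κ,
      Int.negOnePow_zero, one_smul, Cochain.comp_assoc_of_first_is_zero_cochain, inl_κ,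
      ← Cochain.comp_assoc_of_first_is_zero_cochain, ← Cochain.map_comp, ofHom_cmor, cmap_snd, Cochain.map_comp,
      Cochain.map_ofHom, Cochain.map_ofHom, Cochain.comp_assoc_of_third_is_zero_cochain,
      Cochain.comp_assoc_of_third_is_zero_cochain, Cochain.comp_assoc_of_first_is_zero_cochain, sh_naturality,
      ← Cochain.comp_assoc_of_first_is_zero_cochain (Cochain.ofHom _), ← Cochain.comp_assoc_of_first_is_zero_cochain (Cochain.ofHom _),
      ← Cochain.ofHom_comp, ← Cochain.ofHom_comp, cb_nat]
  · rw [← Cochain.ofHom_comp, ← Cochain.ofHom_comp, ← assoc, ← assoc, inr_κ, inr_cmor, assoc, inr_κ,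
      Cochain.ofHom_comp, Cochain.ofHom_comp, ofHom_κ₀, ofHom_κ₀, ← Cochain.map_ofHom,
      ← Cochain.comp_assoc_of_first_is_zero_cochain, ← Cochain.map_comp, ofHom_cmor, cmap_fst,
      Int.negOnePow_zero, one_smul, Cochain.map_comp,
      Cochain.map_ofHom, Cochain.map_ofHom, 
      Cochain.comp_assoc_of_third_is_zero_cochain, Cochain.comp_assoc_of_second_is_zero_cochain, Cochain.comp_assoc_of_first_is_zero_cochain, sh_naturality,
      ← Cochain.comp_assoc_of_first_is_zero_cochain (Cochain.ofHom _), ← Cochain.comp_assoc_of_first_is_zero_cochain (Cochain.ofHom _),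
      ← Cochain.ofHom_comp, ← Cochain.ofHom_comp, ca_nat]

end Mut
end QuipuDE

open CategoryTheory

namespace QuipuDE
open CategoryTheory Category Limits HomologicalComplex CochainComplex CochainComplex.HomComplex Pretriangulated

universe v u v' u' w w' v'' u''

section
variable {A : Type u} [Category.{v} A] [Abelian A] {B : Type u'} [Category.{v'} B] [Abelian B]

lemma quasiIso_of_family {ι : Type*} (H : ι → A ⥤ B) [∀ i, (H i).Additive] [∀ i, (H i).PreservesHomology]
    (hH : ∀ {X Y : A} (f : X ⟶ Y), (∀ i, IsIso ((H i).map f)) → IsIso f)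
    {K L : CochainComplex A ℤ} (f : K ⟶ L)
    (h : ∀ i, QuasiIso (((H i).mapHomologicalComplex _).map f)) : QuasiIso f := by
  rw [quasiIso_iff]
  intro n
  rw [quasiIsoAt_iff]
  let φ := (shortComplexFunctor A (ComplexShape.up ℤ) n).map f
  have γ : ShortComplex.LeftHomologyMapData φ (K.sc n).leftHomologyData (L.sc n).leftHomologyData := default
  refine γ.quasiIso_iff.2 ?_
  apply hH
  intro i
  have h1 := (quasiIso_iff _).1 (h i) n
  rw [quasiIsoAt_iff] at h1
  exact (γ.map (H i)).quasiIso_iff.1 h1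

lemma qi_neg {K L : CochainComplex A ℤ} {f : K ⟶ L} (h : QuasiIso f) : QuasiIso (-f) := by
  have : -f = f ≫ (-(𝟙 L)) := by simp
  have h2 : IsIso (-(𝟙 L)) := ⟨-(𝟙 L), by simp, by simp⟩
  rw [this]; infer_instance

lemma qi_map_shift (F : DGFun A B) {K L : CochainComplex A ℤ} (f : K ⟶ L) (h : QuasiIso (F.functor.map f)) :
    QuasiIso (F.functor.map (f⟦(1 : ℤ)⟧')) := by
  have h1 := qi_shift _ 1 h
  have h2 := (F.functor.commShiftIso (1:ℤ)).hom.naturality f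
  dsimp at h2
  rw [← Iso.app_hom, ← Iso.app_hom, ← Iso.eq_comp_inv] at h2
  rw [h2]
  infer_instance

lemma isIso_cx {K L : CochainComplex A ℤ} (f : K ⟶ L) (h : ∀ i, IsIso (f.f i)) : IsIso f :=
  HomologicalComplex.Hom.isIso_of_components f

lemma inl_cδ {K L : CochainComplex A ℤ} (f : K ⟶ L) :
    (mappingCone.inl f).comp (Cochain.ofHom (DGFun.cδ f)) (add_zero (-1)) = - sh K 1 (-1) (by omega) := by
  have h : ((mappingCone.inl f).comp (Cochain.ofHom (DGFun.cδ f)) (add_zero (-1))).comp (un K 1) (by omega : -1 + 1 = 0)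
    = - Cochain.ofHom (𝟙 _) := by
    rw [Cochain.comp_assoc_of_second_is_zero_cochain, DGFun.cδ_un, Cochain.comp_neg, mappingCone.inl_fst]
  have h2 := congrArg (fun z => Cochain.comp z (sh K 1 (-1) (by omega)) (zero_add (-1))) h
  beta_reduce at h2
  rwa [Cochain.comp_assoc _ _ _ _ (by omega : 1 + -1 = 0) (by omega), un_comp_sh, Cochain.comp_id, Cochain.neg_comp, Cochain.id_comp] at h2

lemma inr_cδ {K L : CochainComplex A ℤ} (f : K ⟶ L) : mappingCone.inr f ≫ DGFun.cδ f = 0 := by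
  apply ofHom_ext_un
  rw [Cochain.ofHom_comp, Cochain.comp_assoc_of_first_is_zero_cochain, DGFun.cδ_un, Cochain.comp_neg, mappingCone.inr_fst]
  simp

end

namespace Mut
variable {A : Type u} [Category.{v} A] [Abelian A] {B : Type u'} [Category.{v'} B] [Abelian B] (m : Mut A B)
  {V : Type u''} [Category.{v''} V] [Abelian V]

lemma ψ_fst (Y : CochainComplex B ℤ) : (Cochain.ofHom (m.ψ Y)).comp (mappingCone.fst _).1 (zero_add 1) =
    (un Y 1).comp (Cochain.ofHom (m.cα Y ≫ (cx m.N₁).map (mappingCone.inr (nat m.θ Y)))) (add_zero 1) := by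
  rw [ψ, mappingCone.ofHom_lift, mappingCone.liftCochain_fst, ψ₁_coe]

lemma ψ_snd (Y : CochainComplex B ℤ) : (Cochain.ofHom (m.ψ Y)).comp (mappingCone.snd _) (zero_add 0) =
    (- (un Y 1).comp ((Cochain.ofHom (m.cβ Y)).comp ((mappingCone.inl (nat m.θ Y)).map m.N₀) (zero_add (-1)))
      (by omega : 1 + (-1) = 0)) := by
  rw [ψ, mappingCone.ofHom_lift, mappingCone.liftCochain_snd]

lemma ψ_cδ (Y : CochainComplex B ℤ) : m.ψ Y ≫ DGFun.cδ _ =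
    - (m.cα Y ≫ (cx m.N₁).map (mappingCone.inr (nat m.θ Y)))⟦(1 : ℤ)⟧' := by
  apply ofHom_ext_un
  rw [Cochain.ofHom_comp, Cochain.comp_assoc_of_first_is_zero_cochain, DGFun.cδ_un, Cochain.comp_neg, ψ_fst,
    Cochain.ofHom_neg, Cochain.neg_comp, un_naturality]

/-- compatibility of an additive functor with the shift -/
noncomputable def cxShift {A : Type u} [Category.{v} A] [Abelian A] {B : Type u'} [Category.{v'} B] [Abelian B]
    (N : A ⥤ B) [N.Additive] (X : CochainComplex A ℤ) :
    (cx N).obj (X⟦(1 : ℤ)⟧) ≅ ((cx N).obj X)⟦(1 : ℤ)⟧ := (DGFun.ofFunctor N).shiftIso 1 X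

lemma cxShift_inv {A : Type u} [Category.{v} A] [Abelian A] {B : Type u'} [Category.{v'} B] [Abelian B]
    (N : A ⥤ B) [N.Additive] (X : CochainComplex A ℤ) : Cochain.ofHom (cxShift N X).inv =
    (un _ 1).comp ((sh X 1 (-1) (by omega)).map N) (by omega : 1 + -1 = 0) := by
  unfold cxShift DGFun.shiftIso
  exact DGFun.ofHom_homOf' _ _

lemma cxShift_un {A : Type u} [Category.{v} A] [Abelian A] {B : Type u'} [Category.{v'} B] [Abelian B]
    (N : A ⥤ B) [N.Additive] (X : CochainComplex A ℤ) :
    (Cochain.ofHom (cxShift N X).hom).comp (un _ 1) (zero_add 1) = (un X 1).map N :=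
  (DGFun.ofFunctor N).shiftIso_hom_un 1 X

lemma ψ_cδ' (Y : CochainComplex B ℤ) : m.ψ Y ≫ cmor m.η (DGFun.cδ (nat m.θ Y)) =
    ((m.cβ Y)⟦(1 : ℤ)⟧' ≫ (cxShift m.N₀ ((cx m.M₁).obj Y)).inv) ≫ mappingCone.inr _ := by
  apply DGFun.hom_ext'
  rw [mappingCone.ext_cochain_to_iff _ 0 1 rfl]
  simp only [Cochain.ofHom_comp, Cochain.comp_assoc_of_first_is_zero_cochain, mappingCone.inr_fst, mappingCone.inr_snd,
    ofHom_cmor, cmap_fst, cmap_snd, Int.negOnePow_zero, one_smul]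
  constructor
  · rw [← Cochain.comp_assoc_of_third_is_zero_cochain, ψ_fst, Cochain.map_ofHom, 
      Cochain.comp_assoc_of_third_is_zero_cochain, ← Cochain.ofHom_comp, assoc, ← Functor.map_comp, inr_cδ]
    simp
  · rw [← Cochain.comp_assoc_of_third_is_zero_cochain, ψ_snd, Cochain.neg_comp, 
      Cochain.comp_assoc_of_third_is_zero_cochain, Cochain.comp_assoc_of_first_is_zero_cochain, ← Cochain.map_comp, inl_cδ,
      Cochain.map_neg, Cochain.comp_neg, Cochain.comp_neg, neg_neg, Cochain.comp_id, cxShift_inv, ← Cochain.comp_assoc_of_first_is_zero_cochain, un_naturality, Cochain.comp_assoc_of_second_is_zero_cochain]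

lemma κ₀_eq (X : CochainComplex A ℤ) : m.κ₀ X =
    -((cx m.M₀).map (DGFun.cδ (nat m.η X)) ≫
      (cxShift m.M₀ ((cx m.N₁).obj X)).hom ≫ (m.ca X)⟦(1 : ℤ)⟧') := by
  apply ofHom_ext_un
  simp only [Cochain.ofHom_comp, Cochain.comp_assoc_of_first_is_zero_cochain, Cochain.ofHom_neg, Cochain.neg_comp, un_naturality]
  rw [← Cochain.comp_assoc_of_first_is_zero_cochain (Cochain.ofHom (cxShift _ _).hom), cxShift_un, ofHom_κ₀, Cochain.comp_assoc _ _ _ _ (by omega : -1 + 1 = 0) (by omega), Cochain.comp_assoc_of_first_is_zero_cochain,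
    sh_comp_un, Cochain.comp_id, ← Cochain.map_ofHom]
  rw [← Cochain.comp_assoc_of_first_is_zero_cochain, ← Cochain.map_comp, DGFun.cδ_un, Cochain.map_neg, Cochain.neg_comp, neg_neg]

lemma κ_cδ (X : CochainComplex A ℤ) : cmor m.θ (mappingCone.inr (nat m.η X)) ≫ m.κ X =
    -(DGFun.cδ _ ≫ (m.cb X)⟦(1 : ℤ)⟧') := by
  apply DGFun.hom_ext'
  rw [mappingCone.ext_cochain_from_iff _ (-1) 0 rfl]
  constructor
  · rw [Cochain.ofHom_comp, ← Cochain.comp_assoc_of_third_is_zero_cochain, ofHom_cmor, inl_cmap, Int.negOnePow_zero, one_smul,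
      Cochain.comp_assoc_of_third_is_zero_cochain, inl_κ, ← Cochain.comp_assoc_of_first_is_zero_cochain, ← Cochain.map_comp,
      mappingCone.inr_snd, Cochain.ofHom_neg, Cochain.ofHom_comp, Cochain.comp_neg, 
      ← Cochain.comp_assoc_of_third_is_zero_cochain, inl_cδ, Cochain.neg_comp, sh_naturality]
    simp
  · rw [← Cochain.ofHom_comp, ← Cochain.ofHom_comp, ← assoc, inr_cmor, assoc, inr_κ, Preadditive.comp_neg, ← assoc, inr_cδ,
      Cochain.ofHom_comp, ofHom_κ₀, ← Cochain.map_ofHom, ← Cochain.comp_assoc_of_first_is_zero_cochain, ← Cochain.map_comp, mappingCone.inr_fst]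
    simp

section ψ
variable (H : B ⥤ V) [H.Additive] [H.PreservesHomology]

lemma qi_ψ_C (h0 : ∀ X, IsZero (H.obj (m.N₀.obj X))) (h1 : ∀ Y, IsIso (H.map (m.α Y))) (Y : CochainComplex B ℤ) :
    QuasiIso ((cx H).map (m.ψ Y)) := by
  have e : QuasiIso ((cx H).map (m.ψ Y ≫ DGFun.cδ _)) := by
    rw [ψ_cδ, Functor.map_neg]
    refine qi_neg (qi_map_shift (DGFun.ofFunctor H) _ ?_)
    rw [Functor.map_comp]
    have i1 : IsIso ((cx H).map (m.cα Y)) := isIso_cx _ fun i => h1 _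
    have i2 : QuasiIso ((cx H).map ((cx m.N₁).map (mappingCone.inr (nat m.θ Y)))) :=
      DGFun.qi_map_inr (F := (DGFun.ofFunctor m.N₁).comp (DGFun.ofFunctor H)) _
        (ac_of_isZero fun i => H.map_isZero (m.zN _))
    exact inferInstanceAs (QuasiIso ((cx H).map (m.cα Y) ≫ (cx H).map ((cx m.N₁).map (mappingCone.inr (nat m.θ Y)))))
  rw [Functor.map_comp] at e
  have i3 : QuasiIso ((cx H).map (DGFun.cδ (nat m.η (mappingCone (nat m.θ Y))))) :=
    DGFun.qi_map_cδ (F := DGFun.ofFunctor H) _ (ac_of_isZero fun i => h0 _)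
  exact quasiIso_of_comp_right _ ((cx H).map (DGFun.cδ (nat m.η (mappingCone (nat m.θ Y)))))

lemma qi_ψ_D (h0 : ∀ Y, IsIso (H.map (m.η.app (m.M₀.obj Y)))) (h1 : ∀ Y, IsIso (H.map (m.β Y))) (Y : CochainComplex B ℤ) :
    QuasiIso ((cx H).map (m.ψ Y)) := by
  have e : QuasiIso ((cx H).map (m.ψ Y ≫ cmor m.η (DGFun.cδ (nat m.θ Y)))) := by
    rw [ψ_cδ', Functor.map_comp, Functor.map_comp]
    have i1 : IsIso ((cx H).map (m.cβ Y)) := isIso_cx _ fun i => h1 _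
    have i2 : QuasiIso ((cx H).map ((m.cβ Y)⟦(1 : ℤ)⟧')) :=
      qi_map_shift (DGFun.ofFunctor H) _ (inferInstanceAs (QuasiIso ((cx H).map (m.cβ Y))))
    have i3 : QuasiIso ((cx H).map (mappingCone.inr (nat m.η (((cx m.M₁).obj Y)⟦(1 : ℤ)⟧)))) :=
      DGFun.qi_map_inr (F := DGFun.ofFunctor H) _
        (ac_of_isZero fun i => H.map_isZero (m.zN _))
    infer_instance
  rw [Functor.map_comp] at e
  have i3 : QuasiIso ((cx H).map (cmor m.η (DGFun.cδ (nat m.θ Y)))) := by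
    refine DGFun.qi_map_cδ (F := (coneDG m.η).comp (DGFun.ofFunctor H)) _
      (DGFun.ac_map_cone (F := DGFun.ofFunctor H) _ ?_)
    have i1 : IsIso ((cx H).map (nat m.η ((cx m.M₀).obj Y))) := isIso_cx _ fun i => h0 _
    exact inferInstanceAs (QuasiIso ((cx H).map (nat m.η ((cx m.M₀).obj Y))))
  exact quasiIso_of_comp_right _ ((cx H).map (cmor m.η (DGFun.cδ (nat m.θ Y))))

end ψ
section κ
variable (H : A ⥤ V) [H.Additive] [H.PreservesHomology]

lemma qi_κ_C (h0 : ∀ X, IsZero (H.obj (m.M₁.obj X))) (h1 : ∀ X, IsIso (H.map (m.a X))) (X : CochainComplex A ℤ) :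
    QuasiIso ((cx H).map (m.κ X)) := by
  have e : QuasiIso ((cx H).map (mappingCone.inr _ ≫ m.κ X)) := by
    rw [inr_κ, κ₀_eq, Functor.map_neg]
    refine qi_neg ?_
    rw [Functor.map_comp, Functor.map_comp]
    have i1 : IsIso ((cx H).map (m.ca X)) := isIso_cx _ fun i => h1 _
    have i2 : QuasiIso ((cx H).map ((m.ca X)⟦(1 : ℤ)⟧')) :=
      qi_map_shift (DGFun.ofFunctor H) _ (inferInstanceAs (QuasiIso ((cx H).map (m.ca X))))
    have i3 : QuasiIso ((cx H).map ((cx m.M₀).map (DGFun.cδ (nat m.η X)))) :=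
      DGFun.qi_map_cδ (F := (DGFun.ofFunctor m.M₀).comp (DGFun.ofFunctor H)) _
        (ac_of_isZero fun i => H.map_isZero (m.zM _))
    infer_instance
  rw [Functor.map_comp] at e
  have i3 : QuasiIso ((cx H).map (mappingCone.inr (nat m.θ (mappingCone (nat m.η X))))) :=
    DGFun.qi_map_inr (F := DGFun.ofFunctor H) _ (ac_of_isZero fun i => h0 _)
  exact quasiIso_of_comp_left ((cx H).map (mappingCone.inr (nat m.θ (mappingCone (nat m.η X))))) _

lemma qi_κ_D (h0 : ∀ X, IsIso (H.map (m.θ.app (m.N₁.obj X)))) (h1 : ∀ X, IsIso (H.map (m.b X))) (X : CochainComplex A ℤ) :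
    QuasiIso ((cx H).map (m.κ X)) := by
  have e : QuasiIso ((cx H).map (cmor m.θ (mappingCone.inr (nat m.η X)) ≫ m.κ X)) := by
    rw [κ_cδ, Functor.map_neg]
    refine qi_neg ?_
    rw [Functor.map_comp]
    have i1 : IsIso ((cx H).map (m.cb X)) := isIso_cx _ fun i => h1 _
    have i2 : QuasiIso ((cx H).map ((m.cb X)⟦(1 : ℤ)⟧')) :=
      qi_map_shift (DGFun.ofFunctor H) _ (inferInstanceAs (QuasiIso ((cx H).map (m.cb X))))
    have i3 : QuasiIso ((cx H).map (DGFun.cδ (nat m.θ ((cx m.N₀).obj X)))) :=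
      DGFun.qi_map_cδ (F := DGFun.ofFunctor H) _
        (ac_of_isZero fun i => H.map_isZero (m.zM _))
    infer_instance
  rw [Functor.map_comp] at e
  have i3 : QuasiIso ((cx H).map (cmor m.θ (mappingCone.inr (nat m.η X)))) := by
    refine DGFun.qi_map_inr (F := (coneDG m.θ).comp (DGFun.ofFunctor H)) _
      (DGFun.ac_map_cone (F := DGFun.ofFunctor H) _ ?_)
    have i1 : IsIso ((cx H).map (nat m.θ ((cx m.N₁).obj X))) := isIso_cx _ fun i => h0 _
    exact inferInstanceAs (QuasiIso ((cx H).map (nat m.θ ((cx m.N₁).obj X))))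
  exact quasiIso_of_comp_left ((cx H).map (cmor m.θ (mappingCone.inr (nat m.η X)))) _

end κ
end Mut
end QuipuDE

open CategoryTheory

namespace QuipuDE
open CategoryTheory Category Limits HomologicalComplex CochainComplex CochainComplex.HomComplex Pretriangulated

universe v u v' u' w w' v'' u''

lemma isEquivalence_of_comps {C : Type u} [Category.{v} C] {D : Type u'} [Category.{v'} D] (F : C ⥤ D) (G : D ⥤ C)
    (h1 : (F ⋙ G).IsEquivalence) (h2 : (G ⋙ F).IsEquivalence) : F.IsEquivalence where
  faithful := Functor.Faithful.of_comp F G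
  full := by
    have : G.Faithful := Functor.Faithful.of_comp G F
    exact Functor.Full.of_comp_faithful F G
  essSurj := ⟨fun Y => ⟨G.obj ((G ⋙ F).objPreimage Y), ⟨(G ⋙ F).objObjPreimageIso Y⟩⟩⟩

section
variable {A : Type u} [Category.{v} A] [Abelian A] [HasDerivedCategory.{w} A]
  {B : Type u'} [Category.{v'} B] [Abelian B] [HasDerivedCategory.{w'} B]

/-- composite of derived functors -/
noncomputable def derComp (F : DGFun A B) (G : DGFun B A) [F.Exact'] [G.Exact']
    (T : CochainComplex A ℤ ⥤ CochainComplex A ℤ) (T' : DerivedCategory A ⥤ DerivedCategory A)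
    (e : DerivedCategory.Q ⋙ T' ≅ T ⋙ DerivedCategory.Q)
    (i : F.functor ⋙ G.functor ⋙ DerivedCategory.Q ≅ T ⋙ DerivedCategory.Q) :
    F.der ⋙ G.der ≅ T' := by
  letI l1 : Localization.Lifting DerivedCategory.Q (HomologicalComplex.quasiIso A (ComplexShape.up ℤ))
    (T ⋙ DerivedCategory.Q) T' := ⟨e⟩
  letI l2 : Localization.Lifting DerivedCategory.Q (HomologicalComplex.quasiIso A (ComplexShape.up ℤ))
    (F.functor ⋙ G.functor ⋙ DerivedCategory.Q) (F.der ⋙ G.der) :=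
      ⟨(Functor.associator _ _ _).symm ≪≫ Functor.isoWhiskerRight F.derFac G.der ≪≫ Functor.associator _ _ _ ≪≫
        Functor.isoWhiskerLeft F.functor G.derFac⟩
  exact Localization.liftNatIso DerivedCategory.Q (HomologicalComplex.quasiIso A (ComplexShape.up ℤ)) _ _ _ _ i

end

/-- triangulated equivalence of derived categories -/
def DEq (A : Type u) [Category.{v} A] [Abelian A] [HasDerivedCategory.{w} A]
  (B : Type u') [Category.{v'} B] [Abelian B] [HasDerivedCategory.{w'} B] : Prop :=
  ∃ (F : DerivedCategory A ⥤ DerivedCategory B) (c : F.CommShift ℤ), haveI := c; (F.IsTriangulated ∧ F.IsEquivalence)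

section
variable {A : Type u} [Category.{v} A] [Abelian A] [HasDerivedCategory.{w} A]
  {B : Type u'} [Category.{v'} B] [Abelian B] [HasDerivedCategory.{w'} B]

lemma DEq.refl : DEq A A := ⟨𝟭 _, inferInstance, inferInstance, inferInstance⟩

lemma DEq.symm (h : DEq A B) : DEq B A := by
  obtain ⟨F, c, h1, h2⟩ := h
  let E := F.asEquivalence
  letI : E.functor.CommShift ℤ := c
  letI := E.commShiftInverse ℤ
  haveI : E.CommShift ℤ := E.commShift_of_functor ℤ
  haveI : E.IsTriangulated := .mk' E h1
  exact ⟨E.inverse, inferInstance, inferInstance, inferInstance⟩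

lemma DEq.trans {C : Type u''} [Category.{v''} C] [Abelian C] [HasDerivedCategory C]
    (h : DEq A B) (h' : DEq B C) : DEq A C := by
  obtain ⟨F, c, h1, h2⟩ := h
  obtain ⟨G, d, h3, h4⟩ := h'
  exact ⟨F ⋙ G, inferInstance, inferInstance, inferInstance⟩

lemma DEq.of_equiv (e : A ≌ B) : DEq A B := by
  have : e.functor.Additive := Functor.additive_of_preserves_binary_products _
  have : e.inverse.Additive := Functor.additive_of_preserves_binary_products _
  refine ⟨(DGFun.ofFunctor e.functor).der, inferInstance, inferInstance,
    isEquivalence_of_comps _ (DGFun.ofFunctor e.inverse).der ?_ ?_⟩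
  · refine Functor.isEquivalence_of_iso (F := 𝟭 _) (derComp _ _ (𝟭 _) (𝟭 _) (Iso.refl _) ?_).symm
    exact (Functor.associator _ _ _).symm ≪≫ Functor.isoWhiskerRight
      (NatIso.ofComponents (fun X => HomologicalComplex.Hom.isoOfComponents (fun i => (e.unitIso.app _).symm) (by
        intro i j _; exact (e.unitIso.inv.naturality _).symm)) (by intro X Y f; ext i; exact (e.unitIso.inv.naturality _))) _
  · refine Functor.isEquivalence_of_iso (F := 𝟭 _) (derComp _ _ (𝟭 _) (𝟭 _) (Iso.refl _) ?_).symm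
    exact (Functor.associator _ _ _).symm ≪≫ Functor.isoWhiskerRight
      (NatIso.ofComponents (fun X => HomologicalComplex.Hom.isoOfComponents (fun i => (e.counitIso.app _)) (by
        intro i j _; exact (e.counitIso.hom.naturality _).symm)) (by intro X Y f; ext i; exact (e.counitIso.hom.naturality _))) _

end

section
variable {A : Type u} [Category.{v} A] [Abelian A] [HasDerivedCategory.{w} A]
  {B : Type u'} [Category.{v'} B] [Abelian B] [HasDerivedCategory.{w'} B] (m : Mut A B)

lemma Mut.deq (h1 : ∀ Y, QuasiIso (m.ψ Y)) (h2 : ∀ X, QuasiIso (m.κ X)) : DEq A B := by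
  refine ⟨(coneDG m.η).der, inferInstance, inferInstance, isEquivalence_of_comps _ (coneDG m.θ).der ?_ ?_⟩
  · refine Functor.isEquivalence_of_iso (derComp _ _ (CategoryTheory.shiftFunctor _ (1 : ℤ)) (CategoryTheory.shiftFunctor _ (1 : ℤ))
      (DerivedCategory.Q.commShiftIso (1 : ℤ)).symm ?_).symm
    exact NatIso.ofComponents (fun X =>
      @asIso _ _ _ _ (DerivedCategory.Q.map (m.κ X)) ((DerivedCategory.isIso_Q_map_iff_quasiIso _ _).2 (h2 X)))
      (by
        intro X Y f
        refine (DerivedCategory.Q.map_comp _ _).symm.trans (Eq.trans ?_ (DerivedCategory.Q.map_comp _ _))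
        exact congrArg _ (m.κ_nat f))
  · refine Functor.isEquivalence_of_iso (derComp _ _ (CategoryTheory.shiftFunctor _ (1 : ℤ)) (CategoryTheory.shiftFunctor _ (1 : ℤ))
      (DerivedCategory.Q.commShiftIso (1 : ℤ)).symm ?_).symm
    exact Iso.symm (NatIso.ofComponents (fun X =>
      @asIso _ _ _ _ (DerivedCategory.Q.map (m.ψ X)) ((DerivedCategory.isIso_Q_map_iff_quasiIso _ _).2 (h1 X)))
      (by
        intro X Y f
        refine (DerivedCategory.Q.map_comp _ _).symm.trans (Eq.trans ?_ (DerivedCategory.Q.map_comp _ _))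
        exact congrArg _ (m.ψ_nat f)))

/-- criterion for mutation data to give a derived equivalence -/
theorem Mut.deq' {V : Type u''} [Category.{v''} V] [Abelian V] {ιA ιB : Type*}
    (H : ιA → A ⥤ V) [∀ i, (H i).Additive] [∀ i, (H i).PreservesHomology]
    (hH : ∀ {X Y : A} (f : X ⟶ Y), (∀ i, IsIso ((H i).map f)) → IsIso f)
    (K : ιB → B ⥤ V) [∀ i, (K i).Additive] [∀ i, (K i).PreservesHomology]
    (hK : ∀ {X Y : B} (f : X ⟶ Y), (∀ i, IsIso ((K i).map f)) → IsIso f)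
    (h1 : ∀ i, ((∀ X, IsZero ((K i).obj (m.N₀.obj X))) ∧ (∀ Y, IsIso ((K i).map (m.α Y)))) ∨
      ((∀ Y, IsIso ((K i).map (m.η.app (m.M₀.obj Y)))) ∧ (∀ Y, IsIso ((K i).map (m.β Y)))))
    (h2 : ∀ i, ((∀ X, IsZero ((H i).obj (m.M₁.obj X))) ∧ (∀ X, IsIso ((H i).map (m.a X)))) ∨
      ((∀ X, IsIso ((H i).map (m.θ.app (m.N₁.obj X)))) ∧ (∀ X, IsIso ((H i).map (m.b X))))) : DEq A B := by
  refine m.deq (fun Y => quasiIso_of_family K hK _ fun i => ?_) (fun X => quasiIso_of_family H hH _ fun i => ?_)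
  · rcases h1 i with h | h
    · exact m.qi_ψ_C _ h.1 h.2 Y
    · exact m.qi_ψ_D _ h.1 h.2 Y
  · rcases h2 i with h | h
    · exact m.qi_κ_C _ h.1 h.2 X
    · exact m.qi_κ_D _ h.1 h.2 X

end
end QuipuDE

open CategoryTheory

namespace QuipuDE
open CategoryTheory Category Limits

section
variable (k : Type) [Field k] (Q : PreQuiver)

/-- representations of a quiver (without relations) -/
structure PreRep where
  obj : Q.V → ModuleCat.{0} k
  map : ∀ a : Q.A, obj (Q.s a) ⟶ obj (Q.t a)

variable {k Q}

/-- the path `p` kills the element `x` -/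
def PreRep.Kills (X : PreRep k Q) : List Q.A → ∀ v : Q.V, X.obj v → Prop
  | [], _, x => x = 0
  | a :: p, v, x => ∀ h : v = Q.s a, PreRep.Kills X p (Q.t a) (X.map a (h ▸ x))

variable (k Q)

/-- representations of a quiver with relations -/
structure Rep' (R : Set (List Q.A)) extends PreRep k Q where
  rel : ∀ p ∈ R, ∀ v (x : obj v), toPreRep.Kills p v x

variable {k Q} {R : Set (List Q.A)}

namespace Rep'

/-- morphisms of representations -/
@[ext]
structure Hom (X Y : Rep' k Q R) where
  app : ∀ v, X.obj v ⟶ Y.obj v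
  comm : ∀ a, X.map a ≫ app (Q.t a) = app (Q.s a) ≫ Y.map a

lemma Hom.comm_assoc {X Y : Rep' k Q R} (f : Hom X Y) (a : Q.A) {Z : ModuleCat.{0} k} (h : Y.obj (Q.t a) ⟶ Z) :
    X.map a ≫ f.app (Q.t a) ≫ h = f.app (Q.s a) ≫ Y.map a ≫ h := by
  rw [← assoc, f.comm, assoc]

instance : Category (Rep' k Q R) where
  Hom X Y := Hom X Y
  id X := ⟨fun v => 𝟙 _, fun a => by simp⟩
  comp f g := ⟨fun v => f.app v ≫ g.app v, fun a => by rw [Hom.comm_assoc, Hom.comm, assoc]⟩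

@[ext]
lemma hom_ext {X Y : Rep' k Q R} {f g : X ⟶ Y} (h : ∀ v, f.app v = g.app v) : f = g := Hom.ext (funext h)

@[simp] lemma id_app (X : Rep' k Q R) (v) : Hom.app (𝟙 X) v = 𝟙 _ := rfl
@[simp] lemma comp_app {X Y Z : Rep' k Q R} (f : X ⟶ Y) (g : Y ⟶ Z) (v) : (f ≫ g).app v = f.app v ≫ g.app v := rfl

instance (X Y : Rep' k Q R) : Zero (X ⟶ Y) := ⟨⟨fun _ => 0, fun a => by simp⟩⟩
instance (X Y : Rep' k Q R) : Add (X ⟶ Y) := ⟨fun f g => ⟨fun v => f.app v + g.app v, fun a => by simp [f.comm, g.comm]⟩⟩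
instance (X Y : Rep' k Q R) : Neg (X ⟶ Y) := ⟨fun f => ⟨fun v => - f.app v, fun a => by simp [f.comm]⟩⟩

@[simp] lemma zero_app {X Y : Rep' k Q R} (v) : Hom.app (0 : X ⟶ Y) v = 0 := rfl
@[simp] lemma add_app {X Y : Rep' k Q R} (f g : X ⟶ Y) (v) : (f + g).app v = f.app v + g.app v := rfl
@[simp] lemma neg_app {X Y : Rep' k Q R} (f : X ⟶ Y) (v) : (- f).app v = - f.app v := rfl

instance (X Y : Rep' k Q R) : AddCommGroup (X ⟶ Y) where
  add_assoc f g h := by ext v : 1; simp [add_assoc]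
  zero_add f := by ext v : 1; simp
  add_zero f := by ext v : 1; simp
  nsmul := nsmulRec
  zsmul := zsmulRec
  neg_add_cancel f := by ext v : 1; simp
  add_comm f g := by ext v : 1; simp [add_comm]

instance : Preadditive (Rep' k Q R) where
  add_comp _ _ _ f g h := by ext v : 1; simp
  comp_add _ _ _ f g h := by ext v : 1; simp

end Rep'

section alg

lemma PreRep.kills_zero (X : PreRep k Q) (p : List Q.A) (v : Q.V) : X.Kills p v 0 := by
  induction p generalizing v with
  | nil => rfl
  | cons a p ih => intro h; subst h; simpa using ih _

lemma PreRep.kills_of_zero (X : PreRep k Q) (p : List Q.A) (h : ∃ a ∈ p, X.map a = 0) (v : Q.V) (x) : X.Kills p v x := by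
  induction p generalizing v with
  | nil => simp at h
  | cons a p ih =>
    intro e
    subst e
    obtain ⟨b, hb, h0⟩ := h
    rcases List.mem_cons.1 hb with rfl | hb
    · rw [h0]; exact X.kills_zero _ _
    · exact ih ⟨b, hb, h0⟩ _ _

/-- the total space of a representation -/
def PreRep.Tot (X : PreRep k Q) : Type := ∀ v, X.obj v

noncomputable instance (X : PreRep k Q) : AddCommGroup X.Tot := inferInstanceAs (AddCommGroup (∀ v, X.obj v))
noncomputable instance (X : PreRep k Q) : Module k X.Tot := inferInstanceAs (Module k (∀ v, X.obj v))

open scoped Classical in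
/-- inclusion of a component -/
noncomputable def PreRep.inc (X : PreRep k Q) (v : Q.V) : X.obj v →ₗ[k] X.Tot := LinearMap.single k (fun v => X.obj v) v

/-- projection to a component -/
noncomputable def PreRep.prj (X : PreRep k Q) (v : Q.V) : X.Tot →ₗ[k] X.obj v := LinearMap.proj v

@[simp] lemma PreRep.prj_inc (X : PreRep k Q) (v : Q.V) (x) : X.prj v (X.inc v x) = x := by
  classical
  exact Pi.single_eq_same (M := fun v => X.obj v) v x

lemma PreRep.prj_inc_ne (X : PreRep k Q) {v w : Q.V} (h : w ≠ v) (x) : X.prj w (X.inc v x) = 0 := by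
  classical
  exact Pi.single_eq_of_ne h _

lemma PreRep.sum_inc (X : PreRep k Q) (x : X.Tot) : ∑ v, X.inc v (X.prj v x) = x := by
  classical
  exact Finset.univ_sum_single x

lemma PreRep.tot_ext (X : PreRep k Q) {x y : X.Tot} (h : ∀ v, X.prj v x = X.prj v y) : x = y := funext h

/-- generators acting on the total space -/
noncomputable def PreRep.gen (X : PreRep k Q) : Q.V ⊕ Q.A → (Module.End k X.Tot)ᵐᵒᵖ
  | Sum.inl v => .op (X.inc v ∘ₗ X.prj v)
  | Sum.inr a => .op (X.inc (Q.t a) ∘ₗ (X.map a).hom ∘ₗ X.prj (Q.s a))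

lemma PreRep.gen_inl (X : PreRep k Q) (v) (x) : (X.gen (Sum.inl v)).unop x = X.inc v (X.prj v x) := rfl
lemma PreRep.gen_inr (X : PreRep k Q) (a) (x) : (X.gen (Sum.inr a)).unop x = X.inc (Q.t a) (X.map a (X.prj (Q.s a) x)) := rfl

lemma PreRep.inc_injective (X : PreRep k Q) (v) : Function.Injective (X.inc v) :=
  Function.LeftInverse.injective (X.prj_inc v)

lemma PreRep.kills_iff (X : PreRep k Q) (p : List Q.A) (v : Q.V) (x : X.obj v) :
    X.Kills p v x ↔ ((p.map fun a => X.gen (Sum.inr a)).prod).unop (X.inc v x) = 0 := by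
  induction p generalizing v with
  | nil => simpa [Kills] using ((X.inc_injective v).eq_iff' (map_zero _)).symm
  | cons a p ih =>
    simp only [List.map_cons, List.prod_cons, MulOpposite.unop_mul, Module.End.mul_apply, X.gen_inr]
    by_cases h : v = Q.s a
    · subst h
      rw [X.prj_inc, ← ih]
      exact ⟨fun h => h rfl, fun h _ => h⟩
    · rw [X.prj_inc_ne (Ne.symm h)]
      simp [Kills, h]

/-- the action of the path algebra -/
noncomputable def Rep'.act (X : Rep' k Q R) : PathAlgebraRel k Q R →ₐ[k] (Module.End k X.Tot)ᵐᵒᵖ :=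
  RingQuot.liftAlgHom k ⟨FreeAlgebra.lift k X.gen, by
    intro x y h
    apply MulOpposite.unop_injective
    apply LinearMap.ext
    intro z
    induction h with
    | idem v => simp [PreRep.gen_inl]
    | orth v w h => simp [PreRep.gen_inl, X.prj_inc_ne h.symm]
    | unit => simp [PreRep.gen_inl, X.sum_inc]
    | source a => simp [PreRep.gen_inl, PreRep.gen_inr]
    | target a => simp [PreRep.gen_inl, PreRep.gen_inr]
    | zeroRel p hp =>
      rw [map_list_prod]
      simp only [List.map_map, Function.comp_def, FreeAlgebra.lift_ι_apply, map_zero]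
      rw [← X.sum_inc z, map_sum, map_sum]
      exact Finset.sum_congr rfl fun v _ => (X.kills_iff p v _).1 (X.rel p hp v _)⟩

/-- vertices in the path algebra -/
noncomputable def pv (R : Set (List Q.A)) (v : Q.V) : PathAlgebraRel k Q R := RingQuot.mkAlgHom k _ (FreeAlgebra.ι k (Sum.inl v))
/-- arrows in the path algebra -/
noncomputable def pa (R : Set (List Q.A)) (a : Q.A) : PathAlgebraRel k Q R := RingQuot.mkAlgHom k _ (FreeAlgebra.ι k (Sum.inr a))

lemma Rep'.act_pv (X : Rep' k Q R) (v) (x) : (X.act (pv R v)).unop x = X.inc v (X.prj v x) := by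
  simp [Rep'.act, pv, PreRep.gen_inl]

lemma Rep'.act_pa (X : Rep' k Q R) (a) (x) : (X.act (pa R a)).unop x = X.inc (Q.t a) (X.map a (X.prj (Q.s a) x)) := by
  simp [Rep'.act, pa, PreRep.gen_inr]

lemma path_induction {P : PathAlgebraRel k Q R → Prop} (hc : ∀ c : k, P (algebraMap k _ c)) (hv : ∀ v, P (pv R v))
    (ha : ∀ a, P (pa R a)) (hadd : ∀ x y, P x → P y → P (x + y)) (hmul : ∀ x y, P x → P y → P (x * y)) (x) : P x := by
  obtain ⟨y, rfl⟩ := RingQuot.mkAlgHom_surjective k (PathAlgRel k Q R) x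
  induction y using FreeAlgebra.induction with
  | grade0 r => rw [AlgHom.commutes]; exact hc r
  | grade1 i => cases i with
    | inl v => exact hv v
    | inr a => exact ha a
  | mul a b h1 h2 => rw [map_mul]; exact hmul _ _ h1 h2
  | add a b h1 h2 => rw [map_add]; exact hadd _ _ h1 h2

lemma pv_idem (v : Q.V) : (pv R v : PathAlgebraRel k Q R) * pv R v = pv R v := by
  rw [pv, ← map_mul]; exact RingQuot.mkAlgHom_rel k (.idem v)
lemma pv_orth {v w : Q.V} (h : v ≠ w) : (pv R v : PathAlgebraRel k Q R) * pv R w = 0 := by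
  rw [pv, pv, ← map_mul, ← map_zero (RingQuot.mkAlgHom k (PathAlgRel k Q R))]; exact RingQuot.mkAlgHom_rel k (.orth v w h)
lemma pv_sum : ∑ v, (pv R v : PathAlgebraRel k Q R) = 1 := by
  simp only [pv, ← map_sum]; rw [← map_one (RingQuot.mkAlgHom k (PathAlgRel k Q R))]; exact RingQuot.mkAlgHom_rel k .unit
lemma pv_pa (a : Q.A) : (pv R (Q.s a) : PathAlgebraRel k Q R) * pa R a = pa R a := by
  rw [pv, pa, ← map_mul]; exact RingQuot.mkAlgHom_rel k (.source a)
lemma pa_pv (a : Q.A) : (pa R a : PathAlgebraRel k Q R) * pv R (Q.t a) = pa R a := by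
  rw [pv, pa, ← map_mul]; exact RingQuot.mkAlgHom_rel k (.target a)
lemma pa_rel (p) (hp : p ∈ R) : (p.map fun a => (pa R a : PathAlgebraRel k Q R)).prod = 0 := by
  have := RingQuot.mkAlgHom_rel k (PathAlgRel.zeroRel (k := k) (Q := Q) p hp)
  rw [map_zero, map_list_prod, List.map_map] at this
  exact this

end alg
end
end QuipuDE

open CategoryTheory

namespace QuipuDE
open CategoryTheory Category Limits MulOpposite

section
variable {k : Type} [Field k] {Q : PreQuiver} {R : Set (List Q.A)}

/-- the module of a representation -/
abbrev Rep'.Mod (X : Rep' k Q R) : Type := X.toPreRep.Tot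

noncomputable instance (X : Rep' k Q R) : SMul (PathAlgebraRel k Q R)ᵐᵒᵖ X.Mod where
  smul c x := ((X.act c.unop).unop (x : X.toPreRep.Tot) : X.toPreRep.Tot)

lemma Rep'.smul_def (X : Rep' k Q R) (c : (PathAlgebraRel k Q R)ᵐᵒᵖ) (x : X.Mod) :
  c • x = ((X.act c.unop).unop (x : X.toPreRep.Tot) : X.toPreRep.Tot) := rfl

noncomputable instance (X : Rep' k Q R) : Module (PathAlgebraRel k Q R)ᵐᵒᵖ X.Mod where
  one_smul x := by rw [X.smul_def, MulOpposite.unop_one, map_one]; rfl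
  mul_smul c d x := by rw [X.smul_def, MulOpposite.unop_mul, map_mul]; rfl
  smul_zero c := by rw [X.smul_def]; exact map_zero _
  smul_add c x y := by rw [X.smul_def]; exact map_add _ _ _
  add_smul c d x := by rw [X.smul_def, MulOpposite.unop_add, map_add]; rfl
  zero_smul x := by rw [X.smul_def, MulOpposite.unop_zero, map_zero]; rfl

lemma Rep'.pv_smul (X : Rep' k Q R) (v) (x : X.Mod) : op (pv R v : PathAlgebraRel k Q R) • x = X.inc v (X.prj v x) := X.act_pv _ _
lemma Rep'.pa_smul (X : Rep' k Q R) (a) (x : X.Mod) : op (pa R a : PathAlgebraRel k Q R) • x = X.inc (Q.t a) (X.map a (X.prj (Q.s a) x)) := X.act_pa _ _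
lemma Rep'.c_smul (X : Rep' k Q R) (c : k) (x : X.Mod) : op (algebraMap k (PathAlgebraRel k Q R) c) • x = (c • (x : X.Tot) : X.Tot) := by
  rw [X.smul_def, unop_op, AlgHom.commutes]; rfl

lemma smul_comm_of_gens {M N : Type} [AddCommGroup M] [AddCommGroup N] [Module (PathAlgebraRel k Q R)ᵐᵒᵖ M]
    [Module (PathAlgebraRel k Q R)ᵐᵒᵖ N] (f : M →+ N)
    (hc : ∀ (c : k) m, f (op (algebraMap k (PathAlgebraRel k Q R) c) • m) = op (algebraMap k (PathAlgebraRel k Q R) c) • f m)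
    (hv : ∀ v m, f (op (pv R v : PathAlgebraRel k Q R) • m) = op (pv R v : PathAlgebraRel k Q R) • f m)
    (ha : ∀ v m, f (op (pa R v : PathAlgebraRel k Q R) • m) = op (pa R v : PathAlgebraRel k Q R) • f m)
    (c : (PathAlgebraRel k Q R)ᵐᵒᵖ) (m : M) : f (c • m) = c • f m := by
  suffices h : ∀ d : PathAlgebraRel k Q R, ∀ m, f (op d • m) = op d • f m from h c.unop m
  intro d
  induction d using path_induction with
  | hc c => exact hc c
  | hv v => exact hv v
  | ha v => exact ha v
  | hadd x y h1 h2 => intro m; rw [MulOpposite.op_add, add_smul, map_add, h1, h2, add_smul]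
  | hmul x y h1 h2 => intro m; rw [MulOpposite.op_mul, mul_smul, mul_smul, h2, h1]

/-- the linear map of total spaces -/
noncomputable def Rep'.totMap {X Y : Rep' k Q R} (f : X ⟶ Y) : X.Tot →ₗ[k] Y.Tot :=
  LinearMap.pi fun v => (f.app v).hom ∘ₗ X.prj v

lemma Rep'.prj_totMap {X Y : Rep' k Q R} (f : X ⟶ Y) (v) (x) : Y.prj v (totMap f x) = f.app v (X.prj v x) := rfl

lemma Rep'.totMap_inc {X Y : Rep' k Q R} (f : X ⟶ Y) (v) (x) : totMap f (X.inc v x) = Y.inc v (f.app v x) := by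
  apply Y.tot_ext
  intro w
  rw [prj_totMap]
  by_cases h : w = v
  · subst h; simp
  · rw [X.prj_inc_ne h, Y.prj_inc_ne h]; simp

lemma Rep'.comm_apply {X Y : Rep' k Q R} (f : X ⟶ Y) (a) (x) : f.app (Q.t a) (X.map a x) = Y.map a (f.app (Q.s a) x) := by
  have := congrArg (fun g => g.hom x) (f.comm a)
  simpa using this

/-- the functor from representations to modules -/
noncomputable def toMod (k : Type) [Field k] (Q : PreQuiver) (R : Set (List Q.A)) :
    Rep' k Q R ⥤ ModuleCat.{0} (PathAlgebraRel k Q R)ᵐᵒᵖ where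
  obj X := ModuleCat.of _ X.Mod
  map {X Y} f := ModuleCat.ofHom (X := X.Mod) (Y := Y.Mod)
    { toFun := fun x => Rep'.totMap f x
      map_add' := fun x y => map_add (Rep'.totMap f) _ _
      map_smul' := smul_comm_of_gens (M := X.Mod) (N := Y.Mod) (Rep'.totMap f).toAddMonoidHom
        (by intro c m; rw [X.c_smul, Y.c_smul]; exact map_smul (Rep'.totMap f) _ _)
        (by intro v m; rw [X.pv_smul, Y.pv_smul]; exact Rep'.totMap_inc f _ _)
        (by
          intro v m; rw [X.pa_smul, Y.pa_smul]; refine (Rep'.totMap_inc f _ _).trans ?_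
          rw [Rep'.comm_apply]; rfl) }
  map_id X := rfl
  map_comp f g := rfl

lemma toMod_map_apply {X Y : Rep' k Q R} (f : X ⟶ Y) (x : X.Mod) : (toMod k Q R).map f x = Rep'.totMap f x := rfl

instance : (toMod k Q R).Additive where
  map_add := rfl

instance : (toMod k Q R).Faithful where
  map_injective {X Y f g} h := by
    ext v x
    have h1 := congrArg (fun g => Y.prj v (g.hom (X.inc v x))) h
    have h2 : Y.prj v (Rep'.totMap f (X.inc v x)) = Y.prj v (Rep'.totMap g (X.inc v x)) := h1
    simpa [Rep'.prj_totMap] using h2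

instance : (toMod k Q R).Full where
  map_surjective {X Y} g := by
    let g' : X.Mod →ₗ[(PathAlgebraRel k Q R)ᵐᵒᵖ] Y.Mod := g.hom
    have gadd : ∀ x y : X.Tot, g' (x + y : X.Tot) = (g' x + g' y : Y.Tot) := fun x y => map_add g' x y
    have gsm : ∀ (c : k) (x : X.Tot), g' (c • x : X.Tot) = (c • (g' x : Y.Tot) : Y.Tot) := fun c x => by
      have := map_smul g' (op (algebraMap k (PathAlgebraRel k Q R) c)) x
      rwa [X.c_smul, Y.c_smul] at this
    let G : X.Tot →ₗ[k] Y.Tot := { toFun := g', map_add' := gadd, map_smul' := gsm }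
    have h1 : ∀ v (x : X.Tot), G (X.inc v (X.prj v x)) = Y.inc v (Y.prj v (G x)) := fun v x => by
      have := map_smul g' (op (pv R v : PathAlgebraRel k Q R)) x
      rwa [X.pv_smul, Y.pv_smul] at this
    have h2 : ∀ a (x : X.Tot), G (X.inc (Q.t a) (X.map a (X.prj (Q.s a) x))) = Y.inc (Q.t a) (Y.map a (Y.prj (Q.s a) (G x))) := fun v x => by
      have := map_smul g' (op (pa R v : PathAlgebraRel k Q R)) x
      rwa [X.pa_smul, Y.pa_smul] at this
    let φ : X ⟶ Y := ⟨fun v => ModuleCat.ofHom (Y.prj v ∘ₗ G ∘ₗ X.inc v), fun a => by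
      ext x
      have := congrArg (Y.prj (Q.t a)) (h2 a (X.inc (Q.s a) x))
      simpa using this⟩
    refine ⟨φ, ?_⟩
    · ext x
      change Rep'.totMap φ x = G x
      apply Y.tot_ext
      intro v
      change Y.prj v (G (X.inc v (X.prj v x))) = _
      exact (congrArg _ (h1 v x)).trans (Y.prj_inc _ _)

open ModuleCat.Algebra

/-- action of the path algebra on a module -/
noncomputable abbrev rho (M : ModuleCat.{0} (PathAlgebraRel k Q R)ᵐᵒᵖ) : (PathAlgebraRel k Q R)ᵐᵒᵖ →ₐ[k] Module.End k M := Algebra.lsmul k k M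

/-- the representation of a module, first version -/
noncomputable def ofModPre (M : ModuleCat.{0} (PathAlgebraRel k Q R)ᵐᵒᵖ) : PreRep k Q :=
      { obj := fun v => ModuleCat.of k (LinearMap.eqLocus (rho M (op (pv R v))) LinearMap.id)
        map := fun a => ModuleCat.ofHom ((rho M (op (pa R a))).restrict (by
          intro x _
          simp only [LinearMap.mem_eqLocus, Algebra.lsmul_coe, LinearMap.id_apply]
          rw [← mul_smul, ← MulOpposite.op_mul, pa_pv])) }

/-- the representation of a module -/
noncomputable def ofMod (M : ModuleCat.{0} (PathAlgebraRel k Q R)ᵐᵒᵖ) : Rep' k Q R where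
  toPreRep := ofModPre M
  rel := by
    have hma : ∀ a (x : (ofModPre M).obj (Q.s a)), ((ofModPre M).map a x).1 = op (pa R a : PathAlgebraRel k Q R) • x.1 := fun a x => rfl
    have hk : ∀ p v (x : (ofModPre M).obj v), op ((p.map fun a => (pa R a : PathAlgebraRel k Q R)).prod) • x.1 = 0 → (ofModPre M).Kills p v x := by
      intro p
      induction p with
      | nil => intro v x h; apply Subtype.ext; exact (by simpa using h : x.1 = 0)
      | cons a p ih =>
        intro v x h e
        subst e
        apply ih
        rw [hma, ← mul_smul, ← MulOpposite.op_mul]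
        simpa using h
    exact fun p hp v x => hk p v x (by rw [pa_rel p hp]; simp)

instance : (toMod k Q R).EssSurj where
  mem_essImage M := by
    let X := ofMod M
    have hm : ∀ v (x : X.obj v), op (pv R v : PathAlgebraRel k Q R) • x.1 = x.1 := fun v x => x.2
    have hma : ∀ a (x : X.obj (Q.s a)), (X.map a x).1 = op (pa R a : PathAlgebraRel k Q R) • x.1 := fun a x => rfl
    have hr : ∀ c m, rho M c m = c • m := fun c m => rfl
    have hne : ∀ v w (x : X.obj v), w ≠ v → op (pv R w : PathAlgebraRel k Q R) • x.1 = 0 := by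
      intro v w x h
      rw [← hm v x, ← mul_smul, ← MulOpposite.op_mul, pv_orth h.symm]; simp
    let f : X.Tot →ₗ[k] M := ∑ v, (LinearMap.eqLocus (rho M (op (pv R v))) LinearMap.id).subtype ∘ₗ X.prj v
    have hf : ∀ x, f x = ∑ v, (X.prj v x).1 := fun x => by simp only [f, LinearMap.sum_apply]; rfl
    have hfi : ∀ v x, f (X.inc v x) = x.1 := by
      intro v x
      rw [hf, Finset.sum_eq_single v]
      · rw [X.prj_inc]
      · intro w _ h; rw [X.prj_inc_ne h]; rfl
      · simp
    have hpf : ∀ v x, op (pv R v : PathAlgebraRel k Q R) • f x = (X.prj v x).1 := by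
      intro v x
      rw [hf, Finset.smul_sum, Finset.sum_eq_single v]
      · rw [hm]
      · intro w _ h; rw [hne _ _ _ h.symm]
      · simp
    let F : X.Mod →ₗ[(PathAlgebraRel k Q R)ᵐᵒᵖ] M :=
      { toFun := fun x => f x
        map_add' := map_add f
        map_smul' := smul_comm_of_gens (M := X.Mod) (N := M) f.toAddMonoidHom
          (by intro c m; rw [X.c_smul]; exact map_smul f _ _)
          (by intro v m; rw [X.pv_smul]; exact (hfi _ _).trans (hpf _ _).symm)
          (by
            intro v m; rw [X.pa_smul]; refine (hfi _ _).trans ?_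
            refine (hma _ _).trans ?_
            change _ = _ • f m
            rw [← pv_pa, MulOpposite.op_mul, mul_smul, mul_smul, hpf]
            exact congrArg _ (hm _ _)) }
    have hF : Function.Bijective F := by
      constructor
      · rw [injective_iff_map_eq_zero]
        intro x hx
        refine X.tot_ext fun v => Subtype.ext ?_
        rw [← hpf]
        have : f x = 0 := hx
        rw [this, smul_zero, map_zero]; rfl
      · intro m
        refine ⟨fun v => ⟨op (pv R v : PathAlgebraRel k Q R) • m, ?_⟩, ?_⟩
        · simp only [LinearMap.mem_eqLocus, hr, LinearMap.id_apply]
          rw [← mul_smul, ← MulOpposite.op_mul, pv_idem]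
        · refine (hf _).trans ?_
          change ∑ v, op (pv R v : PathAlgebraRel k Q R) • m = m
          rw [← Finset.sum_smul, ← Finset.op_sum, pv_sum, MulOpposite.op_one, one_smul]
    exact ⟨X, ⟨(LinearEquiv.ofBijective F hF).toModuleIso⟩⟩

instance : (toMod k Q R).IsEquivalence where

instance : HasFiniteProducts (Rep' k Q R) where
  out _ := Adjunction.hasLimitsOfShape_of_equivalence (toMod k Q R)

noncomputable instance : Abelian (Rep' k Q R) := abelianOfEquivalence (toMod k Q R)

lemma exact_iff (S : ShortComplex (Rep' k Q R)) :
    S.Exact ↔ ∀ v (x : S.X₂.obj v), S.g.app v x = 0 → ∃ y, S.f.app v y = x := by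
  rw [← S.exact_map_iff_of_faithful (toMod k Q R), ShortComplex.moduleCat_exact_iff]
  constructor
  · intro h v x hx
    obtain ⟨y, hy⟩ := h (S.X₂.inc v x) (by
      refine (Rep'.totMap_inc S.g v x).trans ?_
      rw [hx, map_zero]; rfl)
    refine ⟨S.X₁.prj v y, ?_⟩
    have := congrArg (S.X₂.prj v) hy
    rw [S.X₂.prj_inc] at this
    exact this
  · intro h x hx
    have h1 : ∀ v, ∃ y, S.f.app v y = S.X₂.prj v x := fun v => h v _ (by
      have := congrArg (S.X₃.prj v) hx
      exact this.trans (map_zero (S.X₃.prj v)))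
    choose y hy using h1
    exact ⟨y, funext hy⟩

end
end QuipuDE

open CategoryTheory

namespace QuipuDE
open CategoryTheory Category Limits

section
variable {k : Type} [Field k] {Q : PreQuiver} {R : Set (List Q.A)}

/-- evaluation at a vertex -/
@[simps]
noncomputable def ev (k : Type) [Field k] (Q : PreQuiver) (R : Set (List Q.A)) (v : Q.V) : Rep' k Q R ⥤ ModuleCat.{0} k where
  obj X := X.obj v
  map f := f.app v

instance (v : Q.V) : (ev k Q R v).Additive where

instance (v : Q.V) : (ev k Q R v).PreservesHomology := by
  apply Functor.preservesHomology_of_map_exact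
  intro S hS
  rw [ShortComplex.moduleCat_exact_iff]
  exact (exact_iff S).1 hS v

lemma ev_conservative {X Y : Rep' k Q R} (f : X ⟶ Y) (h : ∀ v, IsIso ((ev k Q R v).map f)) : IsIso f := by
  have h' : ∀ v, IsIso (f.app v) := h
  refine ⟨⟨fun v => inv (f.app v), fun a => ?_⟩, ?_, ?_⟩
  · rw [IsIso.eq_inv_comp, ← assoc, IsIso.comp_inv_eq, f.comm]
  · ext v : 1; simp
  · ext v : 1; simp

lemma isZero_rep {X : Rep' k Q R} (h : ∀ v, IsZero (X.obj v)) : IsZero X := by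
  rw [IsZero.iff_id_eq_zero]
  ext v : 1
  exact (h v).eq_of_src _ _

lemma preservesHomology_of {Q' : PreQuiver} {R' : Set (List Q'.A)} (N : Rep' k Q R ⥤ Rep' k Q' R') [N.Additive]
    (h : ∀ (S : ShortComplex (Rep' k Q R)), (∀ v (x : S.X₂.obj v), S.g.app v x = 0 → ∃ y, S.f.app v y = x) →
      ∀ v (x : (N.obj S.X₂).obj v), (N.map S.g).app v x = 0 → ∃ y, (N.map S.f).app v y = x) : N.PreservesHomology := by
  apply Functor.preservesHomology_of_map_exact
  intro S hS
  rw [exact_iff] at hS ⊢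
  exact h S hS

end

section Phi
variable {k : Type} [Field k] {C D E : Type} (src : E → C) (S : E → D → Prop)

/-- the product of the source spaces -/
noncomputable def Phi (x : C → ModuleCat.{0} k) (w : D) : ModuleCat.{0} k :=
  ModuleCat.of k (∀ e : {e // S e w}, x (src e.1))

variable {src S}

/-- projection, for an element of the index set -/
noncomputable def Phi.prS (x : C → ModuleCat.{0} k) (w : D) (e : {e // S e w}) : Phi src S x w ⟶ x (src e.1) :=
  ModuleCat.ofHom (LinearMap.proj (R := k) (φ := fun e : {e // S e w} => x (src e.1)) e)

open scoped Classical in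
/-- projection -/
noncomputable def Phi.pr (x : C → ModuleCat.{0} k) (e : E) (w : D) : Phi src S x w ⟶ x (src e) :=
  if h : S e w then Phi.prS x w ⟨e, h⟩ else 0

lemma Phi.pr_pos (x : C → ModuleCat.{0} k) (w : D) (e : {e // S e w}) :
    Phi.pr (src := src) (S := S) x e.1 w = Phi.prS x w e := dif_pos e.2

/-- lift -/
noncomputable def Phi.lift {x : C → ModuleCat.{0} k} {Z : ModuleCat.{0} k} (f : ∀ e : E, Z ⟶ x (src e)) (w : D) :
    Z ⟶ Phi src S x w := ModuleCat.ofHom (LinearMap.pi fun e => (f e.1).hom)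

lemma Phi.lift_pr {x : C → ModuleCat.{0} k} {Z : ModuleCat.{0} k} (f : ∀ e : E, Z ⟶ x (src e)) (e : E) (w : D) (h : S e w) :
    Phi.lift (S := S) f w ≫ Phi.pr x e w = f e := by
  rw [Phi.pr_pos x w ⟨e, h⟩]; rfl

lemma Phi.lift_pr_assoc {x : C → ModuleCat.{0} k} {Z : ModuleCat.{0} k} (f : ∀ e : E, Z ⟶ x (src e)) (e : E) (w : D) (h : S e w)
    {Y : ModuleCat.{0} k} (g : x (src e) ⟶ Y) :
    Phi.lift (S := S) f w ≫ Phi.pr x e w ≫ g = f e ≫ g := by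
  rw [← assoc, Phi.lift_pr _ _ _ h]

lemma Phi.pr_zero (x : C → ModuleCat.{0} k) (e : E) (w : D) (h : ¬ S e w) : Phi.pr (src := src) (S := S) x e w = 0 := dif_neg h

lemma Phi.hom_ext {x : C → ModuleCat.{0} k} {Z : ModuleCat.{0} k} {w : D} {f g : Z ⟶ Phi src S x w}
    (h : ∀ e, S e w → f ≫ Phi.pr x e w = g ≫ Phi.pr x e w) : f = g := by
  apply ModuleCat.hom_ext
  apply LinearMap.ext
  intro z
  funext e
  have := h e.1 e.2
  rw [Phi.pr_pos] at this
  exact congrArg (fun f => f.hom z) this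

open scoped Classical in
/-- inclusion -/
noncomputable def Phi.inj (x : C → ModuleCat.{0} k) (e : E) (w : D) : x (src e) ⟶ Phi src S x w :=
  Phi.lift (fun e' => if h : e = e' then eqToHom (by rw [h]) else 0) w

lemma Phi.inj_pr (x : C → ModuleCat.{0} k) (e : E) (w : D) (h : S e w) : Phi.inj (src := src) (S := S) x e w ≫ Phi.pr x e w = 𝟙 _ := by
  rw [Phi.inj, Phi.lift_pr _ _ _ h]; simp

lemma Phi.inj_pr_assoc (x : C → ModuleCat.{0} k) (e : E) (w : D) (h : S e w) {Y : ModuleCat.{0} k} (g : x (src e) ⟶ Y) :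
    Phi.inj (src := src) (S := S) x e w ≫ Phi.pr x e w ≫ g = g := by
  rw [← assoc, Phi.inj_pr _ _ _ h, id_comp]

lemma Phi.inj_pr_ne (x : C → ModuleCat.{0} k) (e e' : E) (w : D) (h : e ≠ e') : Phi.inj (src := src) (S := S) x e w ≫ Phi.pr x e' w = 0 := by
  by_cases h' : S e' w
  · rw [Phi.inj, Phi.lift_pr _ _ _ h', dif_neg h]
  · rw [Phi.pr_zero _ _ _ h', comp_zero]

lemma Phi.inj_pr_ne_assoc (x : C → ModuleCat.{0} k) (e e' : E) (w : D) (h : e ≠ e') {Y : ModuleCat.{0} k} (g : x (src e') ⟶ Y) :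
    Phi.inj (src := src) (S := S) x e w ≫ Phi.pr x e' w ≫ g = 0 ≫ g := by
  rw [← assoc, Phi.inj_pr_ne _ _ _ _ h]

lemma Phi.inj_zero (x : C → ModuleCat.{0} k) (e : E) (w : D) (h : ¬ S e w) : Phi.inj (src := src) (S := S) x e w = 0 := by
  apply Phi.hom_ext
  intro e' he'
  rw [Phi.inj_pr_ne _ _ _ _ (by rintro rfl; exact h he'), zero_comp]

/-- finite enumeration -/
noncomputable def enumE (E : Type) [Finite E] : Finset E := @Finset.univ E (Fintype.ofFinite E)

@[simp] lemma mem_enumE [Finite E] (e : E) : e ∈ enumE E := @Finset.mem_univ E (Fintype.ofFinite E) e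

variable [Finite E]

/-- maps out of the product -/
noncomputable def Phi.desc {x : C → ModuleCat.{0} k} {Z : ModuleCat.{0} k} (f : ∀ e : E, x (src e) ⟶ Z) (w : D) :
    Phi src S x w ⟶ Z := ∑ e ∈ enumE E, Phi.pr x e w ≫ f e

lemma Phi.inj_desc {x : C → ModuleCat.{0} k} {Z : ModuleCat.{0} k} (f : ∀ e : E, x (src e) ⟶ Z) (e : E) (w : D) (h : S e w) :
    Phi.inj (src := src) x e w ≫ Phi.desc (S := S) f w = f e := by
  rw [Phi.desc, Preadditive.comp_sum, Finset.sum_eq_single e]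
  · rw [Phi.inj_pr_assoc _ _ _ h]
  · intro e' _ h'; rw [Phi.inj_pr_ne_assoc _ _ _ _ h'.symm, zero_comp]
  · intro h; simp at h

lemma Phi.desc_inj (x : C → ModuleCat.{0} k) (w : D) : Phi.desc (S := S) (fun e => Phi.inj (src := src) x e w) w = 𝟙 _ := by
  apply Phi.hom_ext
  intro e he
  rw [Phi.desc, Preadditive.sum_comp, Finset.sum_eq_single e]
  · rw [assoc, Phi.inj_pr _ _ _ he, comp_id, id_comp]
  · intro e' _ h'; rw [assoc, Phi.inj_pr_ne _ _ _ _ h', comp_zero]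
  · intro h; simp at h

lemma Phi.desc_congr {x : C → ModuleCat.{0} k} {Z Z' : ModuleCat.{0} k} (w w' : D) (u : Phi src S x w ⟶ Phi src S x w')
    (f : ∀ e : E, x (src e) ⟶ Z) (g : ∀ e : E, x (src e) ⟶ Z') (t : Z' ⟶ Z)
    (h : ∀ e, u ≫ Phi.pr x e w' ≫ f e = Phi.pr x e w ≫ g e ≫ t) : u ≫ Phi.desc f w' = Phi.desc g w ≫ t := by
  rw [Phi.desc, Phi.desc, Preadditive.comp_sum, Preadditive.sum_comp]
  refine Finset.sum_congr rfl fun e _ => ?_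
  rw [h, assoc]

/-- functoriality -/
noncomputable def Phi.map {x y : C → ModuleCat.{0} k} (f : ∀ c, x c ⟶ y c) (w : D) : Phi src S x w ⟶ Phi src S y w :=
  Phi.lift (fun e => Phi.pr x e w ≫ f (src e)) w

lemma Phi.map_pr {x y : C → ModuleCat.{0} k} (f : ∀ c, x c ⟶ y c) (e : E) (w : D) :
    Phi.map f w ≫ Phi.pr (src := src) (S := S) y e w = Phi.pr x e w ≫ f (src e) := by
  by_cases h : S e w
  · exact Phi.lift_pr _ _ _ h
  · rw [Phi.pr_zero _ _ _ h, Phi.pr_zero _ _ _ h]; simp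

lemma Phi.map_pr_assoc {x y : C → ModuleCat.{0} k} (f : ∀ c, x c ⟶ y c) (e : E) (w : D) {Y : ModuleCat.{0} k} (g : y (src e) ⟶ Y) :
    Phi.map f w ≫ Phi.pr (src := src) (S := S) y e w ≫ g = Phi.pr x e w ≫ f (src e) ≫ g := by
  rw [← assoc, Phi.map_pr, assoc]

/-- transition maps -/
noncomputable def Phi.tr (x : C → ModuleCat.{0} k) (w w' : D) : Phi src S x w ⟶ Phi src S x w' :=
  Phi.lift (fun e => Phi.pr x e w) w'

lemma Phi.tr_pr (x : C → ModuleCat.{0} k) (e : E) (w w' : D) (h : S e w') :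
    Phi.tr x w w' ≫ Phi.pr (src := src) (S := S) x e w' = Phi.pr x e w := Phi.lift_pr _ _ _ h

lemma Phi.tr_pr_assoc (x : C → ModuleCat.{0} k) (e : E) (w w' : D) (h : S e w') {Y : ModuleCat.{0} k} (g : x (src e) ⟶ Y) :
    Phi.tr x w w' ≫ Phi.pr (src := src) (S := S) x e w' ≫ g = Phi.pr x e w ≫ g := by
  rw [← assoc, Phi.tr_pr _ _ _ _ h]

lemma Phi.map_tr {x y : C → ModuleCat.{0} k} (f : ∀ c, x c ⟶ y c) (w w' : D) :
    Phi.tr (src := src) (S := S) x w w' ≫ Phi.map f w' = Phi.map f w ≫ Phi.tr y w w' := by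
  apply Phi.hom_ext
  intro e he
  rw [assoc, assoc, Phi.map_pr, Phi.tr_pr_assoc _ _ _ _ he, Phi.tr_pr _ _ _ _ he, Phi.map_pr]

lemma Phi.tr_zero (x : C → ModuleCat.{0} k) (w w' : D) (h : ∀ e, ¬ (S e w ∧ S e w')) :
    Phi.tr (src := src) (S := S) x w w' = 0 := by
  apply Phi.hom_ext
  intro e he
  rw [Phi.tr_pr _ _ _ _ he, Phi.pr_zero _ _ _ fun h' => h e ⟨h', he⟩, zero_comp]

lemma Phi.inj_tr (x : C → ModuleCat.{0} k) (e : E) (w w' : D) (h : S e w) :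
    Phi.inj (src := src) (S := S) x e w ≫ Phi.tr x w w' = Phi.inj x e w' := by
  apply Phi.hom_ext
  intro e' he
  rw [assoc, Phi.tr_pr _ _ _ _ he]
  by_cases h' : e = e'
  · subst h'; rw [Phi.inj_pr _ _ _ h, Phi.inj_pr _ _ _ he]
  · rw [Phi.inj_pr_ne _ _ _ _ h', Phi.inj_pr_ne _ _ _ _ h']

lemma Phi.inj_map {x y : C → ModuleCat.{0} k} (f : ∀ c, x c ⟶ y c) (e : E) (w : D) :
    Phi.inj (src := src) (S := S) x e w ≫ Phi.map f w = f (src e) ≫ Phi.inj y e w := by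
  apply Phi.hom_ext
  intro e' he
  rw [assoc, assoc, Phi.map_pr]
  by_cases h' : e = e'
  · subst h'; rw [Phi.inj_pr_assoc _ _ _ he, Phi.inj_pr _ _ _ he, comp_id]
  · rw [Phi.inj_pr_ne_assoc _ _ _ _ h', Phi.inj_pr_ne _ _ _ _ h']; simp

lemma Phi.map_id (x : C → ModuleCat.{0} k) (w : D) : Phi.map (src := src) (S := S) (fun c => 𝟙 (x c)) w = 𝟙 _ := by
  apply Phi.hom_ext
  intro e _
  rw [Phi.map_pr, comp_id, id_comp]

lemma Phi.map_comp {x y z : C → ModuleCat.{0} k} (f : ∀ c, x c ⟶ y c) (g : ∀ c, y c ⟶ z c) (w : D) :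
    Phi.map (src := src) (S := S) (fun c => f c ≫ g c) w = Phi.map f w ≫ Phi.map g w := by
  apply Phi.hom_ext
  intro e _
  rw [Phi.map_pr, assoc, Phi.map_pr, Phi.map_pr_assoc]

lemma Phi.map_add {x y : C → ModuleCat.{0} k} (f : ∀ c, x c ⟶ y c) (g : ∀ c, x c ⟶ y c) (w : D) :
    Phi.map (src := src) (S := S) (fun c => f c + g c) w = Phi.map f w + Phi.map g w := by
  apply Phi.hom_ext
  intro e _
  rw [Phi.map_pr, Preadditive.add_comp, Phi.map_pr, Phi.map_pr, Preadditive.comp_add]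

lemma Phi.isZero {x : C → ModuleCat.{0} k} (h : ∀ c, IsZero (x c)) (w : D) : IsZero (Phi src S x w) := by
  rw [IsZero.iff_id_eq_zero]
  apply Phi.hom_ext
  intro e _
  exact (h _).eq_of_tgt _ _

lemma Phi.map_apply {x y : C → ModuleCat.{0} k} (f : ∀ c, x c ⟶ y c) (w : D) (z : ∀ e : {e // S e w}, x (src e.1)) (e : {e // S e w}) :
    ((Phi.map (src := src) (S := S) f w).hom z : ∀ e : {e // S e w}, y (src e.1)) e = f (src e.1) (z e) := by
  have := Phi.map_pr (src := src) (S := S) f e.1 w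
  rw [Phi.pr_pos, Phi.pr_pos] at this
  exact congrArg (fun f => f.hom z) this

lemma Phi.map_exact {x y z : C → ModuleCat.{0} k} (f : ∀ c, x c ⟶ y c) (g : ∀ c, y c ⟶ z c)
    (h : ∀ c (t : y c), g c t = 0 → ∃ s, f c s = t) (w : D) (t : Phi src S y w) (ht : Phi.map g w t = 0) :
    ∃ s, Phi.map f w s = t := by
  let t' : ∀ e : {e // S e w}, y (src e.1) := t
  have h1 : ∀ e, g (src e.1) (t' e) = 0 := fun e => by
    rw [← Phi.map_apply]
    exact congrFun ht e
  choose s hs using fun e => h _ _ (h1 e)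
  refine ⟨s, ?_⟩
  funext e
  exact (Phi.map_apply f w s e).trans (hs e)

end Phi
end QuipuDE

open CategoryTheory

namespace QuipuDE
open CategoryTheory Category Limits

/-- a quiver split into two parts `C` and `D` with connecting arrows `E` -/
structure SD where
  C : Type
  D : Type
  AC : Type
  AD : Type
  E : Type
  [fC : Fintype C]
  [fD : Fintype D]
  [fE : Finite E]
  sC : AC → C
  tC : AC → C
  sD : AD → D
  tD : AD → D
  src : E → C
  tgt : E → D
  be : E → D
  S : E → D → Prop

attribute [instance] SD.fC SD.fD SD.fE

namespace SD
variable (d : SD)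

/-- connecting arrows from `C` to `D` -/
abbrev QA : PreQuiver where
  V := d.C ⊕ d.D
  A := d.AC ⊕ d.AD ⊕ d.E
  s := Sum.elim (fun a => Sum.inl (d.sC a)) (Sum.elim (fun b => Sum.inr (d.sD b)) (fun e => Sum.inl (d.src e)))
  t := Sum.elim (fun a => Sum.inl (d.tC a)) (Sum.elim (fun b => Sum.inr (d.tD b)) (fun e => Sum.inr (d.tgt e)))

/-- connecting arrows from `D` to `C` -/
abbrev QB : PreQuiver where
  V := d.C ⊕ d.D
  A := d.AC ⊕ d.AD ⊕ d.E
  s := Sum.elim (fun a => Sum.inl (d.sC a)) (Sum.elim (fun b => Sum.inr (d.sD b)) (fun e => Sum.inr (d.be e)))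
  t := Sum.elim (fun a => Sum.inl (d.tC a)) (Sum.elim (fun b => Sum.inr (d.tD b)) (fun e => Sum.inl (d.src e)))

variable {d} {k : Type} [Field k]

section A
variable (X : PreRep k d.QA)
/-- component -/
def AoC (c : d.C) : ModuleCat.{0} k := X.obj (Sum.inl c)
/-- component -/
def AoD (c : d.D) : ModuleCat.{0} k := X.obj (Sum.inr c)
/-- component -/
def AmC (a : d.AC) : AoC X (d.sC a) ⟶ AoC X (d.tC a) := X.map (Sum.inl a)
/-- component -/
def AmD (a : d.AD) : AoD X (d.sD a) ⟶ AoD X (d.tD a) := X.map (Sum.inr (Sum.inl a))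
/-- component -/
def AmE (a : d.E) : AoC X (d.src a) ⟶ AoD X (d.tgt a) := X.map (Sum.inr (Sum.inr a))

/-- constructor -/
def mkA (x : d.C → ModuleCat.{0} k) (y : d.D → ModuleCat.{0} k) (fC : ∀ a, x (d.sC a) ⟶ x (d.tC a))
    (fD : ∀ a, y (d.sD a) ⟶ y (d.tD a)) (fE : ∀ a, x (d.src a) ⟶ y (d.tgt a)) : PreRep k d.QA where
  obj := Sum.elim x y
  map a := match a with
    | Sum.inl a => fC a
    | Sum.inr (Sum.inl a) => fD a
    | Sum.inr (Sum.inr a) => fE a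

variable {RA : Set (List d.QA.A)}

/-- morphism constructor -/
def homA {X Y : Rep' k d.QA RA} (f : ∀ c, AoC X.toPreRep c ⟶ AoC Y.toPreRep c) (g : ∀ c, AoD X.toPreRep c ⟶ AoD Y.toPreRep c)
    (hC : ∀ a, AmC X.toPreRep a ≫ f _ = f _ ≫ AmC Y.toPreRep a)
    (hD : ∀ a, AmD X.toPreRep a ≫ g _ = g _ ≫ AmD Y.toPreRep a)
    (hE : ∀ a, AmE X.toPreRep a ≫ g _ = f _ ≫ AmE Y.toPreRep a) : X ⟶ Y :=
  Rep'.Hom.mk (fun v => match v with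
    | Sum.inl c => f c
    | Sum.inr c => g c) (fun a => match a with
    | Sum.inl a => hC a
    | Sum.inr (Sum.inl a) => hD a
    | Sum.inr (Sum.inr a) => hE a)

/-- component -/
def AfC {X Y : Rep' k d.QA RA} (f : X ⟶ Y) (c : d.C) : AoC X.toPreRep c ⟶ AoC Y.toPreRep c := f.app (Sum.inl c)
/-- component -/
def AfD {X Y : Rep' k d.QA RA} (f : X ⟶ Y) (c : d.D) : AoD X.toPreRep c ⟶ AoD Y.toPreRep c := f.app (Sum.inr c)

lemma A_hC {X Y : Rep' k d.QA RA} (f : X ⟶ Y) (a) : AmC X.toPreRep a ≫ AfC f _ = AfC f _ ≫ AmC Y.toPreRep a := f.comm (Sum.inl a)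
lemma A_hD {X Y : Rep' k d.QA RA} (f : X ⟶ Y) (a) : AmD X.toPreRep a ≫ AfD f _ = AfD f _ ≫ AmD Y.toPreRep a := f.comm (Sum.inr (Sum.inl a))
lemma A_hE {X Y : Rep' k d.QA RA} (f : X ⟶ Y) (a) : AmE X.toPreRep a ≫ AfD f _ = AfC f _ ≫ AmE Y.toPreRep a := f.comm (Sum.inr (Sum.inr a))

lemma A_ext {X Y : Rep' k d.QA RA} {f g : X ⟶ Y} (h1 : ∀ c, AfC f c = AfC g c) (h2 : ∀ c, AfD f c = AfD g c) : f = g := by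
  apply Rep'.hom_ext
  rintro (c | c)
  · exact h1 c
  · exact h2 c

end A

section B
variable (X : PreRep k d.QB)
/-- component -/
def BoC (c : d.C) : ModuleCat.{0} k := X.obj (Sum.inl c)
/-- component -/
def BoD (c : d.D) : ModuleCat.{0} k := X.obj (Sum.inr c)
/-- component -/
def BmC (a : d.AC) : BoC X (d.sC a) ⟶ BoC X (d.tC a) := X.map (Sum.inl a)
/-- component -/
def BmD (a : d.AD) : BoD X (d.sD a) ⟶ BoD X (d.tD a) := X.map (Sum.inr (Sum.inl a))
/-- component -/
def BmE (a : d.E) : BoD X (d.be a) ⟶ BoC X (d.src a) := X.map (Sum.inr (Sum.inr a))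

/-- constructor -/
def mkB (x : d.C → ModuleCat.{0} k) (y : d.D → ModuleCat.{0} k) (fC : ∀ a, x (d.sC a) ⟶ x (d.tC a))
    (fD : ∀ a, y (d.sD a) ⟶ y (d.tD a)) (fE : ∀ a, y (d.be a) ⟶ x (d.src a)) : PreRep k d.QB where
  obj := Sum.elim x y
  map a := match a with
    | Sum.inl a => fC a
    | Sum.inr (Sum.inl a) => fD a
    | Sum.inr (Sum.inr a) => fE a

variable {RB : Set (List d.QB.A)}

/-- morphism constructor -/
def homB {X Y : Rep' k d.QB RB} (f : ∀ c, BoC X.toPreRep c ⟶ BoC Y.toPreRep c) (g : ∀ c, BoD X.toPreRep c ⟶ BoD Y.toPreRep c)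
    (hC : ∀ a, BmC X.toPreRep a ≫ f _ = f _ ≫ BmC Y.toPreRep a)
    (hD : ∀ a, BmD X.toPreRep a ≫ g _ = g _ ≫ BmD Y.toPreRep a)
    (hE : ∀ a, BmE X.toPreRep a ≫ f _ = g _ ≫ BmE Y.toPreRep a) : X ⟶ Y :=
  Rep'.Hom.mk (fun v => match v with
    | Sum.inl c => f c
    | Sum.inr c => g c) (fun a => match a with
    | Sum.inl a => hC a
    | Sum.inr (Sum.inl a) => hD a
    | Sum.inr (Sum.inr a) => hE a)

/-- component -/
def BfC {X Y : Rep' k d.QB RB} (f : X ⟶ Y) (c : d.C) : BoC X.toPreRep c ⟶ BoC Y.toPreRep c := f.app (Sum.inl c)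
/-- component -/
def BfD {X Y : Rep' k d.QB RB} (f : X ⟶ Y) (c : d.D) : BoD X.toPreRep c ⟶ BoD Y.toPreRep c := f.app (Sum.inr c)

lemma B_hC {X Y : Rep' k d.QB RB} (f : X ⟶ Y) (a) : BmC X.toPreRep a ≫ BfC f _ = BfC f _ ≫ BmC Y.toPreRep a := f.comm (Sum.inl a)
lemma B_hD {X Y : Rep' k d.QB RB} (f : X ⟶ Y) (a) : BmD X.toPreRep a ≫ BfD f _ = BfD f _ ≫ BmD Y.toPreRep a := f.comm (Sum.inr (Sum.inl a))
lemma B_hE {X Y : Rep' k d.QB RB} (f : X ⟶ Y) (a) : BmE X.toPreRep a ≫ BfC f _ = BfD f _ ≫ BmE Y.toPreRep a := f.comm (Sum.inr (Sum.inr a))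

lemma B_ext {X Y : Rep' k d.QB RB} {f g : X ⟶ Y} (h1 : ∀ c, BfC f c = BfC g c) (h2 : ∀ c, BfD f c = BfD g c) : f = g := by
  apply Rep'.hom_ext
  rintro (c | c)
  · exact h1 c
  · exact h2 c

end B

section kills

lemma kills_C_AB {X : PreRep k d.QA} {y fD fE} (q : List d.AC) (c : d.C) (x : AoC X c) (h : X.Kills (q.map Sum.inl) (Sum.inl c) x) :
    (mkB (AoC X) y (AmC X) fD fE).Kills (q.map Sum.inl) (Sum.inl c) x := by
  induction q generalizing c with
  | nil => exact h
  | cons a q ih =>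
    intro e
    obtain rfl := Sum.inl.inj e
    exact ih _ _ (h rfl)

lemma kills_C_BA {X : PreRep k d.QB} {y fD fE} (q : List d.AC) (c : d.C) (x : BoC X c) (h : X.Kills (q.map Sum.inl) (Sum.inl c) x) :
    (mkA (BoC X) y (BmC X) fD fE).Kills (q.map Sum.inl) (Sum.inl c) x := by
  induction q generalizing c with
  | nil => exact h
  | cons a q ih =>
    intro e
    obtain rfl := Sum.inl.inj e
    exact ih _ _ (h rfl)

lemma kills_D_AB {X : PreRep k d.QA} {y fC fE} (q : List d.AD) (c : d.D) (x : AoD X c)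
    (h : X.Kills (q.map fun b => Sum.inr (Sum.inl b)) (Sum.inr c) x) :
    (mkB y (AoD X) fC (AmD X) fE).Kills (q.map fun b => Sum.inr (Sum.inl b)) (Sum.inr c) x := by
  induction q generalizing c with
  | nil => exact h
  | cons a q ih =>
    intro e
    obtain rfl := Sum.inr.inj e
    exact ih _ _ (h rfl)

lemma kills_D_BA {X : PreRep k d.QB} {y fC fE} (q : List d.AD) (c : d.D) (x : BoD X c)
    (h : X.Kills (q.map fun b => Sum.inr (Sum.inl b)) (Sum.inr c) x) :
    (mkA y (BoD X) fC (BmD X) fE).Kills (q.map fun b => Sum.inr (Sum.inl b)) (Sum.inr c) x := by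
  induction q generalizing c with
  | nil => exact h
  | cons a q ih =>
    intro e
    obtain rfl := Sum.inr.inj e
    exact ih _ _ (h rfl)

lemma list_D (p : List (d.AC ⊕ d.AD ⊕ d.E)) :
    (∃ q : List d.AD, p = q.map fun b => Sum.inr (Sum.inl b)) ∨ (∃ a, Sum.inl a ∈ p) ∨ (∃ e, Sum.inr (Sum.inr e) ∈ p) := by
  induction p with
  | nil => exact Or.inl ⟨[], rfl⟩
  | cons a p ih =>
    rcases a with a | b | e
    · exact Or.inr (Or.inl ⟨a, by simp⟩)
    · rcases ih with ⟨q, rfl⟩ | ⟨a, h⟩ | ⟨e, h⟩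
      · exact Or.inl ⟨b :: q, rfl⟩
      · exact Or.inr (Or.inl ⟨a, by simp [h]⟩)
      · exact Or.inr (Or.inr ⟨e, by simp [h]⟩)
    · exact Or.inr (Or.inr ⟨e, by simp⟩)

end kills

/-- compatibility of the relation sets of the two quivers -/
def RelCompat (d : SD) (RA RB : Set (List (d.AC ⊕ d.AD ⊕ d.E))) : Prop :=
  ∀ p ∈ RA, (∃ q : List d.AC, q ≠ [] ∧ p = q.map Sum.inl ∧ p ∈ RB) ∨
    ((∃ b, Sum.inr (Sum.inl b) ∈ p ∧ ∀ e, ¬ (d.S e (d.sD b) ∧ d.S e (d.tD b))) ∧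
      ∀ q : List d.AD, p = q.map (fun b => Sum.inr (Sum.inl b)) → p ∈ RB)

/-- all the data of a mutation -/
structure MD (k : Type) [Field k] (d : SD) (RA RB : Set (List (d.AC ⊕ d.AD ⊕ d.E))) where
  hA : RelCompat d RA RB
  hB : RelCompat d RB RA
  S_tgt : ∀ e, d.S e (d.tgt e)
  S_be : ∀ e, d.S e (d.be e)
  P : ∀ (X : Rep' k d.QA RA) e w, AoC X.toPreRep (d.src e) ⟶ AoD X.toPreRep w
  P_zero : ∀ X e w, ¬ d.S e w → P X e w = 0
  P_tgt : ∀ X e, P X e (d.tgt e) = AmE X.toPreRep e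
  P_map : ∀ X e b, d.S e (d.sD b) → P X e (d.sD b) ≫ AmD X.toPreRep b = P X e (d.tD b)
  q : ∀ (Y : Rep' k d.QB RB) e w, BoD Y.toPreRep w ⟶ BoC Y.toPreRep (d.src e)
  q_zero : ∀ X e w, ¬ d.S e w → q X e w = 0
  q_be : ∀ X e, q X e (d.be e) = BmE X.toPreRep e
  q_map : ∀ X e b, d.S e (d.tD b) → BmD X.toPreRep b ≫ q X e (d.tD b) = q X e (d.sD b)
  fwd : ∀ e (T : d.D → Prop), T (d.tgt e) → (∀ b, d.S e (d.sD b) → d.S e (d.tD b) → T (d.sD b) → T (d.tD b)) → ∀ w, d.S e w → T w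
  bwd : ∀ e (T : d.D → Prop), T (d.be e) → (∀ b, d.S e (d.sD b) → d.S e (d.tD b) → T (d.tD b) → T (d.sD b)) → ∀ w, d.S e w → T w

end SD
end QuipuDE

open CategoryTheory

namespace QuipuDE
open CategoryTheory Category Limits

namespace SD
namespace MD
variable {d : SD} {k : Type} [Field k] {RA RB : Set (List (d.AC ⊕ d.AD ⊕ d.E))} (m : MD k d RA RB)

/-- the zero module -/
noncomputable abbrev O (k : Type) [Field k] : ModuleCat.{0} k := ModuleCat.of k PUnit

lemma isZero_O : IsZero (O k) := ModuleCat.isZero_of_subsingleton _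



section objects

/-- `N₁` on objects -/
noncomputable def N1o (X : Rep' k d.QA RA) : Rep' k d.QB RB where
  toPreRep := mkB (AoC X.toPreRep) (Phi d.src d.S (AoC X.toPreRep)) (AmC X.toPreRep)
    (fun b => Phi.tr _ (d.sD b) (d.tD b)) (fun e => Phi.pr _ e (d.be e))
  rel p hp v x := by
    rcases m.hB p hp with ⟨q, hq, rfl, h⟩ | ⟨⟨b, hb, h⟩, -⟩
    · rcases v with c | w
      · exact kills_C_AB q c x (X.rel _ h _ _)
      · rcases q with _ | ⟨a, q⟩
        · exact absurd rfl hq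
        · intro h'; exact absurd h' (by simp)
    · exact PreRep.kills_of_zero _ _ ⟨_, hb, Phi.tr_zero _ _ _ h⟩ _ _

/-- `M₀` on objects -/
noncomputable def M0o (X : Rep' k d.QB RB) : Rep' k d.QA RA where
  toPreRep := mkA (BoC X.toPreRep) (Phi d.src d.S (BoC X.toPreRep)) (BmC X.toPreRep)
    (fun b => Phi.tr _ (d.sD b) (d.tD b)) (fun e => Phi.inj _ e (d.tgt e))
  rel p hp v x := by
    rcases m.hA p hp with ⟨q, hq, rfl, h⟩ | ⟨⟨b, hb, h⟩, -⟩
    · rcases v with c | w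
      · exact kills_C_BA q c x (X.rel _ h _ _)
      · rcases q with _ | ⟨a, q⟩
        · exact absurd rfl hq
        · intro h'; exact absurd h' (by simp)
    · exact PreRep.kills_of_zero _ _ ⟨_, hb, Phi.tr_zero _ _ _ h⟩ _ _

/-- `N₀` on objects -/
noncomputable def N0o (X : Rep' k d.QA RA) : Rep' k d.QB RB where
  toPreRep := mkB (fun _ => O k) (AoD X.toPreRep) (fun _ => 0) (AmD X.toPreRep) (fun _ => 0)
  rel p hp v x := by
    rcases m.hB p hp with ⟨q, hq, rfl, h⟩ | ⟨⟨b, hb, -⟩, h⟩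
    · rcases q with _ | ⟨a, q⟩
      · exact absurd rfl hq
      · exact PreRep.kills_of_zero _ _ ⟨Sum.inl a, by simp, rfl⟩ _ _
    · rcases list_D p with ⟨q, hq⟩ | ⟨a, ha⟩ | ⟨e, he⟩
      · have hp' := h q hq
        subst hq
        rcases v with c | w
        · rcases q with _ | ⟨a, q⟩
          · simp at hb
          · intro h'; exact absurd h' (by simp)
        · exact kills_D_AB q w x (X.rel _ hp' _ _)
      · exact PreRep.kills_of_zero _ _ ⟨_, ha, rfl⟩ _ _
      · exact PreRep.kills_of_zero _ _ ⟨_, he, rfl⟩ _ _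

/-- `M₁` on objects -/
noncomputable def M1o (X : Rep' k d.QB RB) : Rep' k d.QA RA where
  toPreRep := mkA (fun _ => O k) (BoD X.toPreRep) (fun _ => 0) (BmD X.toPreRep) (fun _ => 0)
  rel p hp v x := by
    rcases m.hA p hp with ⟨q, hq, rfl, h⟩ | ⟨⟨b, hb, -⟩, h⟩
    · rcases q with _ | ⟨a, q⟩
      · exact absurd rfl hq
      · exact PreRep.kills_of_zero _ _ ⟨Sum.inl a, by simp, rfl⟩ _ _
    · rcases list_D p with ⟨q, hq⟩ | ⟨a, ha⟩ | ⟨e, he⟩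
      · have hp' := h q hq
        subst hq
        rcases v with c | w
        · rcases q with _ | ⟨a, q⟩
          · simp at hb
          · intro h'; exact absurd h' (by simp)
        · exact kills_D_BA q w x (X.rel _ hp' _ _)
      · exact PreRep.kills_of_zero _ _ ⟨_, ha, rfl⟩ _ _
      · exact PreRep.kills_of_zero _ _ ⟨_, he, rfl⟩ _ _

end objects

/-- `N₁` -/
noncomputable def N1 : Rep' k d.QA RA ⥤ Rep' k d.QB RB where
  obj := m.N1o
  map {X Y} f := homB (X := m.N1o X) (Y := m.N1o Y) (AfC f) (Phi.map (AfC f)) (A_hC f)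
    (fun b => Phi.map_tr _ _ _) (fun e => (Phi.map_pr (AfC f) e (d.be e)).symm)
  map_id X := B_ext (fun _ => rfl) (fun w => Phi.map_id _ w)
  map_comp f g := B_ext (fun _ => rfl) (fun w => Phi.map_comp (AfC f) (AfC g) w)

/-- `M₀` -/
noncomputable def M0 : Rep' k d.QB RB ⥤ Rep' k d.QA RA where
  obj := m.M0o
  map {X Y} f := homA (X := m.M0o X) (Y := m.M0o Y) (BfC f) (Phi.map (BfC f)) (B_hC f)
    (fun b => Phi.map_tr _ _ _) (fun e => (Phi.inj_map (BfC f) e (d.tgt e)))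
  map_id X := A_ext (fun _ => rfl) (fun w => Phi.map_id _ w)
  map_comp f g := A_ext (fun _ => rfl) (fun w => Phi.map_comp (BfC f) (BfC g) w)

/-- `N₀` -/
noncomputable def N0 : Rep' k d.QA RA ⥤ Rep' k d.QB RB where
  obj := m.N0o
  map {X Y} f := homB (X := m.N0o X) (Y := m.N0o Y) (fun _ => 𝟙 _) (AfD f) (fun _ => isZero_O.eq_of_src _ _)
    (A_hD f) (fun e => isZero_O.eq_of_tgt _ _)
  map_id X := B_ext (fun _ => rfl) (fun w => rfl)
  map_comp f g := B_ext (fun _ => isZero_O.eq_of_src _ _) (fun w => rfl)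

/-- `M₁` -/
noncomputable def M1 : Rep' k d.QB RB ⥤ Rep' k d.QA RA where
  obj := m.M1o
  map {X Y} f := homA (X := m.M1o X) (Y := m.M1o Y) (fun _ => 𝟙 _) (BfD f) (fun _ => isZero_O.eq_of_src _ _)
    (B_hD f) (fun e => isZero_O.eq_of_src _ _)
  map_id X := A_ext (fun _ => rfl) (fun w => rfl)
  map_comp f g := A_ext (fun _ => isZero_O.eq_of_src _ _) (fun w => rfl)

instance : m.N1.Additive where
  map_add {X Y f g} := B_ext (fun _ => rfl) (fun w => Phi.map_add (AfC f) (AfC g) w)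
instance : m.M0.Additive where
  map_add {X Y f g} := A_ext (fun _ => rfl) (fun w => Phi.map_add (BfC f) (BfC g) w)
instance : m.N0.Additive where
  map_add {X Y f g} := B_ext (fun _ => isZero_O.eq_of_src _ _) (fun w => rfl)
instance : m.M1.Additive where
  map_add {X Y f g} := A_ext (fun _ => isZero_O.eq_of_src _ _) (fun w => rfl)

instance : m.N1.PreservesHomology := preservesHomology_of _ fun S h v x hx => by
  rcases v with c | w
  · exact h (Sum.inl c) x hx
  · exact Phi.map_exact (AfC S.f) (AfC S.g) (fun c => h (Sum.inl c)) w x hx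

instance : m.M0.PreservesHomology := preservesHomology_of _ fun S h v x hx => by
  rcases v with c | w
  · exact h (Sum.inl c) x hx
  · exact Phi.map_exact (BfC S.f) (BfC S.g) (fun c => h (Sum.inl c)) w x hx

instance : m.N0.PreservesHomology := preservesHomology_of _ fun S h v x hx => by
  rcases v with c | w
  · exact ⟨x, rfl⟩
  · exact h (Sum.inr w) x hx

instance : m.M1.PreservesHomology := preservesHomology_of _ fun S h v x hx => by
  rcases v with c | w
  · exact ⟨x, rfl⟩
  · exact h (Sum.inr w) x hx

lemma P_nat {X Y : Rep' k d.QA RA} (f : X ⟶ Y) (e) (w) : m.P X e w ≫ AfD f w = AfC f (d.src e) ≫ m.P Y e w := by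
  by_cases h : d.S e w
  · refine m.fwd e (fun w => m.P X e w ≫ AfD f w = AfC f (d.src e) ≫ m.P Y e w) ?_ ?_ w h
    · rw [m.P_tgt, m.P_tgt]; exact A_hE f e
    · intro b h1 h2 h3
      rw [← m.P_map _ _ _ h1, ← m.P_map _ _ _ h1, assoc, A_hD, ← assoc, h3, assoc]
  · rw [m.P_zero _ _ _ h, m.P_zero _ _ _ h]; simp

lemma q_nat {X Y : Rep' k d.QB RB} (f : X ⟶ Y) (e) (w) : m.q X e w ≫ BfC f (d.src e) = BfD f w ≫ m.q Y e w := by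
  by_cases h : d.S e w
  · refine m.bwd e (fun w => m.q X e w ≫ BfC f (d.src e) = BfD f w ≫ m.q Y e w) ?_ ?_ w h
    · rw [m.q_be, m.q_be]; exact B_hE f e
    · intro b h1 h2 h3
      rw [← m.q_map _ _ _ h2, ← m.q_map _ _ _ h2, assoc, h3, ← assoc, B_hD, assoc]
  · rw [m.q_zero _ _ _ h, m.q_zero _ _ _ h]; simp

lemma P_M0 (Y : Rep' k d.QB RB) (e w) : m.P (m.M0o Y) e w = Phi.inj (BoC Y.toPreRep) e w := by
  by_cases h : d.S e w
  · refine m.fwd e (fun w => m.P (m.M0o Y) e w = Phi.inj (BoC Y.toPreRep) e w) ?_ ?_ w h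
    · rw [m.P_tgt]; rfl
    · intro b h1 h2 h3
      rw [← m.P_map _ _ _ h1, h3]
      exact Phi.inj_tr _ _ _ _ h1
  · rw [m.P_zero _ _ _ h]; exact (Phi.inj_zero _ _ _ h).symm

lemma q_N1 (X : Rep' k d.QA RA) (e w) : m.q (m.N1o X) e w = Phi.pr (AoC X.toPreRep) e w := by
  by_cases h : d.S e w
  · refine m.bwd e (fun w => m.q (m.N1o X) e w = Phi.pr (AoC X.toPreRep) e w) ?_ ?_ w h
    · rw [m.q_be]; rfl
    · intro b h1 h2 h3
      rw [← m.q_map _ _ _ h2, h3]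
      exact Phi.tr_pr _ _ _ _ h2
  · rw [m.q_zero _ _ _ h]; exact (Phi.pr_zero _ _ _ h).symm

lemma desc_map (X : Rep' k d.QA RA) (b) :
    Phi.tr (src := d.src) (S := d.S) (AoC X.toPreRep) (d.sD b) (d.tD b) ≫ Phi.desc (fun e => m.P X e (d.tD b)) (d.tD b) =
      Phi.desc (fun e => m.P X e (d.sD b)) (d.sD b) ≫ AmD X.toPreRep b := by
  apply Phi.desc_congr
  intro e
  by_cases h : d.S e (d.sD b)
  · rw [m.P_map _ _ _ h]
    by_cases h' : d.S e (d.tD b)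
    · rw [Phi.tr_pr_assoc _ _ _ _ h']
    · rw [m.P_zero _ _ _ h']; simp
  · rw [m.P_zero X _ _ h, zero_comp, comp_zero]
    by_cases h' : d.S e (d.tD b)
    · rw [Phi.tr_pr_assoc _ _ _ _ h', Phi.pr_zero _ _ _ h, zero_comp]
    · rw [m.P_zero _ _ _ h']; simp

lemma desc_nat {X Y : Rep' k d.QA RA} (f : X ⟶ Y) (w) :
    Phi.map (AfC f) w ≫ Phi.desc (S := d.S) (fun e => m.P Y e w) w = Phi.desc (fun e => m.P X e w) w ≫ AfD f w := by
  rw [Phi.desc, Phi.desc, Preadditive.comp_sum, Preadditive.sum_comp]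
  refine Finset.sum_congr rfl fun e _ => ?_
  rw [Phi.map_pr_assoc, assoc, m.P_nat]

lemma lift_map (X : Rep' k d.QB RB) (b) :
    BmD X.toPreRep b ≫ Phi.lift (S := d.S) (fun e => m.q X e (d.tD b)) (d.tD b) =
      Phi.lift (fun e => m.q X e (d.sD b)) (d.sD b) ≫ Phi.tr (src := d.src) (S := d.S) (BoC X.toPreRep) (d.sD b) (d.tD b) := by
  apply Phi.hom_ext
  intro e he
  rw [assoc, assoc, Phi.tr_pr _ _ _ _ he, Phi.lift_pr _ _ _ he, m.q_map _ _ _ he]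
  by_cases h : d.S e (d.sD b)
  · rw [Phi.lift_pr _ _ _ h]
  · rw [Phi.pr_zero _ _ _ h, m.q_zero _ _ _ h, comp_zero]

lemma lift_nat {X Y : Rep' k d.QB RB} (f : X ⟶ Y) (w) :
    BfD f w ≫ Phi.lift (S := d.S) (fun e => m.q Y e w) w = Phi.lift (fun e => m.q X e w) w ≫ Phi.map (BfC f) w := by
  apply Phi.hom_ext
  intro e he
  rw [assoc, assoc, Phi.map_pr, Phi.lift_pr _ _ _ he, Phi.lift_pr_assoc _ _ _ he, m.q_nat]

/-- the component of `η` -/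
noncomputable def etaA (X : Rep' k d.QA RA) : m.N1o X ⟶ m.N0o X :=
  homB (X := m.N1o X) (Y := m.N0o X) (fun _ => 0) (fun w => Phi.desc (fun e => m.P X e w) w)
    (fun _ => isZero_O.eq_of_tgt _ _) (fun b => m.desc_map X b) (fun _ => isZero_O.eq_of_tgt _ _)

/-- the component of `θ` -/
noncomputable def thetaA (X : Rep' k d.QB RB) : m.M1o X ⟶ m.M0o X :=
  homA (X := m.M1o X) (Y := m.M0o X) (fun _ => 0) (fun w => Phi.lift (fun e => m.q X e w) w)
    (fun _ => isZero_O.eq_of_src _ _) (fun b => m.lift_map X b) (fun _ => isZero_O.eq_of_src _ _)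

/-- the component of `α` -/
noncomputable def alphaA (X : Rep' k d.QB RB) : X ⟶ m.N1o (m.M0o X) :=
  homB (X := X) (Y := m.N1o (m.M0o X)) (fun _ => 𝟙 _) (fun w => Phi.lift (fun e => m.q X e w) w)
    (fun a => (comp_id _).trans (id_comp _).symm) (fun b => m.lift_map X b)
    (fun e => (comp_id _).trans ((m.q_be X e).symm.trans (Phi.lift_pr (fun e' => m.q X e' (d.be e)) e (d.be e) (m.S_be e)).symm))

/-- the component of `a` -/
noncomputable def aA (X : Rep' k d.QA RA) : m.M0o (m.N1o X) ⟶ X :=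
  homA (X := m.M0o (m.N1o X)) (Y := X) (fun _ => 𝟙 _) (fun w => Phi.desc (fun e => m.P X e w) w)
    (fun a => (comp_id _).trans (id_comp _).symm) (fun b => m.desc_map X b)
    (fun e => (Phi.inj_desc (fun e' => m.P X e' (d.tgt e)) e (d.tgt e) (m.S_tgt e)).trans ((m.P_tgt X e).trans (id_comp _).symm))

/-- the component of `β` -/
noncomputable def betaA (X : Rep' k d.QB RB) : X ⟶ m.N0o (m.M1o X) :=
  homB (X := X) (Y := m.N0o (m.M1o X)) (fun _ => 0) (fun w => 𝟙 _)
    (fun _ => isZero_O.eq_of_tgt _ _) (fun b => (comp_id _).trans (id_comp _).symm) (fun _ => isZero_O.eq_of_tgt _ _)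

/-- the component of `b` -/
noncomputable def bA (X : Rep' k d.QA RA) : m.M1o (m.N0o X) ⟶ X :=
  homA (X := m.M1o (m.N0o X)) (Y := X) (fun _ => 0) (fun w => 𝟙 _)
    (fun _ => isZero_O.eq_of_src _ _) (fun b => (comp_id _).trans (id_comp _).symm) (fun _ => isZero_O.eq_of_src _ _)

lemma desc_P_M0 (Y : Rep' k d.QB RB) (w) : Phi.desc (S := d.S) (fun e => m.P (m.M0o Y) e w) w = 𝟙 (Phi d.src d.S (BoC Y.toPreRep) w) :=
  (congrArg (fun f => Phi.desc (S := d.S) f w) (funext fun e => m.P_M0 Y e w)).trans (Phi.desc_inj (BoC Y.toPreRep) w)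

lemma lift_q_N1 (X : Rep' k d.QA RA) (w) : Phi.lift (S := d.S) (fun e => m.q (m.N1o X) e w) w = 𝟙 (Phi d.src d.S (AoC X.toPreRep) w) := by
  refine (congrArg (fun f => Phi.lift (S := d.S) f w) (funext fun e => m.q_N1 X e w)).trans ?_
  apply Phi.hom_ext
  intro e he
  exact (Phi.lift_pr _ _ _ he).trans (id_comp _).symm

/-- the mutation -/
noncomputable def mutn : Mut (Rep' k d.QA RA) (Rep' k d.QB RB) where
  N₁ := m.N1
  N₀ := m.N0
  M₁ := m.M1
  M₀ := m.M0
  η := { app := m.etaA, naturality := fun X Y f => B_ext (fun _ => isZero_O.eq_of_tgt _ _) (fun w => m.desc_nat f w) }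
  θ := { app := m.thetaA, naturality := fun X Y f => A_ext (fun _ => isZero_O.eq_of_src _ _) (fun w => m.lift_nat f w) }
  zN Y := isZero_rep fun v => match v with
    | Sum.inl c => isZero_O
    | Sum.inr w => Phi.isZero (src := d.src) (S := d.S) (x := fun _ => O k) (fun _ => isZero_O) w
  zM Y := isZero_rep fun v => match v with
    | Sum.inl c => isZero_O
    | Sum.inr w => Phi.isZero (src := d.src) (S := d.S) (x := fun _ => O k) (fun _ => isZero_O) w
  α := m.alphaA
  α_nat f := B_ext (fun c => (comp_id _).trans (id_comp _).symm) (fun w => m.lift_nat f w)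
  β := m.betaA
  β_nat f := B_ext (fun c => isZero_O.eq_of_tgt _ _) (fun w => (comp_id _).trans (id_comp _).symm)
  αβ Y := B_ext (fun c => isZero_O.eq_of_tgt _ _) (fun w =>
    (congrArg (fun z => _ ≫ z) (m.desc_P_M0 Y w)).trans ((comp_id _).trans (id_comp _).symm))
  a := m.aA
  a_nat f := A_ext (fun c => (id_comp _).trans (comp_id _).symm) (fun w => (m.desc_nat f w).symm)
  b := m.bA
  b_nat f := A_ext (fun c => isZero_O.eq_of_src _ _) (fun w => (id_comp _).trans (comp_id _).symm)
  ab X := A_ext (fun c => isZero_O.eq_of_src _ _) (fun w =>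
    (comp_id _).trans ((id_comp _).symm.trans (congrArg (fun z => z ≫ _) (m.lift_q_N1 X w)).symm))

theorem deq (m : MD k d RA RB) : DEq (Rep' k d.QA RA) (Rep' k d.QB RB) := by
  refine m.mutn.deq' (ev k d.QA RA) (fun f => ev_conservative f) (ev k d.QB RB) (fun f => ev_conservative f) ?_ ?_
  · rintro (c | w)
    · refine Or.inl ⟨fun X => isZero_O, fun Y => ?_⟩
      exact inferInstanceAs (IsIso (𝟙 (BoC Y.toPreRep c)))
    · refine Or.inr ⟨fun Y => ?_, fun Y => ?_⟩
      · have : IsIso (Phi.desc (S := d.S) (fun e => m.P (m.M0o Y) e w) w) := by rw [m.desc_P_M0]; exact IsIso.id _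
        exact this
      · exact inferInstanceAs (IsIso (𝟙 (BoD Y.toPreRep w)))
  · rintro (c | w)
    · refine Or.inl ⟨fun X => isZero_O, fun Y => ?_⟩
      exact inferInstanceAs (IsIso (𝟙 (AoC Y.toPreRep c)))
    · refine Or.inr ⟨fun X => ?_, fun Y => ?_⟩
      · have : IsIso (Phi.lift (S := d.S) (fun e => m.q (m.N1o X) e w) w) := by rw [m.lift_q_N1]; exact IsIso.id _
        exact this
      · exact inferInstanceAs (IsIso (𝟙 (AoD Y.toPreRep w)))

end MD
end SD
end QuipuDE

open CategoryTheory

namespace QuipuDE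
open CategoryTheory Category Limits

section iso
variable (k : Type) [Field k] {Q Q' : PreQuiver} (R : Set (List Q.A)) (R' : Set (List Q'.A))

/-- the algebra map induced by a map of quivers with relations -/
noncomputable def algMap (φV : Q.V ≃ Q'.V) (φA : Q.A → Q'.A) (hs : ∀ a, Q'.s (φA a) = φV (Q.s a))
    (ht : ∀ a, Q'.t (φA a) = φV (Q.t a)) (hR : ∀ p ∈ R, p.map φA ∈ R') :
    PathAlgebraRel k Q R →ₐ[k] PathAlgebraRel k Q' R' :=
  RingQuot.liftAlgHom k ⟨(RingQuot.mkAlgHom k (PathAlgRel k Q' R')).comp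
    (FreeAlgebra.lift k fun g => FreeAlgebra.ι k (Sum.map φV φA g)), by
      intro x y h
      induction h with
      | idem v =>
        have := RingQuot.mkAlgHom_rel k (PathAlgRel.idem (k := k) (R := R') (φV v))
        rw [map_mul] at this
        simp only [AlgHom.comp_apply, map_mul, FreeAlgebra.lift_ι_apply, Sum.map_inl]
        exact this
      | orth v w h =>
        have := RingQuot.mkAlgHom_rel k (PathAlgRel.orth (k := k) (R := R') (φV v) (φV w) (fun h' => h (φV.injective h')))
        rw [map_mul, map_zero] at this
        simp only [AlgHom.comp_apply, map_mul, FreeAlgebra.lift_ι_apply, Sum.map_inl, map_zero]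
        exact this
      | unit =>
        have := RingQuot.mkAlgHom_rel k (PathAlgRel.unit (k := k) (R := R'))
        rw [← Equiv.sum_comp φV] at this
        simpa using this
      | source a =>
        have := RingQuot.mkAlgHom_rel k (PathAlgRel.source (k := k) (R := R') (φA a))
        rw [hs] at this
        simpa using this
      | target a =>
        have := RingQuot.mkAlgHom_rel k (PathAlgRel.target (k := k) (R := R') (φA a))
        rw [ht] at this
        simpa using this
      | zeroRel p hp =>
        have := RingQuot.mkAlgHom_rel k (PathAlgRel.zeroRel (k := k) (R := R') _ (hR p hp))
        simpa [map_list_prod, Function.comp_def] using this⟩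

lemma algMap_mk (φV : Q.V ≃ Q'.V) (φA : Q.A → Q'.A) (hs ht hR) (g) :
    algMap k R R' φV φA hs ht hR (RingQuot.mkAlgHom k (PathAlgRel k Q R) (FreeAlgebra.ι k g)) =
      RingQuot.mkAlgHom k (PathAlgRel k Q' R') (FreeAlgebra.ι k (Sum.map φV φA g)) := by
  simp [algMap]

/-- the algebra isomorphism induced by an isomorphism of quivers with relations -/
noncomputable def algIso (φV : Q.V ≃ Q'.V) (φA : Q.A ≃ Q'.A) (hs : ∀ a, Q'.s (φA a) = φV (Q.s a))
    (ht : ∀ a, Q'.t (φA a) = φV (Q.t a)) (hR : ∀ p ∈ R, p.map φA ∈ R') (hR' : ∀ p ∈ R', p.map φA.symm ∈ R) :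
    PathAlgebraRel k Q R ≃ₐ[k] PathAlgebraRel k Q' R' :=
  AlgEquiv.ofAlgHom (algMap k R R' φV φA hs ht hR)
    (algMap k R' R φV.symm φA.symm (fun a => by rw [← φV.symm_apply_apply (Q.s _), ← hs, φA.apply_symm_apply])
      (fun a => by rw [← φV.symm_apply_apply (Q.t _), ← ht, φA.apply_symm_apply]) hR')
    (by
      apply RingQuot.ringQuot_ext'
      apply FreeAlgebra.hom_ext
      funext g
      simp only [Function.comp_apply, AlgHom.comp_apply, algMap_mk]
      rcases g with g | g <;> simp)
    (by
      apply RingQuot.ringQuot_ext'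
      apply FreeAlgebra.hom_ext
      funext g
      simp only [Function.comp_apply, AlgHom.comp_apply, algMap_mk]
      rcases g with g | g <;> simp)

lemma deq_mod : DEq (Rep' k Q R) (ModuleCat.{0} (PathAlgebraRel k Q R)ᵐᵒᵖ) :=
  DEq.of_equiv (toMod k Q R).asEquivalence

theorem deq_iso (φV : Q.V ≃ Q'.V) (φA : Q.A ≃ Q'.A) (hs : ∀ a, Q'.s (φA a) = φV (Q.s a))
    (ht : ∀ a, Q'.t (φA a) = φV (Q.t a)) (hR : ∀ p ∈ R, p.map φA ∈ R') (hR' : ∀ p ∈ R', p.map φA.symm ∈ R) :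
    DEq (Rep' k Q R) (Rep' k Q' R') := by
  refine (deq_mod k R).trans (DEq.trans ?_ (deq_mod k R').symm)
  have e : (PathAlgebraRel k Q' R')ᵐᵒᵖ ≃+* (PathAlgebraRel k Q R)ᵐᵒᵖ :=
    RingEquiv.op (algIso k R R' φV φA hs ht hR hR').symm.toRingEquiv
  have e2 := ModuleCat.restrictScalarsEquivalenceOfRingEquiv e
  exact DEq.of_equiv e2

end iso
end QuipuDE

open CategoryTheory

namespace QuipuDE
open CategoryTheory Category Limits

section refl
variable (k : Type) [Field k] {V A : Type} [Fintype V] [Finite A] (R : Set (List A))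

/-- the splitting of a quiver at a sink -/
noncomputable abbrev reflSD (s t : A → V) (r : V) (hr : ∀ a, s a ≠ r) : SD where
  C := {v // v ≠ r}
  D := Unit
  AC := {a // t a ≠ r}
  AD := Empty
  E := {a // t a = r}
  fC := Fintype.ofFinite _
  sC a := ⟨s a.1, hr _⟩
  tC a := ⟨t a.1, a.2⟩
  sD a := a.elim
  tD a := a.elim
  src a := ⟨s a.1, hr _⟩
  tgt _ := ()
  be _ := ()
  S _ _ := True

open scoped Classical in
/-- vertices -/
noncomputable def reflV (r : V) : {v : V // v ≠ r} ⊕ Unit ≃ V where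
  toFun := Sum.elim Subtype.val (fun _ => r)
  invFun v := if h : v = r then Sum.inr () else Sum.inl ⟨v, h⟩
  left_inv := by
    rintro (⟨v, hv⟩ | ⟨⟩)
    · simp [hv]
    · simp
  right_inv v := by
    by_cases h : v = r <;> simp [h]

open scoped Classical in
/-- arrows -/
noncomputable def reflA (t : A → V) (r : V) : {a : A // t a ≠ r} ⊕ Empty ⊕ {a : A // t a = r} ≃ A where
  toFun := Sum.elim Subtype.val (Sum.elim Empty.elim Subtype.val)
  invFun v := if h : t v = r then Sum.inr (Sum.inr ⟨v, h⟩) else Sum.inl ⟨v, h⟩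
  left_inv := by
    rintro (⟨v, hv⟩ | ⟨⟨⟩⟩ | ⟨v, hv⟩)
    · simp [hv]
    · simp [hv]
  right_inv v := by
    by_cases h : t v = r <;> simp [h]

lemma list_inl {X Y : Type} (p : List (X ⊕ Y)) (h : ∀ e, Sum.inr e ∉ p) : ∃ q : List X, p = q.map Sum.inl := by
  induction p with
  | nil => exact ⟨[], rfl⟩
  | cons a p ih =>
    obtain ⟨q, rfl⟩ := ih (fun e he => h e (List.mem_cons_of_mem _ he))
    rcases a with a | e
    · exact ⟨a :: q, rfl⟩
    · exact absurd (List.mem_cons_self) (h e)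

lemma refl_compat (s t : A → V) (r : V) (hr : ∀ a, s a ≠ r) (hR : ∀ p ∈ R, p ≠ [] ∧ ∀ a ∈ p, t a ≠ r) :
    SD.RelCompat (reflSD s t r hr) {p | p.map (reflA t r) ∈ R} {p | p.map (reflA t r) ∈ R} := by
  intro p hp
  obtain ⟨h1, h2⟩ := hR _ hp
  obtain ⟨q, rfl⟩ := list_inl p (fun e he => by
    rcases e with ⟨⟨⟩⟩ | e
    exact h2 e.1 (List.mem_map.2 ⟨_, he, rfl⟩) e.2)
  exact Or.inl ⟨q, by rintro rfl; exact h1 rfl, rfl, hp⟩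

/-- the mutation data of a reflection -/
noncomputable def reflMD (s t : A → V) (r : V) (hr : ∀ a, s a ≠ r) (hR : ∀ p ∈ R, p ≠ [] ∧ ∀ a ∈ p, t a ≠ r) :
    SD.MD k (reflSD s t r hr) {p | p.map (reflA t r) ∈ R} {p | p.map (reflA t r) ∈ R} where
  hA := refl_compat R s t r hr hR
  hB := refl_compat R s t r hr hR
  S_tgt _ := trivial
  S_be _ := trivial
  P X e w := SD.AmE X.toPreRep e
  P_zero X e w h := absurd trivial h
  P_tgt X e := rfl
  P_map X e b := b.elim
  q X e w := SD.BmE X.toPreRep e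
  q_zero X e w h := absurd trivial h
  q_be X e := rfl
  q_map X e b := b.elim
  fwd e T h _ w _ := h
  bwd e T h _ w _ := h

theorem deq_refl (s t s' t' : A → V) (r : V) (hr : ∀ a, s a ≠ r) (hR : ∀ p ∈ R, p ≠ [] ∧ ∀ a ∈ p, t a ≠ r)
    (h1 : ∀ a, t a = r → s' a = r ∧ t' a = s a) (h2 : ∀ a, t a ≠ r → s' a = s a ∧ t' a = t a) :
    DEq (Rep' k ⟨V, A, s, t⟩ R) (Rep' k ⟨V, A, s', t'⟩ R) := by
  have hmm : ∀ p ∈ R, (p.map (reflA t r).symm).map (reflA t r) ∈ R := by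
    intro p hp
    rw [List.map_map, Equiv.self_comp_symm, List.map_id]
    exact hp
  refine DEq.trans (DEq.symm ?_) ((reflMD k R s t r hr hR).deq.trans ?_)
  · refine deq_iso k _ _ (reflV r) (reflA t r) ?_ ?_ (fun p hp => hp) hmm
    · rintro (⟨a, ha⟩ | ⟨⟨⟩⟩ | ⟨a, ha⟩) <;> rfl
    · rintro (⟨a, ha⟩ | ⟨⟨⟩⟩ | ⟨a, ha⟩)
      · rfl
      · exact ha
  · refine deq_iso k _ _ (reflV r) (reflA t r) ?_ ?_ (fun p hp => hp) hmm
    · rintro (⟨a, ha⟩ | ⟨⟨⟩⟩ | ⟨a, ha⟩)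
      · exact (h2 a ha).1
      · exact (h1 a ha).1
    · rintro (⟨a, ha⟩ | ⟨⟨⟩⟩ | ⟨a, ha⟩)
      · exact (h2 a ha).2
      · exact (h1 a ha).2

/-- the quiver with orientation given by `F` -/
abbrev Qo (u w : A → V) (F : A → Bool) : PreQuiver where
  V := V
  A := A
  s a := cond (F a) (w a) (u a)
  t a := cond (F a) (u a) (w a)

open scoped Classical in
/-- an arrow is flippable if its orientation does not matter -/
def Flippable (u w : A → V) (e : A) : Prop :=
  ∀ F : A → Bool, DEq (Rep' k (Qo u w F) R) (Rep' k (Qo u w (Function.update F e (!(F e)))) R)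

lemma deq_flips (u w : A → V) (F G : A → Bool) (h : ∀ a, F a = G a ∨ Flippable k R u w a) :
    DEq (Rep' k (Qo u w F) R) (Rep' k (Qo u w G) R) := by
  classical
  have key : ∀ T : Finset A, (∀ a ∈ T, Flippable k R u w a) → ∀ F G : A → Bool, (∀ a ∉ T, F a = G a) →
      DEq (Rep' k (Qo u w F) R) (Rep' k (Qo u w G) R) := by
    intro T
    induction T using Finset.induction_on with
    | empty =>
      intro _ F G h
      obtain rfl : F = G := funext fun a => h a (by simp)
      exact DEq.refl
    | insert a T ha ih =>
      intro hT F G h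
      refine DEq.trans (B := Rep' k (Qo u w (Function.update F a (G a))) R) ?_ (ih (fun b hb => hT b (by simp [hb])) _ _ ?_)
      · by_cases h' : F a = G a
        · rw [← h', Function.update_eq_self]; exact DEq.refl
        · have : G a = !(F a) := by cases hF : F a <;> cases hG : G a <;> simp_all
          rw [this]
          convert hT a (by simp) F
      · intro b hb
        by_cases hba : b = a
        · subst hba; simp
        · rw [Function.update_of_ne hba]
          exact h b (by simp [hb, hba])
  have : Fintype A := Fintype.ofFinite A
  refine key (Finset.univ.filter fun a => Flippable k R u w a) (by simp) F G ?_
  intro a ha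
  exact (h a).resolve_right (by simpa using ha)

lemma flippable_of (u w : A → V) (r : V) (e : A) (he : u e = r ∨ w e = r) (hl : ∀ a, u a ≠ w a)
    (hR : ∀ p ∈ R, p ≠ [] ∧ ∀ a ∈ p, u a ≠ r ∧ w a ≠ r)
    (ho : ∀ a, (u a = r ∨ w a = r) → a ≠ e → Flippable k R u w a) : Flippable k R u w e := by
  classical
  -- first the case where `e` points to `r`
  have key : ∀ F : A → Bool, cond (F e) (u e) (w e) = r →
      DEq (Rep' k (Qo u w F) R) (Rep' k (Qo u w (Function.update F e (!(F e)))) R) := by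
    intro F hF
    let F1 : A → Bool := fun a => if u a = r then true else if w a = r then false else F a
    let F2 : A → Bool := fun a => if u a = r then false else if w a = r then true else F a
    have hF1e : F1 e = F e := by
      have := hl e
      simp only [F1]
      cases h : F e <;> rw [h] at hF <;> simp at hF
      · rw [if_neg (by rw [← hF]; exact this), if_pos hF]
      · rw [if_pos hF]
    have hF2e : F2 e = !(F e) := by
      have := hl e
      simp only [F2]
      cases h : F e <;> rw [h] at hF <;> simp at hF
      · rw [if_neg (by rw [← hF]; exact this), if_pos hF]; rfl
      · rw [if_pos hF]; rfl
    refine DEq.trans (B := Rep' k (Qo u w F1) R) (deq_flips k R u w _ _ ?_)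
      (DEq.trans (B := Rep' k (Qo u w F2) R) ?_ (deq_flips k R u w _ _ ?_))
    · intro a
      by_cases hae : a = e
      · subst hae; exact Or.inl hF1e.symm
      · by_cases ha : u a = r ∨ w a = r
        · exact Or.inr (ho a ha hae)
        · push Not at ha
          exact Or.inl (by simp [F1, ha])
    · refine deq_refl k R _ _ _ _ r ?_ ?_ ?_ ?_
      · intro a
        have := hl a
        by_cases h1 : u a = r
        · simp only [F1, h1, if_true, cond_true]; rw [← h1]; exact this.symm
        · by_cases h2 : w a = r
          · simp [F1, h1, h2]
          · simp only [F1, h1, h2, if_false]; cases F a <;> simp [h1, h2]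
      · intro p hp
        refine ⟨(hR p hp).1, fun a ha => ?_⟩
        obtain ⟨h1, h2⟩ := (hR p hp).2 a ha
        cases F1 a <;> simp [h1, h2]
      · intro a ha
        have := hl a
        by_cases h1 : u a = r
        · simp [F1, F2, h1]
        · by_cases h2 : w a = r
          · simp [F1, F2, h1, h2]
          · exfalso
            simp only [F1, h1, h2, if_false] at ha
            cases h : F a <;> simp [h, h1, h2] at ha
      · intro a ha
        have := hl a
        by_cases h1 : u a = r
        · simp [F1, h1] at ha
        · by_cases h2 : w a = r
          · simp [F1, h1, h2] at ha
          · simp [F1, F2, h1, h2]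
    · intro a
      by_cases hae : a = e
      · subst hae; left; rw [Function.update_self]; exact hF2e
      · by_cases ha : u a = r ∨ w a = r
        · exact Or.inr (ho a ha hae)
        · push Not at ha
          left
          rw [Function.update_of_ne hae]
          simp [F2, ha]
  intro F
  by_cases hF : cond (F e) (u e) (w e) = r
  · convert key F hF
  · have h := key (Function.update F e (!(F e))) (by
      rw [Function.update_self]
      cases h : F e <;> simp [h] at hF ⊢ <;> tauto)
    rw [Function.update_self, Bool.not_not, Function.update_idem, Function.update_eq_self] at h
    convert h.symm

end refl
end QuipuDE

open CategoryTheory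

namespace QuipuDE
open CategoryTheory Category Limits

section path
variable {k : Type} [Field k] {Q : PreQuiver}

/-- the morphism `f` is the action of a path -/
inductive IsPath (X : PreRep k Q) (v : Q.V) : List Q.A → ∀ v' : Q.V, (X.obj v ⟶ X.obj v') → Prop
  | nil : IsPath X v [] v (𝟙 _)
  | snoc (p : List Q.A) (a : Q.A) (f : X.obj v ⟶ X.obj (Q.s a)) (h : IsPath X v p (Q.s a) f) :
      IsPath X v (p ++ [a]) (Q.t a) (f ≫ X.map a)

lemma IsPath.kills {X : PreRep k Q} {v : Q.V} {p : List Q.A} {v' : Q.V} {f : X.obj v ⟶ X.obj v'} (h : IsPath X v p v' f)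
    (q : List Q.A) (x : X.obj v) (hk : X.Kills (p ++ q) v x) : X.Kills q v' (f x) := by
  induction h generalizing q with
  | nil => exact hk
  | snoc p a f h ih =>
    rw [List.append_assoc] at hk
    exact ih _ hk rfl

end path

section chain
variable (k : Type) [Field k] {C D' AC AD' : Type} [Fintype C] [Fintype D'] (sC tC : AC → C) (n : ℕ)
  (σ : AD' → Option D') (τ : AD' → D') (c0 : C)

/-- splitting along a linear chain -/
abbrev chainSD : SD where
  C := C
  D := Fin (n + 1) ⊕ D'
  AC := AC
  AD := Fin n ⊕ AD'
  E := Unit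
  sC := sC
  tC := tC
  sD := Sum.elim (fun i => Sum.inl i.castSucc) (fun b => (σ b).elim (Sum.inl (Fin.last n)) Sum.inr)
  tD := Sum.elim (fun i => Sum.inl i.succ) (fun b => Sum.inr (τ b))
  src _ := c0
  tgt _ := Sum.inl 0
  be _ := Sum.inl (Fin.last n)
  S _ w := w.isLeft = true

/-- the relation through the whole chain ending with `b` -/
abbrev chainRel (b : AD') : List (AC ⊕ (Fin n ⊕ AD') ⊕ Unit) :=
  (Sum.inr (Sum.inr ()) :: (List.finRange n).map fun i => Sum.inr (Sum.inl (Sum.inl i))) ++ [Sum.inr (Sum.inl (Sum.inr b))]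

variable (RB : Set (List (AC ⊕ (Fin n ⊕ AD') ⊕ Unit)))

/-- relations before the mutation -/
abbrev chainRA : Set (List (AC ⊕ (Fin n ⊕ AD') ⊕ Unit)) := RB ∪ {p | ∃ b, σ b = none ∧ p = chainRel n b}

/-- the path maps along the chain -/
def chainP {R} (X : Rep' k (chainSD sC tC n σ τ c0).QA R) (i : Fin (n + 1)) :
    SD.AoC X.toPreRep c0 ⟶ SD.AoD X.toPreRep (Sum.inl i) :=
  Fin.induction (motive := fun i => SD.AoC X.toPreRep c0 ⟶ SD.AoD X.toPreRep (Sum.inl i))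
    (SD.AmE X.toPreRep ()) (fun i ih => ih ≫ SD.AmD X.toPreRep (Sum.inl i)) i

lemma chainP_succ {R} (X : Rep' k (chainSD sC tC n σ τ c0).QA R) (i : Fin n) :
    chainP k sC tC n σ τ c0 X i.succ = chainP k sC tC n σ τ c0 X i.castSucc ≫ SD.AmD X.toPreRep (Sum.inl i) := rfl

/-- the path maps along the chain -/
def chainq {R} (X : Rep' k (chainSD sC tC n σ τ c0).QB R) (i : Fin (n + 1)) :
    SD.BoD X.toPreRep (Sum.inl i) ⟶ SD.BoC X.toPreRep c0 :=
  Fin.reverseInduction (motive := fun i => SD.BoD X.toPreRep (Sum.inl i) ⟶ SD.BoC X.toPreRep c0)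
    (SD.BmE X.toPreRep ()) (fun i ih => SD.BmD X.toPreRep (Sum.inl i) ≫ ih) i

lemma chainq_last {R} (X : Rep' k (chainSD sC tC n σ τ c0).QB R) :
    chainq k sC tC n σ τ c0 X (Fin.last n) = SD.BmE X.toPreRep () := Fin.reverseInduction_last

lemma chainq_castSucc {R} (X : Rep' k (chainSD sC tC n σ τ c0).QB R) (i : Fin n) :
    chainq k sC tC n σ τ c0 X i.castSucc = SD.BmD X.toPreRep (Sum.inl i) ≫ chainq k sC tC n σ τ c0 X i.succ :=
  Fin.reverseInduction_castSucc _

lemma chainP_path {R} (X : Rep' k (chainSD sC tC n σ τ c0).QA R) (i : Fin (n + 1)) :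
    IsPath X.toPreRep (Sum.inl c0)
      (Sum.inr (Sum.inr ()) :: ((List.finRange n).map fun i => Sum.inr (Sum.inl (Sum.inl i))).take i.1)
      (Sum.inr (Sum.inl i)) (chainP k sC tC n σ τ c0 X i) := by
  induction i using Fin.induction with
  | zero =>
    have h := IsPath.snoc (X := X.toPreRep) (v := Sum.inl c0) [] (Sum.inr (Sum.inr ())) (𝟙 _) IsPath.nil
    have e : 𝟙 _ ≫ SD.AmE X.toPreRep () = chainP k sC tC n σ τ c0 X 0 := id_comp _
    exact (congrArg (fun g => IsPath X.toPreRep (Sum.inl c0) [Sum.inr (Sum.inr ())] (Sum.inr (Sum.inl 0)) g) e).mp h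
  | succ i ih =>
    have h := IsPath.snoc (X := X.toPreRep) (v := Sum.inl c0) _ (Sum.inr (Sum.inl (Sum.inl i))) (chainP k sC tC n σ τ c0 X i.castSucc) ih
    rw [chainP_succ]
    refine (congrArg (fun p => IsPath X.toPreRep (Sum.inl c0) p (Sum.inr (Sum.inl i.succ))
      (chainP k sC tC n σ τ c0 X i.castSucc ≫ SD.AmD X.toPreRep (Sum.inl i))) ?_).mp h
    rw [List.cons_append]
    congr 1
    simp only [Fin.val_succ, Fin.val_castSucc]
    rw [List.take_add_one]
    simp

lemma chainP_rel (X : Rep' k (chainSD sC tC n σ τ c0).QA (chainRA n σ RB)) (b : AD') (hb : σ b = none) (x : SD.AoC X.toPreRep c0)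
    (y : X.obj ((chainSD sC tC n σ τ c0).QA.s (Sum.inr (Sum.inl (Sum.inr b)))))
    (e : (Sum.inr (Sum.inl (Fin.last n)) : C ⊕ Fin (n + 1) ⊕ D') = (chainSD sC tC n σ τ c0).QA.s (Sum.inr (Sum.inl (Sum.inr b))))
    (hy : y = e ▸ (chainP k sC tC n σ τ c0 X (Fin.last n)).hom x) :
    X.map (Sum.inr (Sum.inl (Sum.inr b))) y = 0 := by
  have h := (chainP_path k sC tC n σ τ c0 X (Fin.last n)).kills [Sum.inr (Sum.inl (Sum.inr b))] x (by
    have := X.rel (chainRel n b) (Or.inr ⟨b, hb, rfl⟩) (Sum.inl c0) x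
    rw [Fin.val_last, List.take_of_length_le (by simp)]
    exact this)
  have h2 := h e
  rw [hy]
  exact h2

/-- the path maps along the chain, extended by zero -/
def chainPw {R} (X : Rep' k (chainSD sC tC n σ τ c0).QA R) (w : Fin (n + 1) ⊕ D') :
    SD.AoC X.toPreRep c0 ⟶ SD.AoD X.toPreRep w := match w with
  | Sum.inl i => chainP k sC tC n σ τ c0 X i
  | Sum.inr _ => 0

lemma chainPw_eq {R} (X : Rep' k (chainSD sC tC n σ τ c0).QA R) (w : Fin (n + 1) ⊕ D')
    (e : (Sum.inr (Sum.inl (Fin.last n)) : C ⊕ Fin (n + 1) ⊕ D') = Sum.inr w) (x : SD.AoC X.toPreRep c0) :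
    ((chainPw k sC tC n σ τ c0 X w).hom x : X.obj (Sum.inr w)) =
      (e ▸ ((chainP k sC tC n σ τ c0 X (Fin.last n)).hom x : X.obj (Sum.inr (Sum.inl (Fin.last n)))) : X.obj (Sum.inr w)) := by
  obtain rfl := Sum.inr.inj e
  rfl

/-- the mutation data along a chain -/
def chainMD (hRB : ∀ p ∈ RB, ∃ q : List AD', q ≠ [] ∧ p = q.map fun b => Sum.inr (Sum.inl (Sum.inr b))) :
    SD.MD k (chainSD sC tC n σ τ c0) (chainRA n σ RB) RB where
  hA p hp := by
    right
    rcases hp with hp | ⟨b, hb, rfl⟩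
    · obtain ⟨q, hq, rfl⟩ := hRB p hp
      rcases q with _ | ⟨b, q⟩
      · exact absurd rfl hq
      · exact ⟨⟨Sum.inr b, by simp, by simp⟩, fun _ _ => hp⟩
    · refine ⟨⟨Sum.inr b, by simp, by simp⟩, fun q hq => ?_⟩
      rcases q with _ | ⟨b', q⟩
      · simp at hq
      · simp at hq
  hB p hp := by
    right
    obtain ⟨q, hq, rfl⟩ := hRB p hp
    rcases q with _ | ⟨b, q⟩
    · exact absurd rfl hq
    · exact ⟨⟨Sum.inr b, by simp, by simp⟩, fun _ _ => Or.inl hp⟩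
  S_tgt _ := rfl
  S_be _ := rfl
  P X _ w := chainPw k sC tC n σ τ c0 X w
  P_zero X _ w h := by
    rcases w with i | w
    · exact absurd rfl h
    · rfl
  P_tgt X _ := rfl
  P_map X _ b h := by
    rcases b with i | b
    · rfl
    · have key : ∀ o : Option D', σ b = o → o = none := by
        rintro (_ | o) ho
        · rfl
        · exfalso
          simp [ho] at h
      have hb := key _ rfl
      apply ModuleCat.hom_ext
      apply LinearMap.ext
      intro x
      refine chainP_rel k sC tC n σ τ c0 RB X b hb x _ (by simp [hb]) ?_
      exact chainPw_eq k sC tC n σ τ c0 X _ _ x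
  q X _ w := match w with
    | Sum.inl i => chainq k sC tC n σ τ c0 X i
    | Sum.inr _ => 0
  q_zero X _ w h := by
    rcases w with i | w
    · exact absurd rfl h
    · rfl
  q_be X _ := chainq_last k sC tC n σ τ c0 X
  q_map X _ b h := by
    rcases b with i | b
    · exact (chainq_castSucc k sC tC n σ τ c0 X i).symm
    · exact absurd h (by simp)
  fwd _ T h0 h w hw := by
    rcases w with i | w
    · induction i using Fin.induction with
      | zero => exact h0
      | succ i ih => exact h (Sum.inl i) rfl rfl (ih rfl)
    · exact absurd hw (by simp)
  bwd _ T h0 h w hw := by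
    rcases w with i | w
    · induction i using Fin.reverseInduction with
      | last => exact h0
      | cast i ih => exact h (Sum.inl i) rfl rfl (ih rfl)
    · exact absurd hw (by simp)

end chain
end QuipuDE

open CategoryTheory

namespace QuipuDE
open CategoryTheory Category Limits

section flat
variable (L : ℕ) (c : Fin L → ℕ)

/-- vertices of a quipu as pairs of natural numbers -/
abbrev FV : Type := {p : ℕ × ℕ // ∃ h : p.1 < L, p.2 ≤ c ⟨p.1, h⟩}

/-- arrows of a quipu, labelled by their targets -/
abbrev FA : Type := {p : ℕ × ℕ // (∃ h : p.1 < L, p.2 ≤ c ⟨p.1, h⟩) ∧ p ≠ (0, 0)}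

/-- comparison of vertices -/
def flatVf : Fin L ⊕ (Σ v : Fin L, Fin (c v)) → FV L c
  | Sum.inl v => ⟨(v.1, 0), v.2, Nat.zero_le _⟩
  | Sum.inr x => ⟨(x.1.1, x.2.1 + 1), x.1.2, x.2.2⟩

lemma flatVf_bij : Function.Bijective (flatVf L c) := by
  constructor
  · rintro (v | ⟨v, j⟩) (w | ⟨w, i⟩) h
    · simp only [flatVf, Subtype.mk.injEq, Prod.mk.injEq] at h
      rw [Fin.ext h.1]
    · simp [flatVf] at h
    · simp [flatVf] at h
    · simp only [flatVf, Subtype.mk.injEq, Prod.mk.injEq] at h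
      obtain rfl := Fin.ext h.1
      obtain rfl : j = i := Fin.ext (by omega)
      rfl
  · rintro ⟨⟨v, j⟩, hv, hj⟩
    rcases j with _ | j
    · exact ⟨Sum.inl ⟨v, hv⟩, rfl⟩
    · exact ⟨Sum.inr ⟨⟨v, hv⟩, ⟨j, hj⟩⟩, rfl⟩

/-- comparison of arrows -/
def flatAf : Fin (L - 1) ⊕ (Σ v : Fin L, Fin (c v)) → FA L c
  | Sum.inl v => ⟨(v.1 + 1, 0), ⟨by have := v.2; change v.1 + 1 < L; omega, Nat.zero_le _⟩, by simp⟩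
  | Sum.inr x => ⟨(x.1.1, x.2.1 + 1), ⟨x.1.2, x.2.2⟩, by simp⟩

lemma flatAf_bij : Function.Bijective (flatAf L c) := by
  constructor
  · rintro (v | ⟨v, j⟩) (w | ⟨w, i⟩) h
    · simp only [flatAf, Subtype.mk.injEq, Prod.mk.injEq] at h
      rw [Fin.ext (a := v) (b := w) (by omega)]
    · simp [flatAf] at h
    · simp [flatAf] at h
    · simp only [flatAf, Subtype.mk.injEq, Prod.mk.injEq] at h
      obtain rfl := Fin.ext h.1
      obtain rfl : j = i := Fin.ext (by omega)
      rfl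
  · rintro ⟨⟨v, j⟩, ⟨hv, hj⟩, h0⟩
    rcases j with _ | j
    · rcases v with _ | v
      · exact absurd rfl h0
      · exact ⟨Sum.inl ⟨v, by change v + 1 < L at hv; omega⟩, rfl⟩
    · exact ⟨Sum.inr ⟨⟨v, hv⟩, ⟨j, hj⟩⟩, rfl⟩

noncomputable instance : Fintype (FV L c) := Fintype.ofBijective _ (flatVf_bij L c)
noncomputable instance : Fintype (FA L c) := Fintype.ofBijective _ (flatAf_bij L c)

/-- the source of an arrow -/
def flatS (a : FA L c) : FV L c := ⟨(if a.1.2 = 0 then a.1.1 - 1 else a.1.1, a.1.2 - 1), by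
  obtain ⟨⟨v, j⟩, ⟨hv, hj⟩, h0⟩ := a
  change v < L at hv
  change j ≤ c ⟨v, hv⟩ at hj
  by_cases h : j = 0
  · subst h
    exact ⟨by simp; omega, by simp⟩
  · refine ⟨by simpa [h] using hv, ?_⟩
    simp only [h, if_false]
    omega⟩

/-- the target of an arrow -/
def flatT (a : FA L c) : FV L c := ⟨a.1, a.2.1⟩

/-- the relations -/
def flatR (rels : Set (ℕ × ℕ)) : Set (List (FA L c)) :=
  {p | ∃ q ∈ rels, p.map Subtype.val = (List.range q.2).map fun j => (q.1 + j + 1, 0)}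

lemma mainPath_val (q : ℕ × ℕ) (h : q.1 + q.2 < L) :
    ((mainPath L c q.1 q.2).map (flatAf L c)).map Subtype.val = (List.range q.2).map fun j => (q.1 + j + 1, 0) := by
  have e : mainPath L c q.1 q.2 = ((List.range q.2).filterMap fun j =>
    if h : q.1 + j < L - 1 then some (Sum.inl ⟨q.1 + j, h⟩) else none : List (Fin (L - 1) ⊕ (Σ v : Fin L, Fin (c v)))) := rfl
  refine (congrArg (fun z => (List.map (flatAf L c) z).map Subtype.val) e).trans ?_
  rw [List.map_map, List.map_filterMap, ← List.filterMap_eq_map]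
  apply List.filterMap_congr
  intro j hj
  rw [List.mem_range] at hj
  rw [dif_pos (show q.1 + j < L - 1 by omega)]
  rfl

lemma flat_aux (v : Fin L) (j : Fin (c v)) : flatS L c (flatAf L c (Sum.inr ⟨v, j⟩)) =
    flatVf L c (if h : j.1 = 0 then Sum.inl v else Sum.inr ⟨v, ⟨j.1 - 1, by have := j.2; omega⟩⟩) := by
  apply Subtype.ext
  by_cases hj : j.1 = 0
  · simp [flatAf, flatS, flatVf, hj]
  · simp [flatAf, flatS, flatVf, hj]; omega

theorem deq_flat (k : Type) [Field k] (rels : Set (ℕ × ℕ)) (h : ∀ q ∈ rels, q.1 + q.2 < L) :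
    DEq (Rep' k (quipuQuiver L c) {p | ∃ q ∈ rels, p = mainPath L c q.1 q.2})
      (Rep' k ⟨FV L c, FA L c, flatS L c, flatT L c⟩ (flatR L c rels)) := by
  refine deq_iso k _ _ (Equiv.ofBijective _ (flatVf_bij L c)) (Equiv.ofBijective _ (flatAf_bij L c)) ?_ ?_ ?_ ?_
  · rintro (i | ⟨v, j⟩)
    · rfl
    · exact flat_aux L c v j
  · rintro (i | ⟨v, j⟩) <;> rfl
  · rintro p ⟨q, hq, rfl⟩
    exact ⟨q, hq, mainPath_val L c q (h q hq)⟩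
  · rintro p ⟨q, hq, hp⟩
    refine ⟨q, hq, ?_⟩
    rw [← mainPath_val L c q (h q hq)] at hp
    have := Subtype.val_injective.list_map hp
    rw [this]
    exact (List.map_map).trans ((congrArg (fun f => List.map f _) (Equiv.symm_comp_self (Equiv.ofBijective _ (flatAf_bij L c)))).trans (List.map_id _))

end flat
end QuipuDE

open CategoryTheory

namespace QuipuDE
open CategoryTheory Category Limits

section step1
variable (k : Type) [Field k] (L : ℕ) (c : Fin L → ℕ) (s n : ℕ)

/-- upstream vertices -/
abbrev C1 : Type := {p : FV L c // p.1.1 ≤ s}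
/-- downstream vertices -/
abbrev D1 : Type := {p : FV L c // s + n + 2 ≤ p.1.1}
/-- upstream arrows -/
abbrev AC1 : Type := {p : FA L c // p.1.1 ≤ s}
/-- downstream arrows -/
abbrev AD1 : Type := {p : FA L c // s + n + 2 ≤ p.1.1}

lemma flatS_le (a : FA L c) : (flatS L c a).1.1 ≤ a.1.1 := by
  simp only [flatS]; split_ifs <;> omega

/-- source upstream -/
def sC1 (a : AC1 L c s) : C1 L c s := ⟨flatS L c a.1, (flatS_le L c a.1).trans a.2⟩
/-- target upstream -/
def tC1 (a : AC1 L c s) : C1 L c s := ⟨flatT L c a.1, a.2⟩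
/-- source downstream -/
def sig1 (a : AD1 L c s n) : Option (D1 L c s n) :=
  if h : s + n + 2 ≤ (flatS L c a.1).1.1 then some ⟨flatS L c a.1, h⟩ else none
/-- target downstream -/
def tau1 (a : AD1 L c s n) : D1 L c s n := ⟨flatT L c a.1, a.2⟩

variable (hlt : s + n + 2 < L)

/-- a vertex on the main string -/
def mv (i : ℕ) (hi : i ≤ s + n + 2) : FV L c := ⟨(i, 0), lt_of_le_of_lt hi hlt, Nat.zero_le _⟩
/-- an arrow on the main string, by its target -/
def ma (i : ℕ) (hi : i + 1 ≤ s + n + 2) : FA L c := ⟨(i + 1, 0), ⟨lt_of_le_of_lt hi hlt, Nat.zero_le _⟩, by simp⟩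

/-- the vertex `s` -/
def c01 : C1 L c s := ⟨mv L c s n hlt s (by omega), le_rfl⟩

/-- vertices -/
def phiV : C1 L c s ⊕ (Fin (n + 1) ⊕ D1 L c s n) → FV L c
  | Sum.inl x => x.1
  | Sum.inr (Sum.inl i) => mv L c s n hlt (s + 1 + i.1) (by have := i.2; omega)
  | Sum.inr (Sum.inr x) => x.1

/-- arrows -/
def phiA : AC1 L c s ⊕ (Fin n ⊕ AD1 L c s n) ⊕ Unit → FA L c
  | Sum.inl x => x.1
  | Sum.inr (Sum.inl (Sum.inl i)) => ma L c s n hlt (s + 1 + i.1) (by have := i.2; omega)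
  | Sum.inr (Sum.inl (Sum.inr x)) => x.1
  | Sum.inr (Sum.inr _) => ma L c s n hlt s (by omega)

lemma phiV_bij (hc : ∀ v : Fin L, s < v.1 → v.1 < s + n + 2 → c v = 0) : Function.Bijective (phiV L c s n hlt) := by
  constructor
  · rintro (⟨x, hx⟩ | i | ⟨x, hx⟩) (⟨y, hy⟩ | j | ⟨y, hy⟩) h <;> simp only [phiV] at h
    · subst h; rfl
    · subst h; simp [mv] at hx; omega
    · subst h; omega
    · subst h; simp [mv] at hy; omega
    · simp [mv] at h; rw [Fin.ext h]
    · subst h; have := i.2; simp [mv] at hy; omega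
    · subst h; omega
    · subst h; have := j.2; simp [mv] at hx; omega
    · subst h; rfl
  · rintro ⟨⟨v, j⟩, hv, hj⟩
    by_cases h1 : v ≤ s
    · exact ⟨Sum.inl ⟨⟨(v, j), hv, hj⟩, h1⟩, rfl⟩
    by_cases h2 : s + n + 2 ≤ v
    · exact ⟨Sum.inr (Sum.inr ⟨⟨(v, j), hv, hj⟩, h2⟩), rfl⟩
    · refine ⟨Sum.inr (Sum.inl ⟨v - (s + 1), by omega⟩), Subtype.ext (Prod.ext ?_ ?_)⟩
      · simp only [phiV, mv]; omega
      · rw [hc ⟨v, hv⟩ (by simp; omega) (by simp; omega)] at hj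
        simp only [phiV, mv]; simp at hj; omega

lemma phiA_bij (hc : ∀ v : Fin L, s < v.1 → v.1 < s + n + 2 → c v = 0) : Function.Bijective (phiA L c s n hlt) := by
  constructor
  · rintro (⟨x, hx⟩ | (i | ⟨x, hx⟩) | x) (⟨y, hy⟩ | (j | ⟨y, hy⟩) | y) h <;> simp only [phiA] at h
    · subst h; rfl
    · subst h; simp [ma] at hx; omega
    · subst h; omega
    · subst h; simp [ma] at hx
    · subst h; simp [ma] at hy; omega
    · simp [ma] at h; rw [Fin.ext h]
    · subst h; have := i.2; simp [ma] at hy; omega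
    · simp [ma] at h; omega
    · subst h; omega
    · subst h; have := j.2; simp [ma] at hx; omega
    · subst h; rfl
    · subst h; simp [ma] at hx <;> omega
    · subst h; simp [ma] at hy
    · simp [ma] at h; omega
    · subst h; simp [ma] at hy <;> omega
    · rfl
  · rintro ⟨⟨v, j⟩, ⟨hv, hj⟩, h0⟩
    by_cases h1 : v ≤ s
    · exact ⟨Sum.inl ⟨⟨(v, j), ⟨hv, hj⟩, h0⟩, h1⟩, rfl⟩
    by_cases h2 : s + n + 2 ≤ v
    · exact ⟨Sum.inr (Sum.inl (Sum.inr ⟨⟨(v, j), ⟨hv, hj⟩, h0⟩, h2⟩)), rfl⟩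
    rw [hc ⟨v, hv⟩ (by simp; omega) (by simp; omega)] at hj
    simp at hj
    by_cases h3 : v = s + 1
    · refine ⟨Sum.inr (Sum.inr ()), Subtype.ext (Prod.ext ?_ ?_)⟩
      · simp only [phiA, ma]; omega
      · simp only [phiA, ma]; omega
    · refine ⟨Sum.inr (Sum.inl (Sum.inl ⟨v - (s + 2), by omega⟩)), Subtype.ext (Prod.ext ?_ ?_)⟩
      · simp only [phiA, ma]; omega
      · simp only [phiA, ma]; omega

/-- one end of an arrow after the mutation -/
abbrev u2 (a : FA L c) : FV L c := flatS L c a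
/-- the other end of an arrow after the mutation -/
def w2 (a : FA L c) : FV L c := if a.1 = (s + 1, 0) then mv L c s n hlt (s + n + 1) (by omega) else flatT L c a

/-- the orientation after the mutation -/
def F0 (a : FA L c) : Bool := decide (a.1 = (s + 1, 0))

lemma sig_phi (a : AD1 L c s n) : flatS L c a.1 =
    phiV L c s n hlt (Sum.inr ((sig1 L c s n a).elim (Sum.inl (Fin.last n)) Sum.inr)) := by
  rw [sig1]
  split_ifs with h
  · rfl
  · obtain ⟨⟨⟨v, j⟩, ⟨hv, hj⟩, h0⟩, ha⟩ := a
    simp only [flatS] at h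
    simp only at ha
    apply Subtype.ext
    by_cases hj0 : j = 0
    · subst hj0
      simp only [if_true] at h
      simp only [flatS, if_true, phiV, Option.elim, mv, Fin.val_last]
      refine Prod.ext ?_ rfl
      simp only
      omega
    · simp [hj0] at h; omega

lemma list_chain (hn : ∀ b : AD1 L c s n, sig1 L c s n b = none → b.1.1 = (s + n + 2, 0)) (b : AD1 L c s n) (hb : sig1 L c s n b = none) :
    ((chainRel (AC := AC1 L c s) n b).map (phiA L c s n hlt)).map Subtype.val = (List.range (n + 2)).map fun j => (s + j + 1, 0) := by
  rw [List.range_succ, List.range_succ_eq_map]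
  simp only [chainRel, List.map_append, List.map_cons, List.map_nil, List.map_map, phiA, ma, hn b hb]
  rw [← List.map_coe_finRange_eq_range, List.map_map]
  congr 1
  · congr 1
    apply List.map_congr_left
    intro i _
    simp [phiA, ma]
    omega

lemma sig_none (b : AD1 L c s n) (hb : sig1 L c s n b = none) : b.1.1 = (s + n + 2, 0) := by
  rw [sig1] at hb
  split_ifs at hb with h
  obtain ⟨⟨⟨v, j⟩, ⟨hv, hj⟩, h0⟩, ha⟩ := b
  simp only [flatS] at h
  simp only at ha ⊢
  by_cases hj0 : j = 0
  · subst hj0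
    simp only [if_true] at h
    refine Prod.ext ?_ rfl
    simp only
    omega
  · simp [hj0] at h; omega

theorem deq_step1 (hc : ∀ v : Fin L, s < v.1 → v.1 < s + n + 2 → c v = 0)
    (rels : Set (ℕ × ℕ)) (hmem : (s, n + 2) ∈ rels)
    (hoth : ∀ q ∈ rels, q ≠ (s, n + 2) → s + n + 2 ≤ q.1 + 1 ∧ 2 ≤ q.2) :
    DEq (Rep' k ⟨FV L c, FA L c, flatS L c, flatT L c⟩ (flatR L c rels))
      (Rep' k (Qo (u2 L c) (w2 L c s n hlt) (F0 L c s)) (flatR L c (rels \ {(s, n + 2)}))) := by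
  let eV := Equiv.ofBijective _ (phiV_bij L c s n hlt hc)
  let eA := Equiv.ofBijective _ (phiA_bij L c s n hlt hc)
  let RB : Set (List (AC1 L c s ⊕ (Fin n ⊕ AD1 L c s n) ⊕ Unit)) := {p | p.map (phiA L c s n hlt) ∈ flatR L c (rels \ {(s, n + 2)})}
  have hmm : ∀ p : List (FA L c), (p.map eA.symm).map (phiA L c s n hlt) = p := by
    intro p
    have := congrArg (fun f => p.map f) (Equiv.self_comp_symm eA)
    exact List.map_map.trans (this.trans (List.map_id _))
  have hmm' : ∀ p : List (AC1 L c s ⊕ (Fin n ⊕ AD1 L c s n) ⊕ Unit), (p.map (phiA L c s n hlt)).map eA.symm = p := by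
    intro p
    have := congrArg (fun f => p.map f) (Equiv.symm_comp_self eA)
    exact List.map_map.trans (this.trans (List.map_id _))
  have hRB : ∀ p ∈ RB, ∃ q : List (AD1 L c s n), q ≠ [] ∧ p = q.map fun b => Sum.inr (Sum.inl (Sum.inr b)) := by
    rintro p ⟨q, ⟨hq, hq'⟩, hp⟩
    obtain ⟨h1, h2⟩ := hoth q hq hq'
    have hall : ∀ a ∈ p, ∃ b, a = Sum.inr (Sum.inl (Sum.inr b)) := by
      intro a ha
      have : (phiA L c s n hlt a).1 ∈ (List.range q.2).map fun j => (q.1 + j + 1, 0) := by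
        rw [← hp]
        exact List.mem_map_of_mem (List.mem_map_of_mem ha)
      obtain ⟨j, -, hj⟩ := List.mem_map.1 this
      rcases a with ⟨a, ha'⟩ | (i | b) | a
      · simp only [phiA] at hj; rw [← hj] at ha'; simp only at ha'; omega
      · have := i.2; simp [phiA, ma] at hj; omega
      · exact ⟨b, rfl⟩
      · simp [phiA, ma] at hj; omega
    have hne : p ≠ [] := by
      rintro rfl
      have := congrArg List.length hp
      simp at this
      omega
    clear hp
    have : ∃ q : List (AD1 L c s n), p = q.map fun b => Sum.inr (Sum.inl (Sum.inr b)) := by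
      clear hne
      induction p with
      | nil => exact ⟨[], rfl⟩
      | cons a p ih =>
        obtain ⟨q, rfl⟩ := ih (fun a ha => hall a (List.mem_cons_of_mem _ ha))
        obtain ⟨b, rfl⟩ := hall a List.mem_cons_self
        exact ⟨b :: q, rfl⟩
    obtain ⟨q, rfl⟩ := this
    exact ⟨q, by rintro rfl; exact hne rfl, rfl⟩
  have M := chainMD k (sC1 L c s) (tC1 L c s) n (sig1 L c s n) (tau1 L c s n) (c01 L c s n hlt) RB hRB
  refine DEq.trans (DEq.symm ?_) (M.deq.trans ?_)
  · refine deq_iso k _ _ eV eA ?_ ?_ ?_ ?_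
    · rintro (a | (i | a) | a)
      · rfl
      · apply Subtype.ext
        simp [eA, eV, phiA, phiV, ma, mv, flatS]
      · exact sig_phi L c s n hlt a
      · rfl
    · rintro (a | (i | a) | a)
      · rfl
      · apply Subtype.ext
        simp [eA, eV, phiA, phiV, ma, mv, flatT]
        omega
      · rfl
      · rfl
    · rintro p (⟨q, hq, hp⟩ | ⟨b, hb, rfl⟩)
      · exact ⟨q, hq.1, hp⟩
      · exact ⟨_, hmem, list_chain L c s n hlt (sig_none L c s n) b hb⟩
    · rintro p ⟨q, hq, hp⟩
      by_cases h : q = (s, n + 2)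
      · right
        subst h
        let b0 : AD1 L c s n := ⟨ma L c s n hlt (s + n + 1) (by omega), by simp [ma]⟩
        have hb0 : sig1 L c s n b0 = none := by
          rw [sig1, dif_neg]
          simp [b0, ma, flatS]
        refine ⟨b0, hb0, ?_⟩
        rw [← list_chain L c s n hlt (sig_none L c s n) b0 hb0] at hp
        rw [Subtype.val_injective.list_map hp]
        exact hmm' _
      · left
        refine ⟨q, ⟨hq, h⟩, ?_⟩
        rw [← hp]
        exact congrArg (List.map Subtype.val) (hmm p)
  · have hF : ∀ a : FA L c, a.1 ≠ (s + 1, 0) → F0 L c s a = false := fun a ha => by simp [F0, ha]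
    have hF' : ∀ a : FA L c, a.1 ≠ (s + 1, 0) → w2 L c s n hlt a = flatT L c a := fun a ha => by simp [w2, ha]
    have hs : ∀ a : FA L c, a.1 ≠ (s + 1, 0) → (Qo (u2 L c) (w2 L c s n hlt) (F0 L c s)).s a = flatS L c a :=
      fun a ha => by simp [hF a ha]
    have ht : ∀ a : FA L c, a.1 ≠ (s + 1, 0) → (Qo (u2 L c) (w2 L c s n hlt) (F0 L c s)).t a = flatT L c a :=
      fun a ha => by simp [hF a ha, hF' a ha]
    refine deq_iso k _ _ eV eA ?_ ?_ ?_ ?_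
    · rintro (a | (i | a) | a)
      · exact hs a.1 (fun h => by have := a.2; rw [h] at this; simp at this)
      · refine (hs _ (by simp [eA, phiA, ma]; omega)).trans ?_
        apply Subtype.ext
        simp [eA, eV, phiA, phiV, ma, mv, flatS]
      · refine (hs a.1 (fun h => by have := a.2; rw [h] at this; simp at this <;> omega)).trans ?_
        exact sig_phi L c s n hlt a
      · apply Subtype.ext
        simp [eA, eV, phiA, phiV, ma, mv, F0, w2]
        omega
    · rintro (a | (i | a) | a)
      · exact ht a.1 (fun h => by have := a.2; rw [h] at this; simp at this)
      · refine (ht _ (by simp [eA, phiA, ma]; omega)).trans ?_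
        apply Subtype.ext
        simp [eA, eV, phiA, phiV, ma, mv, flatT]
        omega
      · exact ht a.1 (fun h => by have := a.2; rw [h] at this; simp at this <;> omega)
      · apply Subtype.ext
        simp [eA, eV, phiA, phiV, ma, mv, F0, w2, c01, flatS]
    · exact fun p hp => hp
    · intro p hp
      change List.map (phiA L c s n hlt) (p.map eA.symm) ∈ flatR L c (rels \ {(s, n + 2)})
      rw [hmm]
      exact hp

end step1
end QuipuDE

open CategoryTheory

namespace QuipuDE
open CategoryTheory Category Limits

section flips
variable (k : Type) [Field k] (L : ℕ) (c : Fin L → ℕ) (s n : ℕ) (hlt : s + n + 2 < L)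

/-- The vertices before `s + n + 1` are not touched by the remaining relations. -/
lemma flatR_avoid (rels : Set (ℕ × ℕ)) (hoth : ∀ q ∈ rels, s + n + 2 ≤ q.1 + 1 ∧ 2 ≤ q.2)
    (r : FV L c) (hr : r.1.1 < s + n + 1) :
    ∀ p ∈ flatR L c rels, p ≠ [] ∧ ∀ a ∈ p, u2 L c a ≠ r ∧ w2 L c s n hlt a ≠ r := by
  rintro p ⟨q, hq, hp⟩
  obtain ⟨h1, h2⟩ := hoth q hq
  refine ⟨?_, ?_⟩
  · rintro rfl
    have := congrArg List.length hp
    simp at this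
    omega
  · intro a ha
    have : a.1 ∈ (List.range q.2).map fun j => (q.1 + j + 1, 0) := by
      rw [← hp]
      exact List.mem_map_of_mem ha
    obtain ⟨j, -, hj⟩ := List.mem_map.1 this
    obtain ⟨⟨v, i⟩, ha0⟩ := a
    simp only [Prod.mk.injEq] at hj
    obtain ⟨hj1, hj2⟩ := hj
    subst hj1 hj2
    refine ⟨?_, ?_⟩
    · rintro rfl
      simp [flatS] at hr
      omega
    · rintro rfl
      rw [w2, if_neg (by simp; omega)] at hr
      simp [flatT] at hr
      omega

lemma u2_val (a : FA L c) (x y : ℕ) (h : (u2 L c a).1 = (x, y)) :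
    (a.1 = (x + 1, 0) ∧ y = 0) ∨ a.1 = (x, y + 1) := by
  obtain ⟨⟨v, i⟩, hv, h0⟩ := a
  simp only [flatS, Prod.mk.injEq] at h
  simp only [Prod.mk.injEq, ne_eq] at h0 ⊢
  split_ifs at h <;> omega

lemma w2_val (a : FA L c) (x y : ℕ) (h : (w2 L c s n hlt a).1 = (x, y)) :
    (a.1 = (s + 1, 0) ∧ x = s + n + 1 ∧ y = 0) ∨ a.1 = (x, y) := by
  rw [w2] at h
  split_ifs at h with h1
  · left
    simp [mv] at h
    exact ⟨h1, by omega, by omega⟩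
  · exact Or.inr h

lemma u2_ne_w2 (a : FA L c) : u2 L c a ≠ w2 L c s n hlt a := by
  intro h
  have h1 := w2_val L c s n hlt a _ _ (congrArg Subtype.val h).symm
  obtain ⟨⟨v, i⟩, hv, h0⟩ := a
  simp only [flatS, Prod.mk.injEq, ne_eq] at h1 h0
  split_ifs at h1 <;> omega

variable (rels : Set (ℕ × ℕ)) (hoth : ∀ q ∈ rels, s + n + 2 ≤ q.1 + 1 ∧ 2 ≤ q.2)

lemma flippable_cord (hoth : ∀ q ∈ rels, s + n + 2 ≤ q.1 + 1 ∧ 2 ≤ q.2) (m : ℕ) :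
    ∀ a : FA L c, a.1.1 ≤ s → a.1.2 ≠ 0 → (∀ h, c ⟨a.1.1, h⟩ ≤ a.1.2 + m) →
      Flippable k (flatR L c rels) (u2 L c) (w2 L c s n hlt) a := by
  induction m with
  | zero =>
    intro a h1 h2 h3
    obtain ⟨⟨v, i⟩, ⟨hv, hi⟩, h0⟩ := a
    refine flippable_of k _ _ _ ⟨(v, i), hv, hi⟩ _ (Or.inr ?_) (u2_ne_w2 L c s n hlt)
      (flatR_avoid L c s n hlt rels hoth _ (by simp at h1 ⊢; omega)) ?_
    · rw [w2, if_neg]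
      · rfl
      · rintro h; simp at h h2; omega
    · rintro b (hb | hb) hne
      · rcases u2_val L c b v i (congrArg Subtype.val hb) with ⟨h4, h5⟩ | h4
        · exact absurd h5 h2
        · obtain ⟨b0, ⟨hbv, hbi⟩, hb0⟩ := b
          simp only at h4 h3
          subst h4
          have := h3 hv
          simp at hbi
          omega
      · rcases w2_val L c s n hlt b v i (congrArg Subtype.val hb) with ⟨h4, h5, h6⟩ | h4
        · exact absurd h6 h2
        · exact absurd (Subtype.ext h4) hne
  | succ m ih =>
    intro a h1 h2 h3
    obtain ⟨⟨v, i⟩, ⟨hv, hi⟩, h0⟩ := a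
    refine flippable_of k _ _ _ ⟨(v, i), hv, hi⟩ _ (Or.inr ?_) (u2_ne_w2 L c s n hlt)
      (flatR_avoid L c s n hlt rels hoth _ (by simp at h1 ⊢; omega)) ?_
    · rw [w2, if_neg]
      · rfl
      · rintro h; simp at h h2; omega
    · rintro b (hb | hb) hne
      · rcases u2_val L c b v i (congrArg Subtype.val hb) with ⟨h4, h5⟩ | h4
        · exact absurd h5 h2
        · apply ih
          · rw [h4]; exact h1
          · rw [h4]; simp
          · obtain ⟨b0, ⟨hbv, hbi⟩, hb0⟩ := b
            simp only at h4 h3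
            subst h4
            have := h3 hv
            intro _
            simp only
            omega
      · rcases w2_val L c s n hlt b v i (congrArg Subtype.val hb) with ⟨h4, h5, h6⟩ | h4
        · exact absurd h6 h2
        · exact absurd (Subtype.ext h4) hne

lemma flippable_main (hc : ∀ v : Fin L, s < v.1 → v.1 < s + n + 2 → c v = 0)
    (hoth : ∀ q ∈ rels, s + n + 2 ≤ q.1 + 1 ∧ 2 ≤ q.2) (i : ℕ) (hi : i ≤ s + n) :
    ∀ a : FA L c, a.1 = (i + 1, 0) →
      Flippable k (flatR L c rels) (u2 L c) (w2 L c s n hlt) a := by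
  induction i with
  | zero =>
    intro a ha
    refine flippable_of k _ _ _ (mv L c s n hlt 0 (by omega)) _ (Or.inl ?_) (u2_ne_w2 L c s n hlt)
      (flatR_avoid L c s n hlt rels hoth _ (by simp [mv])) ?_
    · apply Subtype.ext
      simp [flatS, ha, mv]
    · rintro b (hb | hb) hne
      · rcases u2_val L c b 0 0 (congrArg Subtype.val hb) with ⟨h4, h5⟩ | h4
        · exact absurd (Subtype.ext (h4.trans ha.symm)) hne
        · exact flippable_cord k L c s n hlt rels hoth (c ⟨0, by omega⟩) b (by simp [h4]) (by simp [h4])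
            (by simp [h4])
      · rcases w2_val L c s n hlt b 0 0 (congrArg Subtype.val hb) with ⟨h4, h5, h6⟩ | h4
        · omega
        · exact absurd h4 b.2.2
  | succ i ih =>
    intro a ha
    refine flippable_of k _ _ _ (mv L c s n hlt (i + 1) (by omega)) _ (Or.inl ?_) (u2_ne_w2 L c s n hlt)
      (flatR_avoid L c s n hlt rels hoth _ (by simp [mv]; omega)) ?_
    · apply Subtype.ext
      simp [flatS, ha, mv]
    · rintro b (hb | hb) hne
      · rcases u2_val L c b (i + 1) 0 (congrArg Subtype.val hb) with ⟨h4, h5⟩ | h4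
        · exact absurd (Subtype.ext (h4.trans ha.symm)) hne
        · by_cases h5 : i + 1 ≤ s
          · exact flippable_cord k L c s n hlt rels hoth (c ⟨i + 1, by omega⟩) b (by simp [h4, h5]) (by simp [h4])
              (by simp [h4])
          · obtain ⟨b0, ⟨hbv, hbi⟩, hb0⟩ := b
            simp only at h4
            subst h4
            rw [hc _ (by simp; omega) (by simp; omega)] at hbi
            simp at hbi
      · rcases w2_val L c s n hlt b (i + 1) 0 (congrArg Subtype.val hb) with ⟨h4, h5, h6⟩ | h4
        · omega
        · exact ih (by omega) b h4

/-- The orientation of the target quipu. -/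
def F1 (a : FA L c) : Bool := decide (s + 2 ≤ a.1.1 ∧ a.1.1 ≤ s + n + 1)

theorem deq_step2 (hc : ∀ v : Fin L, s < v.1 → v.1 < s + n + 2 → c v = 0)
    (hoth : ∀ q ∈ rels, s + n + 2 ≤ q.1 + 1 ∧ 2 ≤ q.2) :
    DEq (Rep' k (Qo (u2 L c) (w2 L c s n hlt) (F0 L c s)) (flatR L c rels))
      (Rep' k (Qo (u2 L c) (w2 L c s n hlt) (F1 L c s n)) (flatR L c rels)) := by
  refine deq_flips k _ _ _ _ _ ?_
  intro a
  obtain ⟨⟨v, i⟩, ⟨hv, hi⟩, h0⟩ := a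
  by_cases h : s + 1 ≤ v ∧ v ≤ s + n + 1
  · right
    have hi0 : i = 0 := by
      rw [hc _ (by simp; omega) (by simp; omega)] at hi
      simpa using hi
    refine flippable_main k L c s n hlt rels hc hoth (v - 1) (by omega) _ ?_
    simp [hi0]; omega
  · left
    have h1 : ¬ (v = s + 1 ∧ i = 0) := by omega
    have h2 : ¬ (s + 2 ≤ v ∧ v ≤ s + n + 1) := by omega
    simp only [F0, F1, Prod.mk.injEq, decide_eq_decide]
    exact iff_of_false h1 h2

end flips
end QuipuDE

open CategoryTheory

namespace QuipuDE
open CategoryTheory Category Limits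

section swap
variable (k : Type) [Field k] (L : ℕ) (c : Fin L → ℕ) (s n : ℕ)

/-- vertex labels, forward -/
def pV (p : ℕ × ℕ) : ℕ × ℕ :=
  if p.1 ≤ s then p else if p.1 < s + n + 2 then (s + 1, s + n + 1 - p.1) else (p.1 - n, p.2)
/-- vertex labels, backward -/
def qV (p : ℕ × ℕ) : ℕ × ℕ :=
  if p.1 ≤ s then p else if p.1 = s + 1 then (s + n + 1 - p.2, 0) else (p.1 + n, p.2)
/-- arrow labels, forward -/
def pA (p : ℕ × ℕ) : ℕ × ℕ :=
  if p.1 ≤ s then p else if p.1 = s + 1 then (s + 1, 0) else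
    if p.1 < s + n + 2 then (s + 1, s + n + 2 - p.1) else (p.1 - n, p.2)
/-- arrow labels, backward -/
def qA (p : ℕ × ℕ) : ℕ × ℕ :=
  if p.1 ≤ s then p else if p.1 = s + 1 then (if p.2 = 0 then (s + 1, 0) else (s + n + 2 - p.2, 0))
    else (p.1 + n, p.2)

lemma lab_qpV (s n v j : ℕ) (h : s < v → v < s + n + 2 → j = 0) : qV s n (pV s n (v, j)) = (v, j) := by
  grind [pV, qV]
lemma lab_pqV (s n v j : ℕ) (h : v = s + 1 → j ≤ n) : pV s n (qV s n (v, j)) = (v, j) := by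
  grind [pV, qV]
lemma lab_qpA (s n v j : ℕ) (h : s < v → v < s + n + 2 → j = 0) : qA s n (pA s n (v, j)) = (v, j) := by
  grind [pA, qA]
lemma lab_pqA (s n v j : ℕ) (h : v = s + 1 → j ≤ n) : pA s n (qA s n (v, j)) = (v, j) := by
  grind [pA, qA]
lemma lab_qAr (s n v j : ℕ) (h : s + n + 2 ≤ v + 1) : qA s n (v + 2 - (n + 2) + j + 1, 0) = (v + j + 1, 0) := by
  grind [qA]
lemma lab_pAr (s n v j : ℕ) (h : s + n + 2 ≤ v + 1) : pA s n (v + j + 1, 0) = (v + 2 - (n + 2) + j + 1, 0) := by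
  grind [pA]
lemma lab_srcF (s n v j : ℕ) (h : j = 0) (hF : s + 2 ≤ v ∧ v ≤ s + n + 1) :
    ((if (pA s n (v, j)).2 = 0 then (pA s n (v, j)).1 - 1 else (pA s n (v, j)).1), (pA s n (v, j)).2 - 1) =
      pV s n (v, j) := by
  grind [pA, pV]
lemma lab_srcN (s n v j : ℕ) (h : s < v → v < s + n + 2 → j = 0) (hne : ¬ (v = 0 ∧ j = 0))
    (hF : ¬ (s + 2 ≤ v ∧ v ≤ s + n + 1)) :
    ((if (pA s n (v, j)).2 = 0 then (pA s n (v, j)).1 - 1 else (pA s n (v, j)).1), (pA s n (v, j)).2 - 1) =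
      pV s n ((if j = 0 then v - 1 else v), j - 1) := by
  grind [pA, pV]
lemma lab_tgtF (s n v j : ℕ) (h : j = 0) (hF : s + 2 ≤ v ∧ v ≤ s + n + 1) :
    pA s n (v, j) = pV s n ((if j = 0 then v - 1 else v), j - 1) := by
  grind [pA, pV]
lemma lab_tgtS (s n : ℕ) : pA s n (s + 1, 0) = pV s n (s + n + 1, 0) := by
  grind [pA, pV]
lemma lab_tgtN (s n v j : ℕ) (h : s < v → v < s + n + 2 → j = 0) (h1 : ¬ (v = s + 1 ∧ j = 0))
    (hF : ¬ (s + 2 ≤ v ∧ v ≤ s + n + 1)) : pA s n (v, j) = pV s n (v, j) := by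
  grind [pA, pV]

/-- Compatibility of the cord lengths before and after the swap. -/
structure SwapC (L' : ℕ) (c' : Fin L' → ℕ) : Prop where
  hlt : s + n + 2 < L
  hL : L' + n = L
  h0 : ∀ v : Fin L, s < v.1 → v.1 < s + n + 2 → c v = 0
  h1 : ∀ (v : ℕ) (h : v < L') (h' : v < L), v ≤ s → c' ⟨v, h⟩ = c ⟨v, h'⟩
  h2 : ∀ h : s + 1 < L', c' ⟨s + 1, h⟩ = n
  h3 : ∀ (v : ℕ) (h : v < L') (h' : v + n < L), s + 2 ≤ v → c' ⟨v, h⟩ = c ⟨v + n, h'⟩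

variable {L c s n} {L' : ℕ} {c' : Fin L' → ℕ}

lemma SwapC.memp (H : SwapC L c s n L' c') (p : ℕ × ℕ) (hp : ∃ h : p.1 < L, p.2 ≤ c ⟨p.1, h⟩) :
    ∃ h : (pV s n p).1 < L', (pV s n p).2 ≤ c' ⟨(pV s n p).1, h⟩ := by
  obtain ⟨v, j⟩ := p
  obtain ⟨hv, hj⟩ := hp
  simp only at hv hj
  have hL := H.hL
  have hlt := H.hlt
  by_cases h1 : v ≤ s
  · have e : pV s n (v, j) = (v, j) := by simp [pV, h1]
    simp only [e]
    exact ⟨by omega, by rw [H.h1 v _ hv h1]; exact hj⟩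
  by_cases h2 : v < s + n + 2
  · have e : pV s n (v, j) = (s + 1, s + n + 1 - v) := by simp [pV, h1, h2]
    simp only [e]
    exact ⟨by omega, by rw [H.h2]; omega⟩
  · have e : pV s n (v, j) = (v - n, j) := by simp [pV, h1, h2]
    simp only [e]
    refine ⟨by omega, ?_⟩
    rw [H.h3 (v - n) _ (by omega) (by omega)]
    have : v - n + n = v := by omega
    simpa only [this] using hj

lemma SwapC.memq (H : SwapC L c s n L' c') (p : ℕ × ℕ) (hp : ∃ h : p.1 < L', p.2 ≤ c' ⟨p.1, h⟩) :
    ∃ h : (qV s n p).1 < L, (qV s n p).2 ≤ c ⟨(qV s n p).1, h⟩ := by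
  obtain ⟨v, j⟩ := p
  obtain ⟨hv, hj⟩ := hp
  simp only at hv hj
  have hL := H.hL
  have hlt := H.hlt
  by_cases h1 : v ≤ s
  · have e : qV s n (v, j) = (v, j) := by simp [qV, h1]
    simp only [e]
    exact ⟨by omega, by rw [← H.h1 v hv _ h1]; exact hj⟩
  by_cases h2 : v = s + 1
  · have e : qV s n (v, j) = (s + n + 1 - j, 0) := by simp [qV, h2]
    simp only [e]
    exact ⟨by omega, Nat.zero_le _⟩
  · have e : qV s n (v, j) = (v + n, j) := by simp [qV, h1, h2]
    simp only [e]
    refine ⟨by omega, ?_⟩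
    rw [← H.h3 v hv (by omega) (by omega)]
    exact hj

lemma SwapC.zero (H : SwapC L c s n L' c') (p : ℕ × ℕ) (hp : ∃ h : p.1 < L, p.2 ≤ c ⟨p.1, h⟩)
    (h1 : s < p.1) (h2 : p.1 < s + n + 2) : p.2 = 0 := by
  obtain ⟨hv, hj⟩ := hp
  rw [H.h0 _ h1 h2] at hj
  simpa using hj

lemma SwapC.le (H : SwapC L c s n L' c') (p : ℕ × ℕ) (hp : ∃ h : p.1 < L', p.2 ≤ c' ⟨p.1, h⟩)
    (h1 : p.1 = s + 1) : p.2 ≤ n := by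
  obtain ⟨v, j⟩ := p
  simp only at h1
  subst h1
  obtain ⟨hv, hj⟩ := hp
  exact hj.trans (H.h2 hv).le

/-- vertices -/
def SwapC.eV (H : SwapC L c s n L' c') : FV L c ≃ FV L' c' where
  toFun p := ⟨pV s n p.1, H.memp p.1 p.2⟩
  invFun p := ⟨qV s n p.1, H.memq p.1 p.2⟩
  left_inv := fun p => Subtype.ext (lab_qpV s n p.1.1 p.1.2 (H.zero _ p.2))
  right_inv := fun p => Subtype.ext (lab_pqV s n p.1.1 p.1.2 (H.le _ p.2))

lemma SwapC.memA (H : SwapC L c s n L' c') (p : ℕ × ℕ)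
    (hp : (∃ h : p.1 < L, p.2 ≤ c ⟨p.1, h⟩) ∧ p ≠ (0, 0)) :
    (∃ h : (pA s n p).1 < L', (pA s n p).2 ≤ c' ⟨(pA s n p).1, h⟩) ∧ pA s n p ≠ (0, 0) := by
  obtain ⟨v, j⟩ := p
  obtain ⟨hp, hne⟩ := hp
  have h0 := H.zero _ hp
  have hL := H.hL
  have hlt := H.hlt
  have hm := H.memp _ hp
  simp only at h0
  refine ⟨?_, by grind [pA]⟩
  by_cases h1 : v = s + 1
  · have e : pA s n (v, j) = (s + 1, 0) := by grind [pA]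
    simp only [e]
    exact ⟨by omega, Nat.zero_le _⟩
  by_cases h2 : s + 2 ≤ v ∧ v ≤ s + n + 1
  · have e : pA s n (v, j) = (s + 1, s + n + 2 - v) := by grind [pA]
    simp only [e]
    exact ⟨by omega, by rw [H.h2]; omega⟩
  · rw [lab_tgtN s n v j h0 (by omega) h2]
    exact hm

lemma SwapC.memA' (H : SwapC L c s n L' c') (p : ℕ × ℕ)
    (hp : (∃ h : p.1 < L', p.2 ≤ c' ⟨p.1, h⟩) ∧ p ≠ (0, 0)) :
    (∃ h : (qA s n p).1 < L, (qA s n p).2 ≤ c ⟨(qA s n p).1, h⟩) ∧ qA s n p ≠ (0, 0) := by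
  obtain ⟨v, j⟩ := p
  obtain ⟨hp, hne⟩ := hp
  have h0 := H.le _ hp
  have hL := H.hL
  have hlt := H.hlt
  have hm := H.memq _ hp
  simp only at h0
  refine ⟨?_, by grind [qA]⟩
  by_cases h1 : v = s + 1
  · have e : (qA s n (v, j)).2 = 0 := by grind [qA]
    have e' : (qA s n (v, j)).1 < L := by grind [qA]
    exact ⟨e', e.le.trans (Nat.zero_le _)⟩
  · have e : qA s n (v, j) = qV s n (v, j) := by grind [qA, qV]
    rw [e]
    exact hm

/-- arrows -/
def SwapC.eA (H : SwapC L c s n L' c') : FA L c ≃ FA L' c' where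
  toFun p := ⟨pA s n p.1, H.memA p.1 p.2⟩
  invFun p := ⟨qA s n p.1, H.memA' p.1 p.2⟩
  left_inv := fun p => Subtype.ext (lab_qpA s n p.1.1 p.1.2 (H.zero _ p.2.1))
  right_inv := fun p => Subtype.ext (lab_pqA s n p.1.1 p.1.2 (H.le _ p.2.1))

theorem deq_step3 (H : SwapC L c s n L' c') (rels : Set (ℕ × ℕ))
    (hoth : ∀ q ∈ rels, s + n + 2 ≤ q.1 + 1 ∧ 2 ≤ q.2) :
    DEq (Rep' k (Qo (u2 L c) (w2 L c s n H.hlt) (F1 L c s n)) (flatR L c rels))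
      (Rep' k ⟨FV L' c', FA L' c', flatS L' c', flatT L' c'⟩
        (flatR L' c' ((fun p : ℕ × ℕ => (p.1 + 2 - (n + 2), p.2)) '' rels))) := by
  have hval : ∀ p : List (FA L c), (p.map H.eA).map Subtype.val = (p.map Subtype.val).map (pA s n) := by
    intro p
    rw [List.map_map, List.map_map]
    rfl
  refine deq_iso k _ _ H.eV H.eA ?_ ?_ ?_ ?_
  · rintro ⟨⟨v, j⟩, hp, hne⟩
    have h0 := H.zero _ hp
    simp only at h0
    apply Subtype.ext
    by_cases hF : s + 2 ≤ v ∧ v ≤ s + n + 1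
    · have hj := h0 (by omega) (by omega)
      have e1 : F1 L c s n ⟨(v, j), hp, hne⟩ = true := decide_eq_true hF
      have e2 : w2 L c s n H.hlt ⟨(v, j), hp, hne⟩ = ⟨(v, j), hp⟩ := if_neg (by simp; omega)
      simp only [e1, cond, e2]
      exact lab_srcF s n v j hj hF
    · have e1 : F1 L c s n ⟨(v, j), hp, hne⟩ = false := decide_eq_false hF
      simp only [e1, cond]
      exact lab_srcN s n v j h0 (by simpa using hne) hF
  · rintro ⟨⟨v, j⟩, hp, hne⟩
    have h0 := H.zero _ hp
    simp only at h0
    apply Subtype.ext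
    by_cases hF : s + 2 ≤ v ∧ v ≤ s + n + 1
    · have hj := h0 (by omega) (by omega)
      have e1 : F1 L c s n ⟨(v, j), hp, hne⟩ = true := decide_eq_true hF
      simp only [e1, cond]
      exact lab_tgtF s n v j hj hF
    · have e1 : F1 L c s n ⟨(v, j), hp, hne⟩ = false := decide_eq_false hF
      simp only [e1, cond]
      by_cases hs : v = s + 1 ∧ j = 0
      · obtain ⟨rfl, rfl⟩ := hs
        have e2 : w2 L c s n H.hlt ⟨(s + 1, 0), hp, hne⟩ = mv L c s n H.hlt (s + n + 1) (by omega) := if_pos rfl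
        simp only [e2]
        exact lab_tgtS s n
      · have e2 : w2 L c s n H.hlt ⟨(v, j), hp, hne⟩ = ⟨(v, j), hp⟩ := if_neg (by simp; omega)
        simp only [e2]
        exact lab_tgtN s n v j h0 hs hF
  · rintro p ⟨q, hq, hp⟩
    refine ⟨_, ⟨q, hq, rfl⟩, ?_⟩
    refine (hval p).trans ((congrArg (List.map (pA s n)) hp).trans ?_)
    rw [List.map_map]
    exact List.map_congr_left fun j _ => lab_pAr s n q.1 j (hoth q hq).1
  · rintro p ⟨_, ⟨q, hq, rfl⟩, hp⟩
    refine ⟨q, hq, ?_⟩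
    have h1 : (p.map H.eA.symm).map Subtype.val = (p.map Subtype.val).map (qA s n) := by
      rw [List.map_map, List.map_map]
      rfl
    refine h1.trans ((congrArg (List.map (qA s n)) hp).trans ?_)
    rw [List.map_map]
    exact List.map_congr_left fun j _ => lab_qAr s n q.1 j (hoth q hq).1

end swap
end QuipuDE

open CategoryTheory

/-- Let `Q` be a quipu quiver with almost separate relations and let
`(s, l)` be the first relation along its main string.  Then the algebra of `Q` is derived
equivalent to the algebra of the quipu quiver with relations `Q'` which is identical to `Q`
except that the relation is removed, the main-string path of length `l` from `s` to
`t = s + l` is replaced by a path `s → t' → t` of length `2`, and a cord of length `l - 2`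
is attached at the new vertex `t'`. -/
theorem firstSwap_derivedEquivalent (k : Type) [Field k] (Q : QRData) (hV : Q.Valid)
    (s l : ℕ) (hmem : (s, l) ∈ Q.rels)
    (hfirst : ∀ q ∈ Q.rels, q ≠ (s, l) → s < q.1)
    (hlt : s + l < Q.L) (hl : 2 ≤ l) :
    DerivedEquivalent k (Q.algebra k) ((FirstSwap Q s l hlt hl).algebra k) := by
  obtain ⟨n, rfl⟩ : ∃ n, l = n + 2 := ⟨l - 2, by omega⟩
  have hoth : ∀ q ∈ Q.rels, q ≠ (s, n + 2) → s + n + 2 ≤ q.1 + 1 ∧ 2 ≤ q.2 := by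
    intro q hq hne
    refine ⟨?_, hV.two_le q hq⟩
    have h1 := hV.almost_separate q hq _ hmem hne
    have h2 := hV.two_le q hq
    have h3 := hfirst q hq hne
    simp only at h1
    omega
  have hoth' : ∀ q ∈ Q.rels \ {(s, n + 2)}, s + n + 2 ≤ q.1 + 1 ∧ 2 ≤ q.2 :=
    fun q hq => hoth q hq.1 hq.2
  have hc : ∀ v : Fin Q.L, s < v.1 → v.1 < s + n + 2 → Q.c v = 0 := by
    intro v h1 h2
    by_contra h
    exact hV.no_cord_internal _ hmem v h ⟨h1, h2⟩
  have hlt' : s + n + 2 < Q.L := hlt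
  have H : QuipuDE.SwapC Q.L Q.c s n (FirstSwap Q s (n + 2) hlt hl).L (FirstSwap Q s (n + 2) hlt hl).c := by
    have hL : (FirstSwap Q s (n + 2) hlt hl).L = Q.L + 2 - (n + 2) := rfl
    refine ⟨hlt', by omega, hc, ?_, ?_, ?_⟩
    · intro v h h' hv
      exact dif_pos hv
    · intro h
      exact (dif_neg (by simp)).trans ((dif_pos rfl).trans (by omega))
    · intro v h h' hv
      exact (dif_neg (by simp; omega)).trans (dif_neg (by simp; omega))
  have hend : ∀ q ∈ (FirstSwap Q s (n + 2) hlt hl).rels, q.1 + q.2 < (FirstSwap Q s (n + 2) hlt hl).L := by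
    rintro _ ⟨q, hq, rfl⟩
    have h1 := hV.end_lt q hq.1
    have h2 := hoth' q hq
    change q.1 + 2 - (n + 2) + q.2 < Q.L + 2 - (n + 2)
    omega
  exact ((((((QuipuDE.deq_mod k _).symm.trans (QuipuDE.deq_flat Q.L Q.c k Q.rels hV.end_lt)).trans
    (QuipuDE.deq_step1 k Q.L Q.c s n hlt' hc Q.rels hmem hoth)).trans
    (QuipuDE.deq_step2 k Q.L Q.c s n hlt' _ hc hoth')).trans
    (QuipuDE.deq_step3 k H _ hoth')).trans
    (QuipuDE.deq_flat _ _ k (FirstSwap Q s (n + 2) hlt hl).rels hend).symm).trans (QuipuDE.deq_mod k _)
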